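/- arXiv:1712.08431 — 2 statements merged into one kernel-verified Lean document; each statement's English description precedes it below -/
import Mathlib

section
/- Let n ≥ 3 and let Ω ⊂ ℝⁿ be a bounded strictly convex open set with smooth boundary which is rotationally symmetric about the xₙ-axis. Let f : ℝ → ℝ be real analytic and nondecreasing, and let u be a positive solution of the Dirichlet problem div(∇u/√(1+|∇u|²)) = f(u) in Ω, u = 0 on ∂Ω, which is C¹ up to the closure of Ω. Then u is rotationally symmetric about the xₙ-axis, i.e. u(g x) = u(x) for every rotation g about the xₙ-axis and every x ∈ Ω (equivalently, u(x) = v(|x'|, xₙ) for some function v of two variables, where x' = (x₁,…,x_{n−1})), and u is strictly radially decreasing in x': for every x ∈ Ω with x' ≠ 0 one has Σ_{i=1}^{n−1} xᵢ ∂ᵢu(x) < 0. -/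
open Set Metric

noncomputable section

/-- The coefficients `a_{ij}(p) = (1+|p|²)^{-1/2}(δ_{ij} − pᵢpⱼ/(1+|p|²))`
of the mean curvature operator. -/
def mcCoeff {n : ℕ} (p : EuclideanSpace ℝ (Fin n)) (i j : Fin n) : ℝ :=
  (Real.sqrt (1 + ‖p‖ ^ 2))⁻¹ * ((if i = j then 1 else 0) - p i * p j / (1 + ‖p‖ ^ 2))

/-- Second partial derivative `∂²u/∂xᵢ∂xⱼ`. -/
def hessEntry {n : ℕ} (u : EuclideanSpace ℝ (Fin n) → ℝ) (x : EuclideanSpace ℝ (Fin n))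
    (i j : Fin n) : ℝ :=
  iteratedFDeriv ℝ 2 u x ![EuclideanSpace.single i 1, EuclideanSpace.single j 1]

/-- The Hessian matrix `D²u(x)`. -/
def hessMatrix {n : ℕ} (u : EuclideanSpace ℝ (Fin n) → ℝ) (x : EuclideanSpace ℝ (Fin n)) :
    Matrix (Fin n) (Fin n) ℝ :=
  Matrix.of fun i j => hessEntry u x i j

/-- The mean curvature operator `L u = div(∇u/√(1+|∇u|²)) = Σ a_{ij}(∇u) ∂²u/∂xᵢ∂xⱼ`. -/
def meanCurv {n : ℕ} (u : EuclideanSpace ℝ (Fin n) → ℝ) (x : EuclideanSpace ℝ (Fin n)) : ℝ :=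
  ∑ i, ∑ j, mcCoeff (gradient u x) i j * hessEntry u x i j

/-- A solution of the Dirichlet problem `L u = f(u)` in `Ω`, `u = 0` on `∂Ω`:
`u ∈ C²(Ω) ∩ C(closure Ω)`. -/
def IsMCSolution {n : ℕ} (Ω : Set (EuclideanSpace ℝ (Fin n))) (f : ℝ → ℝ)
    (u : EuclideanSpace ℝ (Fin n) → ℝ) : Prop :=
  ContDiffOn ℝ 2 u Ω ∧ ContinuousOn u (closure Ω) ∧
    (∀ x ∈ Ω, meanCurv u x = f (u x)) ∧ (∀ x ∈ frontier Ω, u x = 0)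

/-- `Ω` has smooth boundary: near each boundary point there is a smooth local defining
function with nonvanishing differential. -/
def HasSmoothBoundary {n : ℕ} (Ω : Set (EuclideanSpace ℝ (Fin n))) : Prop :=
  ∀ x ∈ frontier Ω, ∃ V : Set (EuclideanSpace ℝ (Fin n)), ∃ φ : EuclideanSpace ℝ (Fin n) → ℝ,
    IsOpen V ∧ x ∈ V ∧ ContDiffOn ℝ (⊤ : ℕ∞) φ V ∧ (∀ y ∈ V, fderiv ℝ φ y ≠ 0) ∧
    (∀ y ∈ V, (y ∈ Ω ↔ φ y < 0)) ∧ (∀ y ∈ V, (y ∈ frontier Ω ↔ φ y = 0))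

/-- A rotation about the `k`-th coordinate axis: a linear isometry fixing `e_k` and
preserving the hyperplane spanned by the other coordinate vectors. -/
def IsAxisRotation {n : ℕ} (k : Fin n)
    (g : EuclideanSpace ℝ (Fin n) ≃ₗᵢ[ℝ] EuclideanSpace ℝ (Fin n)) : Prop :=
  g (EuclideanSpace.single k 1) = EuclideanSpace.single k 1 ∧
    ∀ x : EuclideanSpace ℝ (Fin n), x k = 0 → g x k = 0

theorem fderiv_fderiv_nonneg_of_isLocalMin {E : Type*} [NormedAddCommGroup E] [NormedSpace ℝ E]
    {ψ : E → ℝ} {y : E} (hψ : ContDiffAt ℝ 2 ψ y) (hmin : IsLocalMin ψ y) (ξ : E) :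
    0 ≤ fderiv ℝ (fderiv ℝ ψ) y ξ ξ := by
  by_contra! hneg
  set l : ℝ → E := fun t => y + t • ξ with hl
  have hl0 : l 0 = y := by simp [hl]
  have hlD : ∀ t, HasDerivAt l ξ t := fun t => by
    simpa [hl] using! ((hasDerivAt_id t).smul_const ξ).const_add y
  have hlc : Filter.Tendsto l (nhds 0) (nhds y) := by
    simpa [hl0] using (hlD 0).continuousAt.tendsto
  have hd1 : ∀ᶠ z in nhds y, DifferentiableAt ℝ ψ z :=
    (hψ.eventually (by simp)).mono fun z hz => hz.differentiableAt (by norm_num)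
  have hdl : ∀ᶠ t in nhds (0 : ℝ), HasDerivAt (ψ ∘ l) (fderiv ℝ ψ (l t) ξ) t :=
    (hlc.eventually hd1).mono fun t ht => ht.hasFDerivAt.comp_hasDerivAt t (hlD t)
  have hderiv : deriv (ψ ∘ l) =ᶠ[nhds 0] fun t => fderiv ℝ ψ (l t) ξ :=
    hdl.mono fun t ht => ht.deriv
  have hd2 : DifferentiableAt ℝ (fderiv ℝ ψ) y :=
    (hψ.fderiv_right (m := 1) (by norm_num)).differentiableAt (by norm_num)
  have hdd : deriv (deriv (ψ ∘ l)) 0 = fderiv ℝ (fderiv ℝ ψ) y ξ ξ := by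
    rw [hderiv.deriv_eq]
    have h2 : HasFDerivAt (fderiv ℝ ψ) (fderiv ℝ (fderiv ℝ ψ) y) (l 0) := by
      rw [hl0]; exact hd2.hasFDerivAt
    have h3 := h2.comp_hasDerivAt (0 : ℝ) (hlD 0)
    exact (h3.clm_apply (hasDerivAt_const (0 : ℝ) ξ)).deriv.trans (by simp)
  have hgmin : IsLocalMin (ψ ∘ l) 0 := by
    have := hlc.eventually hmin
    simpa [IsLocalMin, IsMinFilter, hl0] using this
  have hgmax : IsLocalMax (ψ ∘ l) 0 :=
    isLocalMax_of_deriv_deriv_neg (hdd ▸ hneg) hgmin.deriv_eq_zero hdl.self_of_nhds.continuousAt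
  have hconst : (ψ ∘ l) =ᶠ[nhds 0] fun _ => (ψ ∘ l) 0 := by
    filter_upwards [hgmin, hgmax] with t h1 h2 using le_antisymm h2 h1
  have h0 : deriv (ψ ∘ l) =ᶠ[nhds 0] fun _ => 0 := by
    simpa using hconst.deriv
  rw [h0.deriv_eq] at hdd
  simp at hdd
  linarith

theorem hessEntry_eq_fderiv {n : ℕ} (u : EuclideanSpace ℝ (Fin n) → ℝ)
    (x : EuclideanSpace ℝ (Fin n)) (i j : Fin n) :
    hessEntry u x i j =
      fderiv ℝ (fderiv ℝ u) x (EuclideanSpace.single i 1) (EuclideanSpace.single j 1) := by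
  simp [hessEntry, iteratedFDeriv_two_apply]

theorem sum_smul_single {n : ℕ} (ξ : EuclideanSpace ℝ (Fin n)) :
    ∑ i, ξ i • EuclideanSpace.single i (1 : ℝ) = ξ := by
  simpa using (EuclideanSpace.basisFun (Fin n) ℝ).sum_repr ξ

theorem sum_bilin_single {n : ℕ}
    (B : EuclideanSpace ℝ (Fin n) →L[ℝ] EuclideanSpace ℝ (Fin n) →L[ℝ] ℝ)
    (ξ η : EuclideanSpace ℝ (Fin n)) :
    ∑ i, ∑ j, ξ i * η j * B (EuclideanSpace.single i 1) (EuclideanSpace.single j 1) = B ξ η := by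
  conv_rhs => rw [← sum_smul_single ξ, ← sum_smul_single η]
  simp only [map_sum, map_smul, sum_apply, smul_apply, smul_eq_mul, Finset.mul_sum]
  rw [Finset.sum_comm]
  exact Finset.sum_congr rfl fun i _ => Finset.sum_congr rfl fun j _ => by ring

theorem sum_mul_nonneg_of_posSemidef {n : ℕ} {a : Fin n → Fin n → ℝ}
    (ha : ∀ ξ : Fin n → ℝ, 0 ≤ ∑ i, ∑ j, a i j * (ξ i * ξ j))
    {M : Matrix (Fin n) (Fin n) ℝ} (hM : M.PosSemidef) :
    0 ≤ ∑ i, ∑ j, a i j * M i j := by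
  obtain ⟨m, A, hA⟩ := Matrix.posSemidef_iff_eq_sum_vecMulVec.mp hM
  have : ∑ i, ∑ j, a i j * M i j = ∑ l, ∑ i, ∑ j, a i j * (A l i * A l j) := by
    rw [hA, eq_comm, Finset.sum_comm]
    refine Finset.sum_congr rfl fun i _ => ?_
    rw [Finset.sum_comm]
    simp [Matrix.sum_apply, Matrix.vecMulVec_apply, Finset.mul_sum]
  rw [this]
  exact Finset.sum_nonneg fun l _ => ha (A l)

theorem sum_mcCoeff_mul_mul {n : ℕ} (p ξ : EuclideanSpace ℝ (Fin n)) :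
    ∑ i, ∑ j, mcCoeff p i j * (ξ i * ξ j) =
      (Real.sqrt (1 + ‖p‖ ^ 2))⁻¹ * (‖ξ‖ ^ 2 - (inner ℝ p ξ) ^ 2 / (1 + ‖p‖ ^ 2)) := by
  have h1 : ‖ξ‖ ^ 2 = ∑ i, ξ i * ξ i := by
    rw [EuclideanSpace.real_norm_sq_eq]
    exact Finset.sum_congr rfl fun i _ => sq _
  have h2 : inner ℝ p ξ = ∑ i, p i * ξ i := by
    simp [PiLp.inner_apply, mul_comm]
  have h3 : (inner ℝ p ξ) ^ 2 = ∑ i, ∑ j, (p i * ξ i) * (p j * ξ j) := by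
    rw [h2, sq, Finset.sum_mul_sum]
  have h4 : ∑ i, ∑ j, (if i = j then (1 : ℝ) else 0) * (ξ i * ξ j) = ∑ i, ξ i * ξ i := by
    simp
  rw [h3, h1, ← h4, Finset.sum_div, ← Finset.sum_sub_distrib, Finset.mul_sum]
  refine Finset.sum_congr rfl fun i _ => ?_
  rw [Finset.sum_div, ← Finset.sum_sub_distrib, Finset.mul_sum]
  refine Finset.sum_congr rfl fun j _ => ?_
  unfold mcCoeff
  ring

theorem sum_mcCoeff_mul_mul_pos {n : ℕ} (p : EuclideanSpace ℝ (Fin n))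
    {ξ : EuclideanSpace ℝ (Fin n)} (hξ : ξ ≠ 0) :
    0 < ∑ i, ∑ j, mcCoeff p i j * (ξ i * ξ j) := by
  rw [sum_mcCoeff_mul_mul]
  have h1 : (inner ℝ p ξ) ^ 2 ≤ ‖p‖ ^ 2 * ‖ξ‖ ^ 2 := by
    rw [← mul_pow]; exact sq_le_sq' (by linarith [neg_le_of_abs_le (abs_real_inner_le_norm p ξ)])
      (real_inner_le_norm p ξ)
  have h2 : 0 < ‖ξ‖ ^ 2 := by positivity
  have h3 : (inner ℝ p ξ) ^ 2 / (1 + ‖p‖ ^ 2) < ‖ξ‖ ^ 2 := by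
    rw [div_lt_iff₀ (by positivity)]; nlinarith
  have : 0 < ‖ξ‖ ^ 2 - (inner ℝ p ξ) ^ 2 / (1 + ‖p‖ ^ 2) := by linarith
  positivity

theorem sum_mcCoeff_mul_hessEntry_nonneg {n : ℕ} (p : EuclideanSpace ℝ (Fin n))
    {ψ : EuclideanSpace ℝ (Fin n) → ℝ} {y : EuclideanSpace ℝ (Fin n)}
    (hψ : ContDiffAt ℝ 2 ψ y) (hmin : IsLocalMin ψ y) :
    0 ≤ ∑ i, ∑ j, mcCoeff p i j * hessEntry ψ y i j := by
  have hM : (Matrix.of fun i j => hessEntry ψ y i j).PosSemidef := by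
    refine Matrix.PosSemidef.of_dotProduct_mulVec_nonneg ?_ fun ξ => ?_
    · ext i j
      simpa [hessEntry_eq_fderiv] using (hψ.isSymmSndFDerivAt (by simp)).eq _ _
    · have h := fderiv_fderiv_nonneg_of_isLocalMin hψ hmin (WithLp.toLp 2 ξ)
      rw [← sum_bilin_single] at h
      simpa [dotProduct, Matrix.mulVec, Finset.mul_sum, hessEntry_eq_fderiv, mul_assoc,
        mul_comm, mul_left_comm] using h
  refine sum_mul_nonneg_of_posSemidef (fun ξ => ?_) hM
  by_cases h : WithLp.toLp 2 ξ = 0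
  · have : ξ = 0 := by simpa using h
    simp [this]
  · exact (sum_mcCoeff_mul_mul_pos p h).le

theorem contDiff_mcCoeff {n : ℕ} (i j : Fin n) :
    ContDiff ℝ 1 fun p : EuclideanSpace ℝ (Fin n) => mcCoeff p i j := by
  have h1 : ContDiff ℝ 1 fun p : EuclideanSpace ℝ (Fin n) => 1 + ‖p‖ ^ 2 :=
    contDiff_const.add (contDiff_norm_sq ℝ)
  have h0 : ∀ p : EuclideanSpace ℝ (Fin n), 1 + ‖p‖ ^ 2 ≠ 0 := fun p => by positivity
  have hi : ∀ i, ContDiff ℝ 1 fun p : EuclideanSpace ℝ (Fin n) => p i := fun i => by fun_prop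
  unfold mcCoeff
  exact ((h1.sqrt h0).inv fun p => by positivity).mul
    (contDiff_const.sub (((hi i).mul (hi j)).div h1 h0))

theorem continuousOn_gradient {n : ℕ} {U : Set (EuclideanSpace ℝ (Fin n))} (hU : IsOpen U)
    {u : EuclideanSpace ℝ (Fin n) → ℝ} (hu : ContDiffOn ℝ 2 u U) :
    ContinuousOn (gradient u) U :=
  (InnerProductSpace.toDual ℝ (EuclideanSpace ℝ (Fin n))).symm.continuous.comp_continuousOn
    (hu.continuousOn_fderiv_of_isOpen hU (by norm_num))

theorem continuousOn_hessEntry {n : ℕ} {U : Set (EuclideanSpace ℝ (Fin n))} (hU : IsOpen U)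
    {u : EuclideanSpace ℝ (Fin n) → ℝ} (hu : ContDiffOn ℝ 2 u U) (i j : Fin n) :
    ContinuousOn (fun x => hessEntry u x i j) U := by
  simp_rw [hessEntry_eq_fderiv]
  have h : ContinuousOn (fderiv ℝ (fderiv ℝ u)) U :=
    (hu.fderiv_of_isOpen (m := 1) hU (by norm_num)).continuousOn_fderiv_of_isOpen hU le_rfl
  exact (h.clm_apply continuousOn_const).clm_apply continuousOn_const

theorem exists_abs_sum_mcCoeff_sub_le {n : ℕ} {U K : Set (EuclideanSpace ℝ (Fin n))}
    (hU : IsOpen U) (hK : IsCompact K) (hKU : K ⊆ U) {u v : EuclideanSpace ℝ (Fin n) → ℝ}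
    (hu : ContDiffOn ℝ 2 u U) (hv : ContDiffOn ℝ 2 v U) :
    ∃ C, ∀ y ∈ K, |∑ i, ∑ j, (mcCoeff (gradient v y) i j - mcCoeff (gradient u y) i j) *
      hessEntry u y i j| ≤ C * ‖gradient v y - gradient u y‖ := by
  obtain ⟨r₁, hr₁⟩ := hK.exists_bound_of_continuousOn ((continuousOn_gradient hU hu).mono hKU)
  obtain ⟨r₂, hr₂⟩ := hK.exists_bound_of_continuousOn ((continuousOn_gradient hU hv).mono hKU)
  set B := closedBall (0 : EuclideanSpace ℝ (Fin n)) (max r₁ r₂)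
  have hL : ∀ i j : Fin n, ∃ L : NNReal, LipschitzOnWith L (fun p => mcCoeff p i j) B :=
    fun i j => (contDiff_mcCoeff i j).contDiffOn.exists_lipschitzOnWith one_ne_zero
      (convex_closedBall _ _) (isCompact_closedBall _ _)
  choose L hL using hL
  have hH : ∀ i j : Fin n, ∃ H, ∀ y ∈ K, ‖hessEntry u y i j‖ ≤ H := fun i j =>
    hK.exists_bound_of_continuousOn ((continuousOn_hessEntry hU hu i j).mono hKU)
  choose H hH using hH
  refine ⟨∑ i, ∑ j, L i j * H i j, fun y hy => ?_⟩
  rw [Finset.sum_mul]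
  refine (Finset.abs_sum_le_sum_abs _ _).trans (Finset.sum_le_sum fun i _ => ?_)
  rw [Finset.sum_mul]
  refine (Finset.abs_sum_le_sum_abs _ _).trans (Finset.sum_le_sum fun j _ => ?_)
  have h1 := (hL i j).dist_le_mul (gradient v y)
    (mem_closedBall_zero_iff.2 ((hr₂ y hy).trans (le_max_right _ _))) (gradient u y)
    (mem_closedBall_zero_iff.2 ((hr₁ y hy).trans (le_max_left _ _)))
  rw [Real.dist_eq, dist_eq_norm] at h1
  rw [abs_mul]
  calc _ ≤ (L i j * ‖gradient v y - gradient u y‖) * H i j :=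
        mul_le_mul h1 (hH i j y hy) (abs_nonneg _) (by positivity)
    _ = _ := by ring

/-- The Gaussian barrier centred at `c`. -/
def gaussianBarrier {n : ℕ} (α : ℝ) (c z : EuclideanSpace ℝ (Fin n)) : ℝ :=
  Real.exp (-α * ‖z - c‖ ^ 2)

section GaussianBarrier

variable {n : ℕ} (α : ℝ) (c z : EuclideanSpace ℝ (Fin n))

theorem gaussianBarrier_pos : 0 < gaussianBarrier α c z := Real.exp_pos _

theorem gaussianBarrier_le_one {α : ℝ} (hα : 0 ≤ α) : gaussianBarrier α c z ≤ 1 :=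
  Real.exp_le_one_iff.2 (by nlinarith [sq_nonneg ‖z - c‖])

theorem contDiff_gaussianBarrier : ContDiff ℝ 2 (gaussianBarrier α c) :=
  (contDiff_const.mul ((contDiff_id.sub contDiff_const).norm_sq ℝ)).exp

theorem hasFDerivAt_gaussianBarrier :
    HasFDerivAt (gaussianBarrier α c)
      ((-2 * α * gaussianBarrier α c z) • innerSL ℝ (z - c)) z := by
  have h := ((((hasFDerivAt_id z).sub_const c).norm_sq).const_mul (-α)).exp
  refine h.congr_fderiv ?_
  ext ξ
  simp [gaussianBarrier]
  ring

theorem gradient_gaussianBarrier :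
    gradient (gaussianBarrier α c) z = (-2 * α * gaussianBarrier α c z) • (z - c) := by
  rw [gradient, (hasFDerivAt_gaussianBarrier α c z).fderiv, map_smul]
  congr 1
  exact (InnerProductSpace.toDual ℝ _).symm_apply_apply (z - c)

theorem hessEntry_gaussianBarrier (i j : Fin n) :
    hessEntry (gaussianBarrier α c) z i j = gaussianBarrier α c z *
      (4 * α ^ 2 * ((z - c) i * (z - c) j) - 2 * α * if i = j then 1 else 0) := by
  rw [hessEntry_eq_fderiv]
  have h1 : fderiv ℝ (gaussianBarrier α c) =
      fun z => (-2 * α * gaussianBarrier α c z) • innerSL ℝ (z - c) :=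
    funext fun z => (hasFDerivAt_gaussianBarrier α c z).fderiv
  have h2 : HasFDerivAt (fun z => (-2 * α * gaussianBarrier α c z) • innerSL ℝ (z - c)) _ z :=
    ((hasFDerivAt_gaussianBarrier α c z).const_mul (-2 * α)).smul
    ((innerSL ℝ).hasFDerivAt.comp z ((hasFDerivAt_id z).sub_const c))
  have h3 : innerSL ℝ (EuclideanSpace.single i (1 : ℝ)) (EuclideanSpace.single j (1 : ℝ)) =
      if i = j then (1 : ℝ) else 0 := by
    rw [innerSL_apply_apply, EuclideanSpace.inner_single_left]; simp
  rw [h1, h2.fderiv]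
  simp [EuclideanSpace.inner_single_right, h3]
  split_ifs <;> ring

end GaussianBarrier

/-- At an interior minimum of `v - u - φ`, the operator applied to `v` and `u` is controlled
by the test function `φ`. -/
theorem sum_mcCoeff_hessEntry_le_of_isLocalMin {n : ℕ} {u v φ : EuclideanSpace ℝ (Fin n) → ℝ}
    {y : EuclideanSpace ℝ (Fin n)} (hu : ContDiffAt ℝ 2 u y) (hv : ContDiffAt ℝ 2 v y)
    (hφ : ContDiffAt ℝ 2 φ y) (hmin : IsLocalMin (fun z => v z - u z - φ z) y) :
    gradient v y - gradient u y = gradient φ y ∧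
    ∑ i, ∑ j, mcCoeff (gradient v y) i j * hessEntry φ y i j ≤
      meanCurv v y - meanCurv u y - ∑ i, ∑ j,
        (mcCoeff (gradient v y) i j - mcCoeff (gradient u y) i j) * hessEntry u y i j := by
  have hD : ∀ {w : EuclideanSpace ℝ (Fin n) → ℝ}, ContDiffAt ℝ 2 w y →
      ∀ᶠ z in nhds y, DifferentiableAt ℝ w z := fun hw =>
    (hw.eventually (by simp)).mono fun z hz => hz.differentiableAt (by norm_num)
  have hD2 : ∀ {w : EuclideanSpace ℝ (Fin n) → ℝ}, ContDiffAt ℝ 2 w y →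
      DifferentiableAt ℝ (fderiv ℝ w) y := fun hw =>
    (hw.fderiv_right (m := 1) (by norm_num)).differentiableAt (by norm_num)
  have hf : fderiv ℝ (fun z => v z - u z - φ z) =ᶠ[nhds y]
      fun z => fderiv ℝ v z - fderiv ℝ u z - fderiv ℝ φ z := by
    filter_upwards [hD hu, hD hv, hD hφ] with z h1 h2 h3
    exact ((h2.hasFDerivAt.sub h1.hasFDerivAt).sub h3.hasFDerivAt).fderiv
  have hH : ∀ i j, hessEntry (fun z => v z - u z - φ z) y i j =
      hessEntry v y i j - hessEntry u y i j - hessEntry φ y i j := by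
    intro i j
    have h2 : HasFDerivAt (fun z => fderiv ℝ v z - fderiv ℝ u z - fderiv ℝ φ z) _ y :=
      ((hD2 hv).hasFDerivAt.sub (hD2 hu).hasFDerivAt).sub (hD2 hφ).hasFDerivAt
    simp only [hessEntry_eq_fderiv]
    rw [hf.fderiv_eq, h2.fderiv]
    rfl
  constructor
  · have h0 := hmin.fderiv_eq_zero
    rw [hf.self_of_nhds, sub_eq_zero] at h0
    rw [gradient, gradient, gradient, ← map_sub, h0]
  · have h := sum_mcCoeff_mul_hessEntry_nonneg (gradient v y) ((hv.sub hu).sub hφ) hmin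
    have h' : 0 ≤ ∑ i, ∑ j, mcCoeff (gradient v y) i j *
        (hessEntry v y i j - hessEntry u y i j - hessEntry φ y i j) := by
      simpa only [← hH] using h
    simp only [mul_sub, sub_mul, Finset.sum_sub_distrib] at h' ⊢
    unfold meanCurv
    linarith

theorem exists_gaussianBarrier {n : ℕ} {U K : Set (EuclideanSpace ℝ (Fin n))}
    (hU : IsOpen U) (hK : IsCompact K) (hKU : K ⊆ U) {u v : EuclideanSpace ℝ (Fin n) → ℝ}
    (hu : ContDiffOn ℝ 2 u U) (hv : ContDiffOn ℝ 2 v U) {c : EuclideanSpace ℝ (Fin n)}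
    (hc : c ∉ K) (C : ℝ) :
    ∃ α > 0, ∀ y ∈ K, ∀ ε > 0,
      IsLocalMin (fun z => v z - u z - ε * gaussianBarrier α c z) y →
      C * (ε * gaussianBarrier α c y) < meanCurv v y - meanCurv u y := by
  obtain ⟨L, hL⟩ := exists_abs_sum_mcCoeff_sub_le hU hK hKU hu hv
  have hgv := (continuousOn_gradient hU hv).mono hKU
  have ha : ∀ i j, ContinuousOn (fun y => mcCoeff (gradient v y) i j) K := fun i j =>
    (contDiff_mcCoeff i j).continuous.comp_continuousOn hgv
  set F : EuclideanSpace ℝ (Fin n) → ℝ := fun y =>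
    ∑ i, ∑ j, mcCoeff (gradient v y) i j * ((y - c) i * (y - c) j) with hF
  have hFpos : ∀ y ∈ K, 0 < F y := fun y hy =>
    sum_mcCoeff_mul_mul_pos _ (sub_ne_zero.2 fun h => hc (h ▸ hy))
  have hFc : ContinuousOn F K := by
    refine continuousOn_finsetSum _ fun i _ => continuousOn_finsetSum _ fun j _ =>
      (ha i j).mul (Continuous.continuousOn ?_)
    fun_prop
  set G : EuclideanSpace ℝ (Fin n) → ℝ := fun y =>
    2 * (∑ i, mcCoeff (gradient v y) i i) + 2 * L * ‖y - c‖ with hG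
  have hGc : ContinuousOn G K := by
    refine ((continuousOn_finsetSum _ fun i _ => ha i i).const_mul 2).add
      (Continuous.continuousOn ?_)
    fun_prop
  obtain ⟨b, hb⟩ := hK.exists_bound_of_continuousOn
    ((hFc.inv₀ fun y hy => (hFpos y hy).ne').mul (hGc.add (continuousOn_const (c := |C|))))
  refine ⟨max b 1, by positivity, fun y hy ε hε hmin => ?_⟩
  set α := max b 1
  have hα1 : 1 ≤ α := le_max_right _ _
  set h := gaussianBarrier α c y with hh
  have hpos : 0 < h := gaussianBarrier_pos α c y
  have hkey : G y + |C| ≤ α * F y := by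
    have h1 : (F y)⁻¹ * (G y + |C|) ≤ α :=
      ((le_abs_self _).trans (hb y hy)).trans (le_max_left _ _)
    rwa [inv_mul_eq_div, div_le_iff₀ (hFpos y hy)] at h1
  have hUy : U ∈ nhds y := hU.mem_nhds (hKU hy)
  have hφ : ContDiffAt ℝ 2 (fun z => ε * gaussianBarrier α c z) y :=
    (contDiff_const.mul (contDiff_gaussianBarrier α c)).contDiffAt
  obtain ⟨h1, h2⟩ := sum_mcCoeff_hessEntry_le_of_isLocalMin (hu.contDiffAt hUy)
    (hv.contDiffAt hUy) hφ hmin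
  have hfd : fderiv ℝ (fun z => ε * gaussianBarrier α c z) =
      fun z => ε • fderiv ℝ (gaussianBarrier α c) z := funext fun z =>
    ((hasFDerivAt_gaussianBarrier α c z).differentiableAt.hasFDerivAt.const_mul ε).fderiv
  have hgrad : gradient (fun z => ε * gaussianBarrier α c z) y =
      ε • gradient (gaussianBarrier α c) y := by
    rw [gradient, gradient, hfd, map_smul]
  have hhess : ∀ i j, hessEntry (fun z => ε * gaussianBarrier α c z) y i j =
      ε * hessEntry (gaussianBarrier α c) y i j := by
    intro i j
    rw [hessEntry_eq_fderiv, hessEntry_eq_fderiv, hfd]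
    have : DifferentiableAt ℝ (fderiv ℝ (gaussianBarrier α c)) y :=
      (((contDiff_gaussianBarrier α c).fderiv_right (m := 1) (by norm_num)).differentiable
        (by norm_num)) y
    rw [fderiv_fun_const_smul this]
    rfl
  have hnorm : ‖gradient v y - gradient u y‖ = ε * (2 * α * h * ‖y - c‖) := by
    rw [h1, hgrad, gradient_gaussianBarrier, norm_smul, norm_smul, Real.norm_of_nonneg hε.le]
    rw [show -2 * α * gaussianBarrier α c y = -(2 * α * h) by rw [hh]; ring, norm_neg,
      Real.norm_of_nonneg (by positivity)]
  have hlhs : ∑ i, ∑ j, mcCoeff (gradient v y) i j *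
      hessEntry (fun z => ε * gaussianBarrier α c z) y i j =
      ε * h * (4 * α ^ 2 * F y - 2 * α * ∑ i, mcCoeff (gradient v y) i i) := by
    simp_rw [hhess, hessEntry_gaussianBarrier, hF, Finset.mul_sum, ← Finset.sum_sub_distrib,
      Finset.mul_sum]
    refine Finset.sum_congr rfl fun i _ => ?_
    have : mcCoeff (gradient v y) i i =
        ∑ j, mcCoeff (gradient v y) i j * if i = j then 1 else 0 := by simp
    rw [this, Finset.mul_sum, ← Finset.sum_sub_distrib, Finset.mul_sum]
    exact Finset.sum_congr rfl fun j _ => by ring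
  have h3 := hL y hy
  rw [hnorm] at h3
  rw [hlhs] at h2
  have h4 := neg_abs_le (∑ i, ∑ j, (mcCoeff (gradient v y) i j - mcCoeff (gradient u y) i j) *
    hessEntry u y i j)
  have h5 : C < 4 * α ^ 2 * F y - α * G y := by
    have : 0 < α * (α * F y) := by have := hFpos y hy; positivity
    have : α * (G y + |C|) ≤ α * (α * F y) := mul_le_mul_of_nonneg_left hkey (by positivity)
    have : |C| ≤ α * |C| := le_mul_of_one_le_left (abs_nonneg C) hα1
    have := le_abs_self C
    nlinarith
  have h6 := mul_lt_mul_of_pos_left h5 (mul_pos hε hpos)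
  have h7 : ε * h * (4 * α ^ 2 * F y - α * G y) =
      ε * h * (4 * α ^ 2 * F y - 2 * α * ∑ i, mcCoeff (gradient v y) i i) -
        L * (ε * (2 * α * h * ‖y - c‖)) := by rw [hG]; ring
  linarith

/-- Weak comparison principle for `L u = f(u)` with `f` nondecreasing. -/
theorem le_of_meanCurv_eq {n : ℕ} (hn : n ≠ 0) {G : Set (EuclideanSpace ℝ (Fin n))} (hG : IsOpen G)
    (hGb : Bornology.IsBounded G) {f : ℝ → ℝ} (hf : Monotone f)
    {u v : EuclideanSpace ℝ (Fin n) → ℝ} (hu : ContDiffOn ℝ 2 u G) (hv : ContDiffOn ℝ 2 v G)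
    (huc : ContinuousOn u (closure G)) (hvc : ContinuousOn v (closure G))
    (hLu : ∀ x ∈ G, meanCurv u x = f (u x)) (hLv : ∀ x ∈ G, meanCurv v x = f (v x))
    (hbd : ∀ x ∈ frontier G, u x ≤ v x) : ∀ x ∈ G, u x ≤ v x := by
  intro x₀ hx₀
  by_contra! hlt
  have hcomp : IsCompact (closure G) := hGb.isCompact_closure
  have hwc : ContinuousOn (fun x => v x - u x) (closure G) := hvc.sub huc
  set m := u x₀ - v x₀ with hm
  have hmpos : 0 < m := sub_pos.2 hlt
  set K := closure G ∩ (fun x => v x - u x) ⁻¹' Iic (-m / 2) with hKdef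
  have hK : IsCompact K :=
    hcomp.of_isClosed_subset (hwc.preimage_isClosed_of_isClosed isClosed_closure isClosed_Iic)
      inter_subset_left
  have hKG : K ⊆ G := by
    rintro y ⟨hy, hy'⟩
    by_contra hyG
    have h1 := hbd y (by rw [hG.frontier_eq]; exact ⟨hy, hyG⟩)
    have h2 : v y - u y ≤ -m / 2 := hy'
    linarith
  have : Nonempty (Fin n) := ⟨0, hn.bot_lt⟩
  obtain ⟨c, hc⟩ : ∃ c, c ∉ K := (ne_univ_iff_exists_notMem K).1 hK.ne_univ
  obtain ⟨α, hα, hbar⟩ := exists_gaussianBarrier hG hK hKG hu hv hc 0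
  have hhc : Continuous (gaussianBarrier α c) := (contDiff_gaussianBarrier α c).continuous
  have hh1 : ∀ z, gaussianBarrier α c z ≤ 1 := fun z => gaussianBarrier_le_one c z hα.le
  obtain ⟨y, hy, hymin⟩ := hcomp.exists_isMinOn ⟨x₀, subset_closure hx₀⟩
    (hwc.sub (continuousOn_const.mul hhc.continuousOn) (g := fun z => m / 2 * gaussianBarrier α c z))
  have h1 : v y - u y - m / 2 * gaussianBarrier α c y ≤
      v x₀ - u x₀ - m / 2 * gaussianBarrier α c x₀ := hymin (subset_closure hx₀)
  have h2 := gaussianBarrier_pos α c x₀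
  have hw : v y - u y ≤ -m / 2 := by nlinarith [hh1 y]
  have hyK : y ∈ K := ⟨hy, hw⟩
  have hyG := hKG hyK
  have h3 := hbar y hyK (m / 2) (half_pos hmpos)
    (hymin.isLocalMin (Filter.mem_of_superset (hG.mem_nhds hyG) subset_closure))
  rw [hLu y hyG, hLv y hyG] at h3
  have h4 : f (v y) ≤ f (u y) := hf (by linarith)
  linarith

/-- Hopf's boundary point lemma for two solutions of `L u = f(u)`. -/
theorem fderiv_sub_pos_of_meanCurv_eq {n : ℕ} {U : Set (EuclideanSpace ℝ (Fin n))}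
    (hU : IsOpen U) {f : ℝ → ℝ} (hf : ContDiff ℝ 1 f)
    {u v : EuclideanSpace ℝ (Fin n) → ℝ} (hu : ContDiffOn ℝ 2 u U) (hv : ContDiffOn ℝ 2 v U)
    (hLu : ∀ x ∈ U, meanCurv u x = f (u x)) (hLv : ∀ x ∈ U, meanCurv v x = f (v x))
    {c : EuclideanSpace ℝ (Fin n)} {R : ℝ} (hR : 0 < R) (hBU : closedBall c R ⊆ U)
    (hle : ∀ x ∈ closedBall c R, u x ≤ v x) (hlt : ∀ x ∈ ball c R, u x < v x)
    {x₀ : EuclideanSpace ℝ (Fin n)} (hx₀ : ‖x₀ - c‖ = R) (heq : u x₀ = v x₀) :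
    0 < fderiv ℝ (fun x => v x - u x) x₀ (c - x₀) := by
  set K := closedBall c R \ ball c (R / 2) with hKdef
  have hK : IsCompact K := (isCompact_closedBall c R).diff isOpen_ball
  have hKU : K ⊆ U := sdiff_subset.trans hBU
  have hcK : c ∉ K := fun h => h.2 (mem_ball_self (by positivity))
  have hmemK : ∀ {z}, z ∈ K ↔ R / 2 ≤ ‖z - c‖ ∧ ‖z - c‖ ≤ R := by
    intro z
    simp [hKdef, dist_eq_norm, and_comm]
  have hx₀K : x₀ ∈ K := hmemK.2 ⟨by linarith, hx₀.le⟩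
  have hKB : ∀ z ∈ K, z ∈ closedBall c R := fun z hz => hz.1
  have hwc : ContinuousOn (fun x => v x - u x) U := hv.continuousOn.sub hu.continuousOn
  obtain ⟨M₁, hM₁⟩ := hK.exists_bound_of_continuousOn (hu.continuousOn.mono hKU)
  obtain ⟨M₂, hM₂⟩ := hK.exists_bound_of_continuousOn (hv.continuousOn.mono hKU)
  obtain ⟨C, hC⟩ := hf.contDiffOn.exists_lipschitzOnWith one_ne_zero
    (convex_Icc (-max M₁ M₂) (max M₁ M₂)) isCompact_Icc
  have hfLip : ∀ y ∈ K, f (v y) - f (u y) ≤ C * (v y - u y) := by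
    intro y hy
    have h1 := hC.dist_le_mul (v y) (abs_le.1 ((hM₂ y hy).trans (le_max_right _ _))) (u y)
      (abs_le.1 ((hM₁ y hy).trans (le_max_left _ _)))
    rw [Real.dist_eq, Real.dist_eq, abs_of_nonneg (sub_nonneg.2 (hle y (hKB y hy)))] at h1
    exact (le_abs_self _).trans h1
  obtain ⟨m, hm, hmS⟩ : ∃ m > 0, ∀ z ∈ sphere c (R / 2), m ≤ v z - u z := by
    have hS : sphere c (R / 2) ⊆ ball c R := fun z hz => by
      rw [mem_ball, mem_sphere.1 hz]; linarith
    rcases (sphere c (R / 2)).eq_empty_or_nonempty with h | h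
    · exact ⟨1, one_pos, by simp [h]⟩
    · obtain ⟨z, hz, hzmin⟩ := (isCompact_sphere c (R / 2)).exists_isMinOn h
        (hwc.mono (hS.trans (ball_subset_closedBall.trans hBU)))
      exact ⟨v z - u z, sub_pos.2 (hlt z (hS hz)), fun y hy => hzmin hy⟩
  obtain ⟨α, hα, hbar⟩ := exists_gaussianBarrier hU hK hKU hu hv hcK C
  have hhc : Continuous (gaussianBarrier α c) := (contDiff_gaussianBarrier α c).continuous
  have hmin : IsMinOn (fun z => v z - u z - m * gaussianBarrier α c z) K x₀ := by
    obtain ⟨y, hy, hymin⟩ := hK.exists_isMinOn ⟨x₀, hx₀K⟩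
      ((hwc.mono hKU).sub (continuousOn_const.mul hhc.continuousOn)
        (g := fun z => m * gaussianBarrier α c z))
    suffices h : -(m * gaussianBarrier α c x₀) ≤ v y - u y - m * gaussianBarrier α c y by
      intro z hz
      have h1 : v y - u y - m * gaussianBarrier α c y ≤ v z - u z - m * gaussianBarrier α c z :=
        hymin hz
      change v x₀ - u x₀ - m * gaussianBarrier α c x₀ ≤ v z - u z - m * gaussianBarrier α c z
      linarith
    have hpos := mul_pos hm (gaussianBarrier_pos α c x₀)
    obtain ⟨hy1, hy2⟩ := hmemK.1 hy
    rcases hy2.eq_or_lt with hyR | hyR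
    · have : gaussianBarrier α c y = gaussianBarrier α c x₀ := by
        rw [gaussianBarrier, gaussianBarrier, hyR, hx₀]
      rw [this]
      linarith [hle y (hKB y hy)]
    rcases hy1.eq_or_lt with hyr | hyr
    · have h1 := hmS y (by rw [mem_sphere, dist_eq_norm, hyr])
      nlinarith [gaussianBarrier_le_one c y hα.le]
    · have hnhds : K ∈ nhds y := by
        have hcont : Continuous fun z : EuclideanSpace ℝ (Fin n) => ‖z - c‖ := by fun_prop
        refine Filter.mem_of_superset ((isOpen_Ioo.preimage hcont).mem_nhds ⟨hyr, hyR⟩) ?_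
        exact fun z hz => hmemK.2 ⟨hz.1.le, hz.2.le⟩
      have h1 := hbar y hy m hm (hymin.isLocalMin hnhds)
      rw [hLu y (hKU hy), hLv y (hKU hy)] at h1
      have h2 := lt_of_mul_lt_mul_left (h1.trans_le (hfLip y hy)) C.2
      linarith
  have hd : ∀ {w : EuclideanSpace ℝ (Fin n) → ℝ}, ContDiffOn ℝ 2 w U →
      DifferentiableAt ℝ w x₀ := fun hw =>
    (hw.contDiffAt (hU.mem_nhds (hKU hx₀K))).differentiableAt (by norm_num)
  have hwd : HasFDerivAt (fun x => v x - u x) (fderiv ℝ (fun x => v x - u x) x₀) x₀ :=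
    ((hd hv).sub (hd hu)).hasFDerivAt
  have hseg : segment ℝ x₀ (x₀ + (1 / 2 : ℝ) • (c - x₀)) ⊆ K := by
    rw [segment_eq_image']
    rintro _ ⟨t, ⟨ht0, ht1⟩, rfl⟩
    have h1 : x₀ + t • (x₀ + (1 / 2 : ℝ) • (c - x₀) - x₀) - c = (1 - t / 2) • (x₀ - c) := by
      module
    rw [hmemK, h1, norm_smul, hx₀, Real.norm_of_nonneg (by linarith)]
    constructor <;> nlinarith
  have hnn := hmin.localize.hasFDerivWithinAt_nonneg
    (hwd.sub ((hasFDerivAt_gaussianBarrier α c x₀).const_mul m)).hasFDerivWithinAt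
    (mem_posTangentConeAt_of_segment_subset hseg)
  have hin : inner ℝ (x₀ - c) (c - x₀) = -R ^ 2 := by
    rw [← neg_sub x₀ c, inner_neg_right, real_inner_self_eq_norm_sq, hx₀]
  have hb : 0 < m * (α * gaussianBarrier α c x₀ * R ^ 2) := by
    have := gaussianBarrier_pos α c x₀; positivity
  simp only [sub_apply, smul_apply, map_smul, smul_eq_mul, innerSL_apply_apply, hin] at hnn
  nlinarith

/-- Strong comparison principle for two ordered solutions of `L u = f(u)`. -/
theorem lt_of_meanCurv_eq {n : ℕ} {U : Set (EuclideanSpace ℝ (Fin n))}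
    (hU : IsOpen U) (hUc : IsPreconnected U) {f : ℝ → ℝ} (hf : ContDiff ℝ 1 f)
    {u v : EuclideanSpace ℝ (Fin n) → ℝ} (hu : ContDiffOn ℝ 2 u U) (hv : ContDiffOn ℝ 2 v U)
    (hLu : ∀ x ∈ U, meanCurv u x = f (u x)) (hLv : ∀ x ∈ U, meanCurv v x = f (v x))
    (hle : ∀ x ∈ U, u x ≤ v x) (hne : ∃ x ∈ U, u x < v x) : ∀ x ∈ U, u x < v x := by
  have hwc : ContinuousOn (fun x => v x - u x) U := hv.continuousOn.sub hu.continuousOn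
  set W := U ∩ (fun x => v x - u x) ⁻¹' Ioi 0 with hW
  have hWo : IsOpen W := hwc.isOpen_inter_preimage hU isOpen_Ioi
  suffices h : closure W ∩ U ⊆ W by
    have hsub : U ⊆ W := by
      refine hUc.subset_of_closure_inter_subset hWo ?_ h
      obtain ⟨x, hx, hlt⟩ := hne
      exact ⟨x, hx, hx, sub_pos.2 hlt⟩
    exact fun x hx => sub_pos.1 (hsub hx).2
  rintro z ⟨hzW, hzU⟩
  by_contra hz
  obtain ⟨r, hr, hrU⟩ := Metric.isOpen_iff.1 hU z hzU
  obtain ⟨c, hcW, hcz⟩ := Metric.mem_closure_iff.1 hzW (r / 2) (by positivity)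
  have hBU : closedBall c (dist z c) ⊆ U := by
    intro y hy
    refine hrU ?_
    rw [mem_ball]
    have := dist_triangle y c z
    rw [mem_closedBall] at hy
    rw [dist_comm c z] at this
    linarith
  set Z := closedBall c (dist z c) ∩ (fun x => v x - u x) ⁻¹' Iic 0 with hZ
  have hZc : IsCompact Z := (isCompact_closedBall c _).of_isClosed_subset
    ((hwc.mono hBU).preimage_isClosed_of_isClosed isClosed_closedBall isClosed_Iic)
    inter_subset_left
  have hzZ : z ∈ Z := by
    refine ⟨mem_closedBall.2 le_rfl, ?_⟩
    by_contra h
    rw [mem_preimage, mem_Iic, not_le] at h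
    exact hz ⟨hzU, h⟩
  obtain ⟨x₀, hx₀, hx₀min⟩ := hZc.exists_isMinOn (f := fun y => dist y c) ⟨z, hzZ⟩ (by fun_prop)
  have hx₀U := hBU hx₀.1
  have heq : u x₀ = v x₀ := le_antisymm (hle _ hx₀U) (sub_nonpos.1 hx₀.2)
  have hRz : dist x₀ c ≤ dist z c := hx₀.1
  have hR : 0 < dist x₀ c := by
    refine dist_pos.2 fun h => ?_
    have h1 : 0 < v c - u c := hcW.2
    rw [← h, heq] at h1
    linarith
  have hpos := fderiv_sub_pos_of_meanCurv_eq hU hf hu hv hLu hLv hR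
    ((closedBall_subset_closedBall hRz).trans hBU)
    (fun x hx => hle x (hBU (closedBall_subset_closedBall hRz hx)))
    (fun x hx => by
      by_contra h
      have hxZ : x ∈ Z :=
        ⟨closedBall_subset_closedBall hRz (ball_subset_closedBall hx),
          sub_nonpos.2 (not_lt.1 h)⟩
      exact absurd (mem_ball.1 hx) (not_lt.2 (hx₀min hxZ)))
    (dist_eq_norm x₀ c).symm heq
  have hmin : IsLocalMin (fun x => v x - u x) x₀ := by
    filter_upwards [hU.mem_nhds hx₀U] with y hy
    rw [heq, sub_self]
    exact sub_nonneg.2 (hle y hy)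
  rw [hmin.fderiv_eq_zero] at hpos
  simp at hpos

theorem meanCurv_eq {n : ℕ} (u : EuclideanSpace ℝ (Fin n) → ℝ) (x : EuclideanSpace ℝ (Fin n)) :
    meanCurv u x = (Real.sqrt (1 + ‖gradient u x‖ ^ 2))⁻¹ *
      ((∑ i, fderiv ℝ (fderiv ℝ u) x (EuclideanSpace.single i 1) (EuclideanSpace.single i 1)) -
        fderiv ℝ (fderiv ℝ u) x (gradient u x) (gradient u x) / (1 + ‖gradient u x‖ ^ 2)) := by
  have h : ∑ i, fderiv ℝ (fderiv ℝ u) x (EuclideanSpace.single i 1) (EuclideanSpace.single i 1) =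
      ∑ i, ∑ j, (if i = j then (1 : ℝ) else 0) * hessEntry u x i j := by
    simp [hessEntry_eq_fderiv]
  rw [h, ← sum_bilin_single, Finset.sum_div, ← Finset.sum_sub_distrib, Finset.mul_sum]
  refine Finset.sum_congr rfl fun i _ => ?_
  rw [Finset.sum_div, ← Finset.sum_sub_distrib, Finset.mul_sum]
  refine Finset.sum_congr rfl fun j _ => ?_
  rw [← hessEntry_eq_fderiv]
  unfold mcCoeff
  ring

theorem fderiv_comp_isometry_add {E : Type*} [NormedAddCommGroup E] [InnerProductSpace ℝ E]
    (g : E ≃ₗᵢ[ℝ] E) (b : E) {u : E → ℝ} {x : E} (hu : DifferentiableAt ℝ u (g x + b)) :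
    fderiv ℝ (fun y => u (g y + b)) x =
      (fderiv ℝ u (g x + b)).comp (g.toContinuousLinearEquiv : E →L[ℝ] E) :=
  (hu.hasFDerivAt.comp x ((g.toContinuousLinearEquiv.hasFDerivAt).add_const b)).fderiv

/-- The mean curvature operator commutes with rigid motions. -/
theorem meanCurv_comp_isometry_add {n : ℕ}
    (g : EuclideanSpace ℝ (Fin n) ≃ₗᵢ[ℝ] EuclideanSpace ℝ (Fin n))
    (b : EuclideanSpace ℝ (Fin n)) {u : EuclideanSpace ℝ (Fin n) → ℝ}
    {x : EuclideanSpace ℝ (Fin n)} (hu : ContDiffAt ℝ 2 u (g x + b)) :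
    meanCurv (fun y => u (g y + b)) x = meanCurv u (g x + b) := by
  have hρ : ContinuousAt (fun y => g y + b) x := by fun_prop
  have hD : ∀ᶠ y in nhds x, DifferentiableAt ℝ u (g y + b) :=
    hρ.eventually ((hu.eventually (by simp)).mono fun z hz => hz.differentiableAt (by norm_num))
  have hf : fderiv ℝ (fun y => u (g y + b)) =ᶠ[nhds x] fun y =>
      (fderiv ℝ u (g y + b)).comp
        (g.toContinuousLinearEquiv : EuclideanSpace ℝ (Fin n) →L[ℝ] EuclideanSpace ℝ (Fin n)) :=
    hD.mono fun y hy => fderiv_comp_isometry_add g b hy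
  have hgrad : g (gradient (fun y => u (g y + b)) x) = gradient u (g x + b) := by
    refine ext_inner_right ℝ fun w => ?_
    rw [inner_gradient_left, ← g.symm.inner_map_map, g.symm_apply_apply, inner_gradient_left,
      hf.self_of_nhds]
    simp
  have hnorm : ‖gradient (fun y => u (g y + b)) x‖ = ‖gradient u (g x + b)‖ := by
    rw [← hgrad, g.norm_map]
  have hD2 : DifferentiableAt ℝ (fderiv ℝ u) (g x + b) :=
    (hu.fderiv_right (m := 1) (by norm_num)).differentiableAt (by norm_num)
  have hH : ∀ ξ η, fderiv ℝ (fderiv ℝ (fun y => u (g y + b))) x ξ η =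
      fderiv ℝ (fderiv ℝ u) (g x + b) (g ξ) (g η) := by
    intro ξ η
    have h1 := hD2.hasFDerivAt.comp x ((g.toContinuousLinearEquiv.hasFDerivAt).add_const b)
    have h2 : HasFDerivAt (fun y => (fderiv ℝ u (g y + b)).comp
        (g.toContinuousLinearEquiv : EuclideanSpace ℝ (Fin n) →L[ℝ] EuclideanSpace ℝ (Fin n)))
        _ x := h1.clm_comp (hasFDerivAt_const _ x)
    rw [hf.fderiv_eq, h2.fderiv]
    simp
  have htr : ∑ i, fderiv ℝ (fderiv ℝ u) (g x + b) (g (EuclideanSpace.single i 1))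
        (g (EuclideanSpace.single i 1)) =
      ∑ i, fderiv ℝ (fderiv ℝ u) (g x + b) (EuclideanSpace.single i 1)
        (EuclideanSpace.single i 1) := by
    have h := congrFun
      ((InnerProductSpace.laplacian_eq_iteratedFDeriv_orthonormalBasis u
        ((EuclideanSpace.basisFun (Fin n) ℝ).map g)).symm.trans
      (InnerProductSpace.laplacian_eq_iteratedFDeriv_orthonormalBasis u
        (EuclideanSpace.basisFun (Fin n) ℝ))) (g x + b)
    simpa [iteratedFDeriv_two_apply] using h
  rw [meanCurv_eq, meanCurv_eq, hnorm]
  simp only [hH, hgrad, htr]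

theorem interior_closure_eq_of_hasSmoothBoundary {n : ℕ} {Ω : Set (EuclideanSpace ℝ (Fin n))}
    (hΩ : IsOpen Ω) (hs : HasSmoothBoundary Ω) : interior (closure Ω) = Ω := by
  refine subset_antisymm (fun x hx => ?_) (interior_maximal subset_closure hΩ)
  by_contra hxΩ
  have hxf : x ∈ frontier Ω := by
    rw [hΩ.frontier_eq]; exact ⟨interior_subset hx, hxΩ⟩
  obtain ⟨V, φ, hV, hxV, -, hφ, hneg, hzero⟩ := hs x hxf
  refine hφ x hxV (IsLocalMax.fderiv_eq_zero ?_)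
  filter_upwards [hV.mem_nhds hxV, isOpen_interior.mem_nhds hx] with y hyV hy
  rw [(hzero x hxV).1 hxf]
  by_cases hyΩ : y ∈ Ω
  · exact ((hneg y hyV).1 hyΩ).le
  · refine ((hzero y hyV).1 ?_).le
    rw [hΩ.frontier_eq]; exact ⟨interior_subset hy, hyΩ⟩

/-- The reflection in the hyperplane orthogonal to `ν`. -/
def hyperplaneReflection {n : ℕ} (ν : EuclideanSpace ℝ (Fin n)) :
    EuclideanSpace ℝ (Fin n) ≃ₗᵢ[ℝ] EuclideanSpace ℝ (Fin n) :=
  (Submodule.span ℝ {ν})ᗮ.reflection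

theorem hyperplaneReflection_apply {n : ℕ} (ν y : EuclideanSpace ℝ (Fin n)) :
    hyperplaneReflection ν y = y - (2 * (inner ℝ ν y / ‖ν‖ ^ 2)) • ν := by
  rw [hyperplaneReflection, Submodule.reflection_orthogonal_apply,
    Submodule.reflection_singleton_apply]
  simp [mul_smul, two_smul]

theorem isAxisRotation_hyperplaneReflection {n : ℕ} {k : Fin n} {ν : EuclideanSpace ℝ (Fin n)}
    (hν : ν k = 0) : IsAxisRotation k (hyperplaneReflection ν) := by
  refine ⟨?_, fun x hx => ?_⟩
  · rw [hyperplaneReflection_apply, EuclideanSpace.inner_single_right]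
    simp [hν]
  · rw [hyperplaneReflection_apply]
    simp [hν, hx]

theorem contDiffOn_comp_isometry_add {n : ℕ}
    (g : EuclideanSpace ℝ (Fin n) ≃ₗᵢ[ℝ] EuclideanSpace ℝ (Fin n))
    (b : EuclideanSpace ℝ (Fin n)) {u : EuclideanSpace ℝ (Fin n) → ℝ}
    {Ω G : Set (EuclideanSpace ℝ (Fin n))} (hu : ContDiffOn ℝ 2 u Ω)
    (hG : MapsTo (fun y => g y + b) G Ω) : ContDiffOn ℝ 2 (fun y => u (g y + b)) G :=
  hu.comp (g.contDiff.add contDiff_const).contDiffOn hG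

/-- By uniqueness, the solution inherits every linear symmetry of the domain. -/
theorem comp_isometry_eq_of_image_eq {n : ℕ} (hn : n ≠ 0)
    {Ω : Set (EuclideanSpace ℝ (Fin n))} (hΩ : IsOpen Ω) (hΩb : Bornology.IsBounded Ω)
    {f : ℝ → ℝ} (hf : Monotone f) {u : EuclideanSpace ℝ (Fin n) → ℝ}
    (hu : ContDiffOn ℝ 2 u Ω) (huc : ContinuousOn u (closure Ω))
    (hLu : ∀ x ∈ Ω, meanCurv u x = f (u x)) (hu0 : ∀ x ∈ frontier Ω, u x = 0)
    {g : EuclideanSpace ℝ (Fin n) ≃ₗᵢ[ℝ] EuclideanSpace ℝ (Fin n)} (hg : g '' Ω = Ω) :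
    ∀ x ∈ Ω, u (g x) = u x := by
  have hmaps : MapsTo (fun y => g y + 0) Ω Ω := fun y hy => by
    simpa using hg ▸ mem_image_of_mem g hy
  have hcl : MapsTo g (closure Ω) (closure Ω) :=
    (mapsTo_iff_image_subset.2 hg.subset).closure g.continuous
  have hfr : MapsTo g (frontier Ω) (frontier Ω) := by
    have h : g '' frontier Ω = frontier (g '' Ω) := g.toHomeomorph.image_frontier Ω
    exact mapsTo_iff_image_subset.2 (by rw [h, hg])
  have hv : ContDiffOn ℝ 2 (fun y => u (g y)) Ω := by
    simpa using contDiffOn_comp_isometry_add g 0 hu hmaps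
  have hvc : ContinuousOn (fun y => u (g y)) (closure Ω) :=
    huc.comp g.continuous.continuousOn hcl
  have hLv : ∀ x ∈ Ω, meanCurv (fun y => u (g y)) x = f (u (g x)) := by
    intro x hx
    have h1 := meanCurv_comp_isometry_add g 0 (hu.contDiffAt (hΩ.mem_nhds (hmaps hx)))
    have h2 := hLu _ (hmaps hx)
    simp only [add_zero] at h1 h2
    rw [h1, h2]
  have hbd : ∀ x ∈ frontier Ω, u (g x) = u x := fun x hx => by rw [hu0 x hx, hu0 _ (hfr hx)]
  exact fun x hx => le_antisymm
    (le_of_meanCurv_eq hn hΩ hΩb hf hv hu hvc huc hLv hLu (fun y hy => (hbd y hy).le) x hx)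
    (le_of_meanCurv_eq hn hΩ hΩb hf hu hv huc hvc hLu hLv (fun y hy => (hbd y hy).ge) x hx)

/-- Moving planes: in a strictly convex domain symmetric under the reflection in `ν^⊥`, a positive
solution is strictly decreasing in direction `ν` at the points `x` with `⟪ν, x⟫ = ‖ν‖²`. -/
theorem fderiv_apply_neg_of_reflection_symmetric {n : ℕ} (hn : n ≠ 0)
    {Ω : Set (EuclideanSpace ℝ (Fin n))} (hΩ : IsOpen Ω) (hΩb : Bornology.IsBounded Ω)
    (hΩconv : StrictConvex ℝ (closure Ω)) (hΩint : interior (closure Ω) = Ω)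
    {ν : EuclideanSpace ℝ (Fin n)} (hΩsym : hyperplaneReflection ν '' Ω = Ω)
    {f : ℝ → ℝ} (hf1 : ContDiff ℝ 1 f) (hf : Monotone f)
    {u : EuclideanSpace ℝ (Fin n) → ℝ}
    (hu : ContDiffOn ℝ 2 u Ω) (huc : ContinuousOn u (closure Ω))
    (hLu : ∀ x ∈ Ω, meanCurv u x = f (u x)) (hu0 : ∀ x ∈ frontier Ω, u x = 0)
    (hupos : ∀ x ∈ Ω, 0 < u x) (hν : ν ≠ 0) {x : EuclideanSpace ℝ (Fin n)} (hx : x ∈ Ω)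
    (hxν : inner ℝ ν x = ‖ν‖ ^ 2) : fderiv ℝ u x ν < 0 := by
  set S := hyperplaneReflection ν with hS
  set s := ‖ν‖ ^ 2 with hs
  have hspos : 0 < s := by positivity
  set ρ : EuclideanSpace ℝ (Fin n) → EuclideanSpace ℝ (Fin n) := fun y => S y + (2 : ℝ) • ν with hρ
  have hρc : Continuous ρ := by fun_prop
  have hρfix : ∀ y, inner ℝ ν y = s → ρ y = y := by
    intro y hy
    simp only [hρ, hS, hyperplaneReflection_apply, hy, ← hs]
    rw [div_self hspos.ne']
    module
  have hScl : MapsTo S (closure Ω) (closure Ω) :=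
    (mapsTo_iff_image_subset.2 hΩsym.subset).closure S.continuous
  have hρΩ : ∀ y ∈ closure Ω, s < inner ℝ ν y → ρ y ∈ Ω := by
    intro y hy hty
    have ht : 0 < inner ℝ ν y := hspos.trans hty
    have hSy : S y = y - (2 * (inner ℝ ν y / s)) • ν := hyperplaneReflection_apply ν y
    have hne : y ≠ S y := by
      intro h
      rw [hSy, eq_comm, sub_eq_self, smul_eq_zero] at h
      rcases h with h | h
      · have : 0 < 2 * (inner ℝ ν y / s) := by positivity
        linarith
      · exact hν h
    rw [← hΩint]
    refine hΩconv.openSegment_subset hy (hScl hy) hne ?_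
    refine ⟨s / inner ℝ ν y, 1 - s / inner ℝ ν y, by positivity,
      sub_pos.2 ((div_lt_one ht).2 hty), by ring, ?_⟩
    simp only [hρ]
    rw [hSy]
    match_scalars
    · ring
    · field_simp
      ring
  have hin : Continuous fun y : EuclideanSpace ℝ (Fin n) => (inner ℝ ν y : ℝ) := by fun_prop
  set G := Ω ∩ {y | s < inner ℝ ν y} with hG
  have hGo : IsOpen G := hΩ.inter (isOpen_lt continuous_const hin)
  have hGΩ : G ⊆ Ω := inter_subset_left
  have hρG : ∀ y ∈ G, ρ y ∈ Ω := fun y hy => hρΩ y (subset_closure hy.1) hy.2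
  have hGcl : ∀ y ∈ closure G, y ∈ closure Ω ∧ s ≤ inner ℝ ν y := by
    intro y hy
    refine ⟨closure_mono hGΩ hy, ?_⟩
    exact closure_minimal (fun z hz => (hz.2 : s < inner ℝ ν z).le)
      (isClosed_le continuous_const hin) hy
  have hρcl : MapsTo ρ (closure G) (closure Ω) := by
    intro y hy
    obtain ⟨h1, h2⟩ := hGcl y hy
    rcases h2.eq_or_lt with h | h
    · rwa [hρfix y h.symm]
    · exact subset_closure (hρΩ y h1 h)
  set v : EuclideanSpace ℝ (Fin n) → ℝ := fun y => u (ρ y) with hv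
  set U := Ω ∩ ρ ⁻¹' Ω with hU
  have hUo : IsOpen U := hΩ.inter (hΩ.preimage hρc)
  have hGU : G ⊆ U := fun y hy => ⟨hy.1, hρG y hy⟩
  have huU : ContDiffOn ℝ 2 u U := hu.mono inter_subset_left
  have hvU : ContDiffOn ℝ 2 v U := contDiffOn_comp_isometry_add S _ hu fun y hy => hy.2
  have hLuU : ∀ y ∈ U, meanCurv u y = f (u y) := fun y hy => hLu y hy.1
  have hLvU : ∀ y ∈ U, meanCurv v y = f (v y) := fun y hy =>
    (meanCurv_comp_isometry_add S _ (hu.contDiffAt (hΩ.mem_nhds hy.2))).trans (hLu _ hy.2)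
  have hbd : ∀ y ∈ frontier Ω, s < inner ℝ ν y → u y < v y := by
    intro y hy hty
    rw [hu0 y hy]
    exact hupos _ (hρΩ y (frontier_subset_closure hy) hty)
  have huGc : ContinuousOn u (closure G) := huc.mono (closure_mono hGΩ)
  have hvGc : ContinuousOn v (closure G) := huc.comp hρc.continuousOn hρcl
  have hleG : ∀ y ∈ G, u y ≤ v y := by
    refine le_of_meanCurv_eq hn hGo (hΩb.subset hGΩ) hf (huU.mono hGU) (hvU.mono hGU) huGc hvGc
      (fun y hy => hLuU y (hGU hy)) (fun y hy => hLvU y (hGU hy)) fun y hy => ?_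
    rw [hGo.frontier_eq] at hy
    obtain ⟨h1, h2⟩ := hGcl y hy.1
    rcases h2.eq_or_lt with h | h
    · exact (congrArg u (hρfix y h.symm)).ge
    · refine (hbd y ?_ h).le
      rw [hΩ.frontier_eq]
      exact ⟨h1, fun hyΩ => hy.2 ⟨hyΩ, h⟩⟩
  have hpush : ∀ y ∈ Ω, ∃ δ > 0, ∀ t ∈ Icc (0 : ℝ) δ, y + t • ν ∈ Ω := by
    intro y hy
    have hc : Continuous fun t : ℝ => y + t • ν := by fun_prop
    have hmem : (fun t : ℝ => y + t • ν) ⁻¹' Ω ∈ nhds (0 : ℝ) :=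
      (hΩ.preimage hc).mem_nhds (by simpa using hy)
    obtain ⟨δ, hδ, hsub⟩ := Metric.nhds_basis_closedBall.mem_iff.1 hmem
    refine ⟨δ, hδ, fun t ht => hsub ?_⟩
    rw [mem_closedBall_zero_iff, Real.norm_of_nonneg ht.1]
    exact ht.2
  have hinν : ∀ (y : EuclideanSpace ℝ (Fin n)) (t : ℝ),
      inner ℝ ν (y + t • ν) = inner ℝ ν y + t * s := by
    intro y t
    rw [inner_add_right, real_inner_smul_right, real_inner_self_eq_norm_sq]
  have hex : ∃ y ∈ G, u y < v y := by
    obtain ⟨y, hy, hymax⟩ := hΩb.isCompact_closure.exists_isMaxOn ⟨x, subset_closure hx⟩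
      hin.continuousOn
    have hyΩ : y ∉ Ω := by
      intro h
      obtain ⟨δ, hδ, hδΩ⟩ := hpush y h
      have h1 : inner ℝ ν (y + δ • ν) ≤ inner ℝ ν y :=
        hymax (subset_closure (hδΩ δ ⟨hδ.le, le_rfl⟩))
      rw [hinν] at h1
      nlinarith
    have hyf : y ∈ frontier Ω := by rw [hΩ.frontier_eq]; exact ⟨hy, hyΩ⟩
    have hsy : s < inner ℝ ν y := by
      obtain ⟨δ, hδ, hδΩ⟩ := hpush x hx
      have h1 : inner ℝ ν (x + δ • ν) ≤ inner ℝ ν y :=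
        hymax (subset_closure (hδΩ δ ⟨hδ.le, le_rfl⟩))
      rw [hinν, hxν] at h1
      nlinarith
    have hyG : y ∈ closure G := by
      have := (isOpen_lt continuous_const hin : IsOpen {z | s < inner ℝ ν z}).inter_closure
        (s := {z | s < inner ℝ ν z}) (t := Ω) ⟨hsy, hy⟩
      rwa [inter_comm] at this
    by_contra! hall
    exact absurd (hbd y hyf hsy) (not_lt.2
      (ContinuousWithinAt.closure_le hyG ((hvGc y hyG).mono subset_closure)
        ((huGc y hyG).mono subset_closure) hall))
  have hGconv : Convex ℝ G := by
    have h1 : Convex ℝ Ω := hΩint ▸ hΩconv.convex.interior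
    exact h1.inter (convex_halfSpace_gt ⟨fun a b => inner_add_right _ _ _,
      fun r a => real_inner_smul_right _ _ _⟩ s)
  have hltG : ∀ y ∈ G, u y < v y :=
    lt_of_meanCurv_eq hGo hGconv.isPreconnected hf1 (huU.mono hGU)
      (hvU.mono hGU) (fun y hy => hLuU y (hGU hy)) (fun y hy => hLvU y (hGU hy)) hleG hex
  have hρx : ρ x = x := hρfix x hxν
  obtain ⟨r, hr, hrΩ⟩ := Metric.isOpen_iff.1 hΩ x hx
  have hνn : 0 < ‖ν‖ := norm_pos_iff.2 hν
  set t := r / (4 * ‖ν‖) with ht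
  have htpos : 0 < t := by positivity
  have htν : t * ‖ν‖ = r / 4 := by rw [ht]; field_simp
  set c := x + t • ν with hc
  have hxc : ‖x - c‖ = t * ‖ν‖ := by
    rw [hc, sub_add_cancel_left, norm_neg, norm_smul, Real.norm_of_nonneg htpos.le]
  have hinB : ∀ y, inner ℝ ν y ≥ s + ‖ν‖ * (t * ‖ν‖ - dist y c) := by
    intro y
    have h1 := neg_le_of_abs_le (abs_real_inner_le_norm ν (y - c))
    rw [inner_sub_right, hc, hinν, hxν, ← hc, ← dist_eq_norm] at h1
    nlinarith
  have hBΩ : ∀ y ∈ closedBall c (t * ‖ν‖), y ∈ Ω := by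
    intro y hy
    refine hrΩ ?_
    rw [mem_closedBall] at hy
    have := dist_triangle y c x
    rw [dist_comm c x, dist_eq_norm x c, hxc] at this
    rw [mem_ball]
    linarith
  have hB : ∀ y ∈ closedBall c (t * ‖ν‖), y ∈ G ∨ ρ y = y := by
    intro y hy
    have h1 : s ≤ inner ℝ ν y :=
      le_trans (le_add_of_nonneg_right (mul_nonneg hνn.le (sub_nonneg.2 hy))) (hinB y)
    rcases h1.eq_or_lt with h | h
    · exact .inr (hρfix y h.symm)
    · exact .inl ⟨hBΩ y hy, h⟩
  have hhopf := fderiv_sub_pos_of_meanCurv_eq hUo hf1 huU hvU hLuU hLvU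
    (by positivity : 0 < t * ‖ν‖)
    (fun y hy => (hB y hy).elim (fun h => hGU h) fun h =>
      ⟨hBΩ y hy, by rw [mem_preimage, h]; exact hBΩ y hy⟩)
    (fun y hy => (hB y hy).elim (fun h => hleG y h) fun h => (congrArg u h).ge)
    (fun y hy => hltG y ⟨hBΩ y (ball_subset_closedBall hy),
      lt_of_lt_of_le (lt_add_of_pos_right _ (mul_pos hνn (sub_pos.2 hy))) (hinB y)⟩)
    hxc (congrArg u hρx.symm)
  have hux : DifferentiableAt ℝ u x :=
    (hu.contDiffAt (hΩ.mem_nhds hx)).differentiableAt (by norm_num)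
  have huρx : DifferentiableAt ℝ u (S x + (2 : ℝ) • ν) := by
    change DifferentiableAt ℝ u (ρ x)
    rwa [hρx]
  have hvx : fderiv ℝ v x = (fderiv ℝ u x).comp
      (S.toContinuousLinearEquiv : EuclideanSpace ℝ (Fin n) →L[ℝ] EuclideanSpace ℝ (Fin n)) := by
    have h := fderiv_comp_isometry_add S ((2 : ℝ) • ν) huρx
    change fderiv ℝ v x = (fderiv ℝ u (ρ x)).comp _ at h
    rwa [hρx] at h
  have hvd : DifferentiableAt ℝ v x :=
    (hvU.contDiffAt (hUo.mem_nhds ⟨hx, by rwa [mem_preimage, hρx]⟩)).differentiableAt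
      (by norm_num)
  have hSν : S ν = -ν := Submodule.reflection_orthogonalComplement_singleton_eq_neg ν
  rw [fderiv_fun_sub hvd hux, hvx, hc, add_sub_cancel_left] at hhopf
  simp only [sub_apply, map_smul, ContinuousLinearMap.comp_apply, smul_eq_mul] at hhopf
  simp [hSν] at hhopf
  nlinarith

/-- Symmetry of the solution: a positive solution in a bounded, strictly
convex, smooth, rotationally symmetric domain of `ℝⁿ` (`n ≥ 3`) is rotationally symmetric
about the axis, and is strictly radially decreasing in the variables `x'` orthogonal to the
axis: `Σ_{i≠k} xᵢ ∂ᵢu(x) < 0` whenever `x' ≠ 0`. -/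
theorem solution_rotationally_symmetric_and_radially_decreasing
    (n : ℕ) (hn : 3 ≤ n) (k : Fin n) (hk : (k : ℕ) = n - 1)
    (Ω : Set (EuclideanSpace ℝ (Fin n)))
    (hΩne : Ω.Nonempty) (hΩopen : IsOpen Ω) (hΩbd : Bornology.IsBounded Ω)
    (hΩconv : StrictConvex ℝ (closure Ω)) (hΩsmooth : HasSmoothBoundary Ω)
    (hΩsym : ∀ g : EuclideanSpace ℝ (Fin n) ≃ₗᵢ[ℝ] EuclideanSpace ℝ (Fin n),
      IsAxisRotation k g → g '' Ω = Ω)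
    (f : ℝ → ℝ) (hf : AnalyticOnNhd ℝ f Set.univ) (hfmono : Monotone f)
    (u : EuclideanSpace ℝ (Fin n) → ℝ)
    (hsol : IsMCSolution Ω f u) (hupos : ∀ x ∈ Ω, 0 < u x)
    (huC1 : ContDiffOn ℝ 1 u (closure Ω)) :
    (∀ g : EuclideanSpace ℝ (Fin n) ≃ₗᵢ[ℝ] EuclideanSpace ℝ (Fin n),
      IsAxisRotation k g → ∀ x ∈ Ω, u (g x) = u x) ∧
    (∀ x ∈ Ω, (∃ i : Fin n, i ≠ k ∧ x i ≠ 0) →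
      ∑ i ∈ Finset.univ.erase k, x i * gradient u x i < 0) := by
  have hn0 : n ≠ 0 := by omega
  obtain ⟨hu, huc, hLu, hu0⟩ := hsol
  refine ⟨fun g hg x hx => ?_, fun x hx hxk => ?_⟩
  · exact comp_isometry_eq_of_image_eq hn0 hΩopen hΩbd hfmono hu huc hLu hu0 (hΩsym g hg) x hx
  · obtain ⟨i, hik, hxi⟩ := hxk
    set ν : EuclideanSpace ℝ (Fin n) := x - x k • EuclideanSpace.single k 1 with hν
    have hνk : ν k = 0 := by simp [hν]
    have hνi : ∀ j, j ≠ k → ν j = x j := fun j hj => by simp [hν, hj]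
    have hν0 : ν ≠ 0 := fun h => hxi (by rw [← hνi i hik, h]; rfl)
    have hsum : ∀ w : EuclideanSpace ℝ (Fin n),
        inner ℝ ν w = ∑ j ∈ Finset.univ.erase k, x j * w j := by
      intro w
      rw [PiLp.inner_apply, ← Finset.add_sum_erase _ _ (Finset.mem_univ k)]
      simp only [hνk, RCLike.inner_apply, map_zero, mul_zero, zero_add, conj_trivial]
      exact Finset.sum_congr rfl fun j hj => by rw [hνi j (Finset.ne_of_mem_erase hj), mul_comm]
    have hxν : inner ℝ ν x = ‖ν‖ ^ 2 := by
      rw [hsum, ← real_inner_self_eq_norm_sq, hsum]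
      exact Finset.sum_congr rfl fun j hj => by rw [hνi j (Finset.ne_of_mem_erase hj)]
    have h := fderiv_apply_neg_of_reflection_symmetric hn0 hΩopen hΩbd hΩconv
      (interior_closure_eq_of_hasSmoothBoundary hΩopen hΩsmooth)
      (hΩsym _ (isAxisRotation_hyperplaneReflection hνk))
      (contDiffOn_univ.1 (hf.contDiffOn uniqueDiffOn_univ)) hfmono hu huc hLu hu0 hupos hν0 hx hxν
    rw [← hsum, real_inner_comm, inner_gradient_left]
    exact h
end
end

section
/- Let n ≥ 3, let Ω = B(x₀, R) ⊂ ℝⁿ be an open ball, and let f : ℝ → ℝ be locally Lipschitz continuous on [0,∞). Let u ∈ C²(Ω) ∩ C¹(closure Ω) satisfy u > 0 in Ω, u = 0 on ∂Ω, and div(∇u/√(1+|∇u|²)) = f(u) in Ω. Then u is radially symmetric about x₀: there exists a function w : [0,R] → ℝ with u(x) = w(|x − x₀|) for all x ∈ closure Ω, w is differentiable on (0,R), and w'(r) < 0 for all 0 < r < R. -/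
open Set Metric

noncomputable section

open Filter Topology MeasureTheory Module
open scoped RealInnerProductSpace Gradient ENNReal NNReal

section Algebra

variable {E : Type*} [NormedAddCommGroup E]

/-- The area factor `√(1+|p|²)`. -/
def areaFactor (p : E) : ℝ := Real.sqrt (1 + ‖p‖ ^ 2)

theorem areaFactor_pos (p : E) : 0 < areaFactor p := Real.sqrt_pos.2 (by positivity)

theorem areaFactor_sq (p : E) : areaFactor p ^ 2 = 1 + ‖p‖ ^ 2 := Real.sq_sqrt (by positivity)

theorem one_le_areaFactor (p : E) : 1 ≤ areaFactor p := by
  nlinarith [areaFactor_sq p, areaFactor_pos p, sq_nonneg ‖p‖]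

theorem areaFactor_le {p : E} {G : ℝ} (h : ‖p‖ ≤ G) : areaFactor p ≤ Real.sqrt (1 + G ^ 2) := by
  unfold areaFactor
  gcongr

variable [InnerProductSpace ℝ E]

/-- The mean curvature flux `p/√(1+|p|²)`. -/
def mcFlux (p : E) : E := (areaFactor p)⁻¹ • p

/-- The mean curvature operator as a function of the gradient `p` and the Hessian `H`. -/
def mcOp (p : E) (H : E →L[ℝ] E) : ℝ :=
  (areaFactor p)⁻¹ * (LinearMap.trace ℝ E H.toLinearMap - ⟪H p, p⟫ / (1 + ‖p‖ ^ 2))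

theorem contDiff_areaFactor {k : WithTop ℕ∞} : ContDiff ℝ k (areaFactor : E → ℝ) := by
  unfold areaFactor
  exact (contDiff_const.add (contDiff_norm_sq ℝ)).sqrt fun x => by positivity

theorem hasFDerivAt_areaFactor (p : E) :
    HasFDerivAt (areaFactor : E → ℝ) ((areaFactor p)⁻¹ • innerSL ℝ p) p := by
  have h := ((hasStrictFDerivAt_norm_sq p).hasFDerivAt.const_add (1 : ℝ)).sqrt
    (by positivity : 1 + ‖p‖ ^ 2 ≠ 0)
  refine h.congr_fderiv ?_
  ext k
  simp only [areaFactor, smul_apply, smul_eq_mul, nsmul_eq_mul, Nat.cast_ofNat]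
  field_simp

theorem contDiff_mcFlux {k : WithTop ℕ∞} : ContDiff ℝ k (mcFlux : E → E) :=
  (contDiff_areaFactor.inv fun p => (areaFactor_pos p).ne').smul contDiff_id

theorem fderiv_mcFlux_apply (p q : E) :
    fderiv ℝ mcFlux p q
      = (areaFactor p)⁻¹ • (q - (⟪p, q⟫ / (1 + ‖p‖ ^ 2)) • p) := by
  have h0 := (areaFactor_pos p).ne'
  have h := ((hasDerivAt_inv h0).comp_hasFDerivAt p (hasFDerivAt_areaFactor p)).smul
    (hasFDerivAt_id p)
  have h' : HasFDerivAt (mcFlux : E → E) _ p := h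
  rw [h'.fderiv, ← areaFactor_sq]
  simp only [add_apply, smul_apply, ContinuousLinearMap.smulRight_apply,
    ContinuousLinearMap.id_apply, id, smul_sub, smul_smul, innerSL_apply_apply, smul_eq_mul]
  rw [sub_eq_add_neg, ← neg_smul]
  congr 2
  field_simp

/-- Uniform monotonicity of the mean curvature flux on bounded sets of gradients. -/
theorem mcFlux_monotone {G : ℝ} {p q : E} (hp : ‖p‖ ≤ G) (hq : ‖q‖ ≤ G) :
    (Real.sqrt (1 + G ^ 2) ^ 3)⁻¹ * ‖p - q‖ ^ 2 ≤ ⟪mcFlux p - mcFlux q, p - q⟫ := by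
  set a := areaFactor p with ha
  set b := areaFactor q with hb
  set s := Real.sqrt (1 + G ^ 2) with hs
  have ha0 : 0 < a := areaFactor_pos p
  have hb0 : 0 < b := areaFactor_pos q
  have ha2 : a ^ 2 = 1 + ‖p‖ ^ 2 := areaFactor_sq p
  have hb2 : b ^ 2 = 1 + ‖q‖ ^ 2 := areaFactor_sq q
  have has : a ≤ s := areaFactor_le hp
  have hbs : b ≤ s := areaFactor_le hq
  have hs0 : 0 < s := ha0.trans_le has
  have hs2 : s ^ 2 = 1 + G ^ 2 := Real.sq_sqrt (by positivity)
  have hN : ‖p - q‖ ^ 2 = ‖p‖ ^ 2 - 2 * ⟪p, q⟫ + ‖q‖ ^ 2 := norm_sub_sq_real p q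
  have hid : ⟪mcFlux p - mcFlux q, p - q⟫
      = (1 / 2) * (a⁻¹ + b⁻¹) * (‖p - q‖ ^ 2 - (a - b) ^ 2) := by
    have : ⟪mcFlux p - mcFlux q, p - q⟫
        = a⁻¹ * ‖p‖ ^ 2 + b⁻¹ * ‖q‖ ^ 2 - (a⁻¹ + b⁻¹) * ⟪p, q⟫ := by
      simp only [mcFlux, inner_sub_left, inner_sub_right, real_inner_smul_left,
        real_inner_self_eq_norm_sq, real_inner_comm p q, ← ha, ← hb]
      ring
    rw [this, hN]
    have e1 : ‖p‖ ^ 2 = a ^ 2 - 1 := by linarith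
    have e2 : ‖q‖ ^ 2 = b ^ 2 - 1 := by linarith
    rw [e1, e2]
    field_simp
    ring
  have hpa : ‖p‖ * s ≤ G * a := by
    have hG : 0 ≤ G := (norm_nonneg p).trans hp
    refine abs_le_of_sq_le_sq' ?_ (by positivity) |>.2
    rw [mul_pow, mul_pow, hs2, ha2]
    nlinarith [pow_le_pow_left₀ (norm_nonneg p) hp 2]
  have hqb : ‖q‖ * s ≤ G * b := by
    have hG : 0 ≤ G := (norm_nonneg p).trans hp
    refine abs_le_of_sq_le_sq' ?_ (by positivity) |>.2
    rw [mul_pow, mul_pow, hs2, hb2]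
    nlinarith [pow_le_pow_left₀ (norm_nonneg q) hq 2]
  have hG : 0 ≤ G := (norm_nonneg p).trans hp
  have hab : |a - b| * s ≤ G * ‖p - q‖ := by
    have h1 : |a - b| * (a + b) ≤ ‖p - q‖ * (‖p‖ + ‖q‖) := by
      have : |a - b| * (a + b) = |‖p‖ - ‖q‖| * (‖p‖ + ‖q‖) := by
        have h3 : |a - b| * |a + b| = |‖p‖ - ‖q‖| * |‖p‖ + ‖q‖| := by
          rw [← abs_mul, ← abs_mul]
          congr 1
          nlinarith
        rwa [abs_of_pos (add_pos ha0 hb0),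
          abs_of_nonneg (add_nonneg (norm_nonneg p) (norm_nonneg q))] at h3
      rw [this]
      exact mul_le_mul_of_nonneg_right (abs_norm_sub_norm_le p q) (by positivity)
    have h2 : |a - b| * s * (a + b) ≤ G * ‖p - q‖ * (a + b) := by
      calc |a - b| * s * (a + b) = (|a - b| * (a + b)) * s := by ring
        _ ≤ (‖p - q‖ * (‖p‖ + ‖q‖)) * s := by gcongr
        _ = ‖p - q‖ * (‖p‖ * s + ‖q‖ * s) := by ring
        _ ≤ ‖p - q‖ * (G * a + G * b) := by gcongr
        _ = _ := by ring
    exact le_of_mul_le_mul_right h2 (by positivity)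
  have hab2 : (a - b) ^ 2 * s ^ 2 ≤ G ^ 2 * ‖p - q‖ ^ 2 := by
    have := pow_le_pow_left₀ (by positivity) hab 2
    rwa [mul_pow, mul_pow, sq_abs] at this
  have hkey : (s ^ 2)⁻¹ * ‖p - q‖ ^ 2 ≤ ‖p - q‖ ^ 2 - (a - b) ^ 2 := by
    rw [inv_mul_le_iff₀ (by positivity)]
    nlinarith
  rw [hid]
  have hinv : s⁻¹ ≤ (1 / 2) * (a⁻¹ + b⁻¹) := by
    have h1 : s⁻¹ ≤ a⁻¹ := by gcongr
    have h2 : s⁻¹ ≤ b⁻¹ := by gcongr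
    linarith
  calc (s ^ 3)⁻¹ * ‖p - q‖ ^ 2 = s⁻¹ * ((s ^ 2)⁻¹ * ‖p - q‖ ^ 2) := by
        field_simp
    _ ≤ _ := mul_le_mul hinv hkey (by positivity) (by positivity)

theorem mcOp_sub (p : E) (H K : E →L[ℝ] E) : mcOp p (H - K) = mcOp p H - mcOp p K := by
  simp only [mcOp, sub_apply, inner_sub_left,
    ContinuousLinearMap.toLinearMap_sub, map_sub]
  ring

theorem mcOp_smul (p : E) (c : ℝ) (H : E →L[ℝ] E) : mcOp p (c • H) = c * mcOp p H := by
  simp only [mcOp, smul_apply, real_inner_smul_left,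
    ContinuousLinearMap.toLinearMap_smul, map_smul, smul_eq_mul]
  ring

theorem mcOp_conj (S : E ≃ₗᵢ[ℝ] E) (p : E) (H : E →L[ℝ] E) :
    mcOp (S p) ((S : E →L[ℝ] E) ∘L H ∘L (S.symm : E →L[ℝ] E)) = mcOp p H := by
  have h1 : areaFactor (S p) = areaFactor p := by simp [areaFactor]
  have h2 : LinearMap.trace ℝ E
      ((S : E →L[ℝ] E) ∘L H ∘L (S.symm : E →L[ℝ] E)).toLinearMap
      = LinearMap.trace ℝ E H.toLinearMap := by
    exact LinearMap.trace_conj' H.toLinearMap S.toLinearEquiv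
  simp only [mcOp, h1, h2, LinearIsometryEquiv.norm_map]
  simp

variable [FiniteDimensional ℝ E]

theorem trace_eq_sum (H : E →L[ℝ] E) :
    LinearMap.trace ℝ E H.toLinearMap
      = ∑ i, ⟪stdOrthonormalBasis ℝ E i, H (stdOrthonormalBasis ℝ E i)⟫ :=
  LinearMap.trace_eq_sum_inner _ (stdOrthonormalBasis ℝ E)

/-- Degenerate ellipticity. -/
theorem mcOp_nonneg (p : E) {H : E →L[ℝ] E} (hsymm : ∀ h k, ⟪H h, k⟫ = ⟪H k, h⟫)
    (hH : ∀ k, 0 ≤ ⟪H k, k⟫) : 0 ≤ mcOp p H := by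
  refine mul_nonneg (inv_nonneg.2 (areaFactor_pos p).le) ?_
  set b := stdOrthonormalBasis ℝ E
  have htr0 : LinearMap.trace ℝ E H.toLinearMap = ∑ i, ⟪H (b i), b i⟫ := by
    rw [trace_eq_sum]
    exact Finset.sum_congr rfl fun i _ => real_inner_comm _ _
  have htr : 0 ≤ LinearMap.trace ℝ E H.toLinearMap := by
    rw [htr0]
    exact Finset.sum_nonneg fun i _ => hH _
  have hCS : ⟪H p, p⟫ ≤ ‖p‖ ^ 2 * LinearMap.trace ℝ E H.toLinearMap := by
    rcases eq_or_ne p 0 with rfl | hp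
    · simp
    have hp0 : 0 < ‖p‖ ^ 2 := by positivity
    set t : ℝ := (‖p‖ ^ 2)⁻¹ with ht
    have hsum : 0 ≤ ∑ i, ⟪H (b i - (t * ⟪b i, p⟫) • p), b i - (t * ⟪b i, p⟫) • p⟫ :=
      Finset.sum_nonneg fun i _ => hH _
    have hexp : ∀ i, ⟪H (b i - (t * ⟪b i, p⟫) • p), b i - (t * ⟪b i, p⟫) • p⟫
        = ⟪H (b i), b i⟫ - 2 * t * (⟪H p, b i⟫ * ⟪b i, p⟫)
          + t ^ 2 * ⟪H p, p⟫ * (⟪p, b i⟫ * ⟪b i, p⟫) := by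
      intro i
      simp only [map_sub, map_smul, inner_sub_left, inner_sub_right, real_inner_smul_left,
        real_inner_smul_right, hsymm (b i) p, real_inner_comm (b i) p]
      ring
    simp only [hexp, Finset.sum_add_distrib, Finset.sum_sub_distrib, ← Finset.mul_sum,
      OrthonormalBasis.sum_inner_mul_inner, real_inner_self_eq_norm_sq] at hsum
    rw [← htr0] at hsum
    have h2 : t ^ 2 * ⟪H p, p⟫ * ‖p‖ ^ 2 = t * ⟪H p, p⟫ := by
      rw [ht]; field_simp
    rw [h2] at hsum
    have h3 : t * ⟪H p, p⟫ ≤ LinearMap.trace ℝ E H.toLinearMap := by linarith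
    rwa [ht, inv_mul_le_iff₀ hp0] at h3
  rw [sub_nonneg, div_le_iff₀ (by positivity)]
  nlinarith

theorem contDiff_mcOp : ContDiff ℝ 1 (fun z : E × (E →L[ℝ] E) => mcOp z.1 z.2) := by
  simp only [mcOp, trace_eq_sum]
  refine ((contDiff_areaFactor.comp contDiff_fst).inv
    fun z => (areaFactor_pos z.1).ne').mul (ContDiff.sub ?_ (ContDiff.div ?_ ?_ ?_))
  · refine ContDiff.sum fun i _ => ContDiff.inner ℝ contDiff_const ?_
    exact contDiff_snd.clm_apply contDiff_const
  · exact ContDiff.inner ℝ (contDiff_snd.clm_apply contDiff_fst) contDiff_fst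
  · exact contDiff_const.add (contDiff_fst.norm_sq ℝ)
  · intro z
    positivity

/-- Lipschitz dependence of the operator on the gradient, locally uniformly in the Hessian. -/
theorem exists_mcOp_lipschitz (G B : ℝ) : ∃ C : ℝ, 0 ≤ C ∧ ∀ p q : E, ∀ H : E →L[ℝ] E,
    ‖p‖ ≤ G → ‖q‖ ≤ G → ‖H‖ ≤ B → |mcOp p H - mcOp q H| ≤ C * ‖p - q‖ := by
  have hloc : LocallyLipschitzOn
      (Metric.closedBall (0 : E) G ×ˢ Metric.closedBall (0 : E →L[ℝ] E) B)
      (fun z : E × (E →L[ℝ] E) => mcOp z.1 z.2) :=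
    contDiff_mcOp.locallyLipschitz.locallyLipschitzOn
  obtain ⟨C, hC⟩ := hloc.exists_lipschitzOnWith_of_compact
    ((isCompact_closedBall _ _).prod (isCompact_closedBall _ _))
  refine ⟨C, C.2, fun p q H hp hq hH => ?_⟩
  have := hC.dist_le_mul (p, H) ⟨by simpa using hp, by simpa using hH⟩
    (q, H) ⟨by simpa using hq, by simpa using hH⟩
  rw [Prod.dist_eq, Real.dist_eq] at this
  simpa [dist_eq_norm] using this

end Algebra

section Calculus

variable {E : Type*} [NormedAddCommGroup E] [InnerProductSpace ℝ E] [FiniteDimensional ℝ E]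

theorem contDiffAt_gradient {u : E → ℝ} {x : E} (hu : ContDiffAt ℝ 2 u x) :
    ContDiffAt ℝ 1 (∇ u) x :=
  (InnerProductSpace.toDual ℝ E).symm.toContinuousLinearEquiv.contDiff.contDiffAt.comp x
    (hu.fderiv_right (m := 1) (by norm_num))

theorem differentiableAt_gradient {u : E → ℝ} {x : E} (hu : ContDiffAt ℝ 2 u x) :
    DifferentiableAt ℝ (∇ u) x :=
  (contDiffAt_gradient hu).differentiableAt one_ne_zero

theorem inner_fderiv_gradient {u : E → ℝ} {x : E} (hu : ContDiffAt ℝ 2 u x) (h k : E) :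
    ⟪fderiv ℝ (∇ u) x h, k⟫ = fderiv ℝ (fderiv ℝ u) x h k := by
  have hd : DifferentiableAt ℝ (fderiv ℝ u) x :=
    (hu.fderiv_right (m := 1) (by norm_num)).differentiableAt one_ne_zero
  have h1 : HasFDerivAt (fun y => ⟪∇ u y, k⟫) ((innerSL ℝ k) ∘L fderiv ℝ (∇ u) x) x := by
    have := (innerSL ℝ k).hasFDerivAt.comp x (differentiableAt_gradient hu).hasFDerivAt
    refine this.congr_of_eventuallyEq (Eventually.of_forall fun y => ?_)
    simp
  have h2 : HasFDerivAt (fun y => fderiv ℝ u y k)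
      ((ContinuousLinearMap.apply ℝ ℝ k) ∘L fderiv ℝ (fderiv ℝ u) x) x :=
    (ContinuousLinearMap.apply ℝ ℝ k).hasFDerivAt.comp x hd.hasFDerivAt
  have h3 : (fun y => ⟪∇ u y, k⟫) = fun y => fderiv ℝ u y k := by
    ext y
    exact inner_gradient_left
  rw [h3] at h1
  have := congrArg (fun L => L h) (h1.unique h2)
  simpa [real_inner_comm] using this

theorem inner_fderiv_gradient_symm {u : E → ℝ} {x : E} (hu : ContDiffAt ℝ 2 u x) (h k : E) :
    ⟪fderiv ℝ (∇ u) x h, k⟫ = ⟪fderiv ℝ (∇ u) x k, h⟫ := by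
  rw [inner_fderiv_gradient hu, inner_fderiv_gradient hu]
  exact (hu.isSymmSndFDerivAt (by simp)) h k

theorem gradient_sub_of_contDiffAt {u v : E → ℝ} {x : E} (hu : ContDiffAt ℝ 2 u x)
    (hv : ContDiffAt ℝ 2 v x) : ∇ (fun y => u y - v y) x = ∇ u x - ∇ v x := by
  unfold gradient
  rw [← map_sub]
  congr 1
  exact fderiv_fun_sub (hu.differentiableAt two_ne_zero) (hv.differentiableAt two_ne_zero)

theorem fderiv_gradient_sub {u v : E → ℝ} {x : E} (hu : ContDiffAt ℝ 2 u x)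
    (hv : ContDiffAt ℝ 2 v x) :
    fderiv ℝ (∇ (fun y => u y - v y)) x = fderiv ℝ (∇ u) x - fderiv ℝ (∇ v) x := by
  have h : ∇ (fun y => u y - v y) =ᶠ[𝓝 x] fun y => ∇ u y - ∇ v y := by
    filter_upwards [hu.eventually (by simp), hv.eventually (by simp)] with y h1 h2
    exact gradient_sub_of_contDiffAt h1 h2
  rw [h.fderiv_eq]
  exact fderiv_fun_sub (differentiableAt_gradient hu) (differentiableAt_gradient hv)

theorem gradient_eq_zero_of_isLocalMin {w : E → ℝ} {x : E} (hmin : IsLocalMin w x) :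
    ∇ w x = 0 := by
  simp [gradient, hmin.fderiv_eq_zero]

/-- Second derivative test: the Hessian at a local minimum is positive semidefinite. -/
theorem inner_fderiv_gradient_nonneg_of_isLocalMin {w : E → ℝ} {x : E}
    (hw : ContDiffAt ℝ 2 w x) (hmin : IsLocalMin w x) (k : E) :
    0 ≤ ⟪fderiv ℝ (∇ w) x k, k⟫ := by
  by_contra! hneg
  set c := ⟪fderiv ℝ (∇ w) x k, k⟫ with hc
  set φ : ℝ → ℝ := fun t => w (x + t • k) + (-c / 4) * t ^ 2 with hφ
  have hline : ∀ t : ℝ, HasDerivAt (fun t : ℝ => x + t • k) k t := fun t => by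
    simpa using ((hasDerivAt_id t).smul_const k).const_add x
  have hx0 : x + (0 : ℝ) • k = x := by simp
  have hcont : Tendsto (fun t : ℝ => x + t • k) (𝓝 0) (𝓝 x) := by
    simpa using (hline 0).continuousAt.tendsto
  have hev : ∀ᶠ t : ℝ in 𝓝 0, ContDiffAt ℝ 2 w (x + t • k) :=
    hcont.eventually (hw.eventually (by simp))
  have hd1 : ∀ᶠ t : ℝ in 𝓝 0, HasDerivAt φ (⟪∇ w (x + t • k), k⟫ + (-c / 2) * t) t := by
    filter_upwards [hev] with t ht
    have h1 := (ht.differentiableAt two_ne_zero).hasFDerivAt.comp_hasDerivAt t (hline t)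
    have h2 := ((hasDerivAt_pow 2 t).const_mul (-c / 4))
    have h3 := h1.add h2
    rw [← inner_gradient_left] at h3
    refine h3.congr_deriv ?_
    push_cast
    ring
  have hd2 : HasDerivAt (fun t : ℝ => ⟪∇ w (x + t • k), k⟫ + (-c / 2) * t) (c + (-c / 2)) 0 := by
    have h0 : HasFDerivAt (∇ w) (fderiv ℝ (∇ w) x) (x + (0 : ℝ) • k) := by
      rw [hx0]; exact (differentiableAt_gradient hw).hasFDerivAt
    have h1 := (h0.comp_hasDerivAt (0 : ℝ) (hline 0)).inner ℝ (hasDerivAt_const (0 : ℝ) k)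
    have h2 := (hasDerivAt_id (0 : ℝ)).const_mul (-c / 2)
    refine (h1.add h2).congr_deriv ?_
    simp [hc]
  have hdd : deriv (deriv φ) 0 = c + (-c / 2) := by
    have : deriv φ =ᶠ[𝓝 0] fun t : ℝ => ⟪∇ w (x + t • k), k⟫ + (-c / 2) * t := by
      filter_upwards [hd1] with t ht using ht.deriv
    rw [this.deriv_eq, hd2.deriv]
  have hd0 : deriv φ 0 = 0 := by
    rw [hd1.self_of_nhds.deriv, hx0, gradient_eq_zero_of_isLocalMin hmin]
    simp
  have hmax := isLocalMax_of_deriv_deriv_neg (f := φ) (x₀ := 0) (by rw [hdd]; linarith) hd0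
    hd1.self_of_nhds.continuousAt
  have hmin' : ∀ᶠ t : ℝ in 𝓝 0, w x ≤ w (x + t • k) :=
    hcont.eventually hmin
  have hboth : ∀ᶠ t : ℝ in 𝓝 0, t = 0 := by
    filter_upwards [hmax, hmin'] with t h1 h2
    simp only [hφ, hx0] at h1
    have : t ^ 2 ≤ 0 := by nlinarith
    nlinarith [sq_eq_zero_iff.1 (le_antisymm this (sq_nonneg t))]
  have hne : ∃ᶠ t : ℝ in 𝓝 0, t ≠ 0 :=
    (eventually_mem_nhdsWithin (a := (0 : ℝ)) (s := {0}ᶜ)).frequently.filter_mono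
      nhdsWithin_le_nhds
  exact hne (hboth.mono fun t ht => not_not.2 ht)

theorem contDiffAt_mcFlux_gradient {u : E → ℝ} {x : E} (hu : ContDiffAt ℝ 2 u x) :
    ContDiffAt ℝ 1 (fun y => mcFlux (∇ u y)) x :=
  contDiff_mcFlux.contDiffAt.comp x (contDiffAt_gradient hu)

/-- The divergence of the mean curvature flux in nondivergence form. -/
theorem trace_fderiv_mcFlux_gradient {u : E → ℝ} {x : E} (hu : ContDiffAt ℝ 2 u x) :
    LinearMap.trace ℝ E (fderiv ℝ (fun y => mcFlux (∇ u y)) x).toLinearMap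
      = mcOp (∇ u x) (fderiv ℝ (∇ u) x) := by
  have h : fderiv ℝ (fun y => mcFlux (∇ u y)) x
      = (fderiv ℝ mcFlux (∇ u x)) ∘L fderiv ℝ (∇ u) x :=
    (((contDiff_mcFlux (k := 1)).differentiable one_ne_zero _).hasFDerivAt.comp x
      (differentiableAt_gradient hu).hasFDerivAt).fderiv
  set p := ∇ u x
  set H := fderiv ℝ (∇ u) x with hH
  set b := stdOrthonormalBasis ℝ E
  have hsum : ∑ i, ⟪p, H (b i)⟫ * ⟪b i, p⟫ = ⟪H p, p⟫ := by
    have : ∀ i, ⟪p, H (b i)⟫ = ⟪H p, b i⟫ := fun i => by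
      rw [real_inner_comm, inner_fderiv_gradient_symm hu]
    simp_rw [this]
    exact b.sum_inner_mul_inner _ _
  rw [h, trace_eq_sum, mcOp, trace_eq_sum, ← hsum]
  simp only [ContinuousLinearMap.comp_apply, fderiv_mcFlux_apply, inner_smul_right,
    inner_sub_right, real_inner_comm]
  rw [Finset.sum_div, ← Finset.sum_sub_distrib, Finset.mul_sum]
  refine Finset.sum_congr rfl fun i _ => ?_
  ring

/-- The coordinate form of the mean curvature operator agrees with the invariant form. -/
theorem meanCurv_eq_mcOp {n : ℕ} {u : EuclideanSpace ℝ (Fin n) → ℝ}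
    {x : EuclideanSpace ℝ (Fin n)} (hu : ContDiffAt ℝ 2 u x) :
    meanCurv u x = mcOp (∇ u x) (fderiv ℝ (∇ u) x) := by
  set p := ∇ u x with hp
  set H := fderiv ℝ (∇ u) x with hH
  set b := EuclideanSpace.basisFun (Fin n) ℝ with hb
  have hent : ∀ i j, hessEntry u x i j = ⟪H (b i), b j⟫ := fun i j => by
    rw [inner_fderiv_gradient hu, hessEntry, iteratedFDeriv_two_apply]
    simp [hb]
  have htr : LinearMap.trace ℝ _ H.toLinearMap = ∑ i, ⟪H (b i), b i⟫ := by
    rw [LinearMap.trace_eq_sum_inner _ b]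
    exact Finset.sum_congr rfl fun i _ => real_inner_comm _ _
  have hpp : ⟪H p, p⟫ = ∑ i, ∑ j, p i * p j * ⟪H (b i), b j⟫ := by
    have hpe : p = ∑ i, p i • b i := by
      have := b.sum_repr p
      simpa [hb] using this.symm
    conv_lhs => rw [hpe]
    simp only [map_sum, map_smul, sum_inner, inner_sum, real_inner_smul_left,
      real_inner_smul_right]
    refine Finset.sum_congr rfl fun i _ => Finset.sum_congr rfl fun j _ => ?_
    rw [inner_fderiv_gradient_symm hu (b j)]
    ring
  rw [mcOp, htr, hpp, meanCurv]
  simp only [hent, mcCoeff, ← hp]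
  rw [Finset.sum_div, ← Finset.sum_sub_distrib, Finset.mul_sum]
  refine Finset.sum_congr rfl fun i _ => ?_
  rw [Finset.sum_div]
  have : ⟪H (b i), b i⟫ = ∑ j, (if i = j then 1 else 0) * ⟪H (b i), b j⟫ := by simp
  rw [this, ← Finset.sum_sub_distrib, Finset.mul_sum]
  refine Finset.sum_congr rfl fun j _ => ?_
  rw [areaFactor]
  ring

end Calculus

section PosPart

theorem hasDerivAt_posPart_sq (t : ℝ) :
    HasDerivAt (fun s : ℝ => max s 0 ^ 2) (2 * max t 0) t := by
  rcases lt_trichotomy t 0 with h | rfl | h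
  · have : (fun s : ℝ => max s 0 ^ 2) =ᶠ[𝓝 t] fun _ => 0 := by
      filter_upwards [eventually_lt_nhds h] with s hs
      simp [max_eq_right hs.le]
    rw [max_eq_right h.le, mul_zero]
    exact (hasDerivAt_const t (0 : ℝ)).congr_of_eventuallyEq this
  · have hO : (fun s : ℝ => max s 0 ^ 2) =O[𝓝 0] fun s : ℝ => s ^ 2 := by
      refine Asymptotics.IsBigO.of_bound 1 (Eventually.of_forall fun s => ?_)
      rw [one_mul, norm_pow, norm_pow]
      refine pow_le_pow_left₀ (norm_nonneg _) ?_ 2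
      rcases le_total s 0 with hs | hs <;> simp [hs]
    have ho := hO.trans_isLittleO (Asymptotics.isLittleO_pow_id (𝕜 := ℝ) one_lt_two)
    rw [hasDerivAt_iff_isLittleO]
    simpa using ho
  · have : (fun s : ℝ => max s 0 ^ 2) =ᶠ[𝓝 t] fun s => s ^ 2 := by
      filter_upwards [eventually_gt_nhds h] with s hs
      simp [max_eq_left hs.le]
    rw [max_eq_left h.le]
    simpa using (hasDerivAt_pow 2 t).congr_of_eventuallyEq this

theorem contDiff_posPart_sq : ContDiff ℝ 1 (fun s : ℝ => max s 0 ^ 2) := by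
  rw [contDiff_one_iff_deriv]
  refine ⟨fun t => (hasDerivAt_posPart_sq t).differentiableAt, ?_⟩
  have : deriv (fun s : ℝ => max s 0 ^ 2) = fun t => 2 * max t 0 :=
    funext fun t => (hasDerivAt_posPart_sq t).deriv
  rw [this]
  fun_prop

theorem posPart_cube_eq (s : ℝ) : max s 0 ^ 3 = max s 0 ^ 2 * s := by
  rcases le_total s 0 with hs | hs
  · simp [hs]
  · rw [max_eq_left hs]; ring

theorem contDiff_posPart_cube : ContDiff ℝ 1 (fun s : ℝ => max s 0 ^ 3) := by
  simp only [posPart_cube_eq]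
  exact contDiff_posPart_sq.mul contDiff_id

theorem hasDerivAt_posPart_cube (t : ℝ) :
    HasDerivAt (fun s : ℝ => max s 0 ^ 3) (3 * max t 0 ^ 2) t := by
  simp only [posPart_cube_eq]
  refine ((hasDerivAt_posPart_sq t).mul (hasDerivAt_id t)).congr_deriv ?_
  have : max t 0 * t = max t 0 ^ 2 := by
    rcases le_total t 0 with hs | hs
    · simp [hs]
    · rw [max_eq_left hs]; ring
  simp only [id]
  linear_combination 2 * this

end PosPart

section Indicator

variable {E : Type*} [NormedAddCommGroup E] {F : Type*} [NormedAddCommGroup F]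

theorem indicator_eventuallyEq_zero {U C : Set E} (hC : IsClosed C) {g : E → F}
    (h0 : ∀ x ∈ U, x ∉ C → g x = 0) {x : E} (hx : x ∉ C) :
    U.indicator g =ᶠ[𝓝 x] fun _ => 0 := by
  filter_upwards [hC.isOpen_compl.mem_nhds hx] with y hy
  by_cases hyU : y ∈ U
  · rw [indicator_of_mem hyU, h0 y hyU hy]
  · exact indicator_of_notMem hyU g

theorem indicator_eventuallyEq_self {U : Set E} (hU : IsOpen U) (g : E → F) {x : E} (hx : x ∈ U) :
    U.indicator g =ᶠ[𝓝 x] g := by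
  filter_upwards [hU.mem_nhds hx] with y hy using indicator_of_mem hy g

theorem hasCompactSupport_indicator {U C : Set E} (hC : IsCompact C) {g : E → F}
    (h0 : ∀ x ∈ U, x ∉ C → g x = 0) : HasCompactSupport (U.indicator g) := by
  refine HasCompactSupport.intro hC fun x hx => ?_
  by_cases hxU : x ∈ U
  · rw [indicator_of_mem hxU, h0 x hxU hx]
  · exact indicator_of_notMem hxU g

theorem integrable_indicator_of_compact [MeasurableSpace E] [BorelSpace E] {μ : Measure E}
    [IsFiniteMeasureOnCompacts μ] {U C : Set E} (hU : IsOpen U) (hC : IsCompact C)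
    (hCU : C ⊆ U) {g : E → F} (hg : ContinuousOn g U) (h0 : ∀ x ∈ U, x ∉ C → g x = 0) :
    Integrable (U.indicator g) μ := by
  refine Continuous.integrable_of_hasCompactSupport ?_ (hasCompactSupport_indicator hC h0)
  rw [continuous_iff_continuousAt]
  intro x
  by_cases hx : x ∈ C
  · exact (hg.continuousAt (hU.mem_nhds (hCU hx))).congr
      (indicator_eventuallyEq_self hU g (hCU hx)).symm
  · exact continuousAt_const.congr (indicator_eventuallyEq_zero hC.isClosed h0 hx).symm

variable [NormedSpace ℝ E] [NormedSpace ℝ F]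

theorem contDiff_indicator {k : WithTop ℕ∞} {U C : Set E} (hU : IsOpen U) (hC : IsClosed C)
    (hCU : C ⊆ U) {g : E → F} (hg : ∀ x ∈ U, ContDiffAt ℝ k g x)
    (h0 : ∀ x ∈ U, x ∉ C → g x = 0) : ContDiff ℝ k (U.indicator g) := by
  rw [contDiff_iff_contDiffAt]
  intro x
  by_cases hx : x ∈ C
  · exact (hg x (hCU hx)).congr_of_eventuallyEq (indicator_eventuallyEq_self hU g (hCU hx))
  · exact contDiffAt_const.congr_of_eventuallyEq (indicator_eventuallyEq_zero hC h0 hx)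

end Indicator

section Integral

variable {E : Type*} [NormedAddCommGroup E] [InnerProductSpace ℝ E] [FiniteDimensional ℝ E]
  [MeasurableSpace E] [BorelSpace E]

theorem integral_fderiv_apply_eq_zero {g : E → ℝ} (hg : ContDiff ℝ 1 g)
    (hc : HasCompactSupport g) (v : E) : ∫ x, fderiv ℝ g x v = 0 := by
  have hint : Integrable (fun x => fderiv ℝ g x v) :=
    ((hg.continuous_fderiv one_ne_zero).clm_apply continuous_const).integrable_of_hasCompactSupport
      (hc.fderiv_apply ℝ v)
  have h := integral_mul_fderiv_eq_neg_fderiv_mul_of_integrable (μ := (volume : Measure E))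
    (f := fun _ : E => (1 : ℝ)) (g := g) (v := v) (by simp) (by simpa using hint)
    (by simpa using hg.continuous.integrable_of_hasCompactSupport hc)
    (fun x _ => differentiableAt_const _) (fun x _ => hg.differentiable one_ne_zero x)
  simpa using h

/-- The divergence of a compactly supported `C¹` vector field has zero integral. -/
theorem integrable_trace_fderiv {F : E → E} (hF : ContDiff ℝ 1 F) (hc : HasCompactSupport F) :
    Integrable (fun x => LinearMap.trace ℝ E (fderiv ℝ F x).toLinearMap) ∧
    ∫ x, LinearMap.trace ℝ E (fderiv ℝ F x).toLinearMap = 0 := by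
  set b := stdOrthonormalBasis ℝ E
  have hcomp : ∀ i, ContDiff ℝ 1 (fun x => ⟪b i, F x⟫) := fun i => contDiff_const.inner ℝ hF
  have hsupp : ∀ i, HasCompactSupport (fun x => ⟪b i, F x⟫) := fun i =>
    hc.comp_left (g := fun y => ⟪b i, y⟫) (inner_zero_right _)
  have hder : ∀ i x, fderiv ℝ (fun x => ⟪b i, F x⟫) x (b i) = ⟪b i, fderiv ℝ F x (b i)⟫ := by
    intro i x
    have := (innerSL ℝ (b i)).hasFDerivAt.comp x (hF.differentiable one_ne_zero x).hasFDerivAt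
    have h2 : HasFDerivAt (fun x => ⟪b i, F x⟫) (innerSL ℝ (b i) ∘L fderiv ℝ F x) x := this
    rw [h2.fderiv]
    simp
  have heq : (fun x => LinearMap.trace ℝ E (fderiv ℝ F x).toLinearMap)
      = fun x => ∑ i, fderiv ℝ (fun x => ⟪b i, F x⟫) x (b i) := by
    ext x
    simp only [hder, trace_eq_sum, b]
  have hint : ∀ i, Integrable (fun x => fderiv ℝ (fun x => ⟪b i, F x⟫) x (b i)) := fun i =>
    (((hcomp i).continuous_fderiv one_ne_zero).clm_apply
      continuous_const).integrable_of_hasCompactSupport ((hsupp i).fderiv_apply ℝ (b i))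
  rw [heq]
  refine ⟨integrable_finsetSum _ fun i _ => hint i, ?_⟩
  rw [integral_finsetSum _ fun i _ => hint i]
  exact Finset.sum_eq_zero fun i _ => integral_fderiv_apply_eq_zero (hcomp i) (hsupp i) _

/-- A Poincaré inequality for functions supported in sets of small measure. -/
theorem exists_poincare_of_small_measure (hn : 2 ≤ finrank ℝ E) {τ : ℝ} (hτ : 0 < τ) :
    ∃ δ : ℝ, 0 < δ ∧ ∀ (S : Set E) (T : E → ℝ), MeasurableSet S →
      volume S ≤ ENNReal.ofReal δ → ContDiff ℝ 1 T → HasCompactSupport T →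
      (∀ x ∉ S, T x = 0) → ∫ x, ‖T x‖ ≤ τ * ∫ x, ‖fderiv ℝ T x‖ := by
  set n : ℝ≥0 := ((finrank ℝ E : ℕ) : ℝ≥0) with hndef
  have hn1 : (1 : ℝ≥0) < n := by
    rw [hndef]
    exact_mod_cast hn
  set p : ℝ≥0 := n.conjExponent with hp
  have hpq : NNReal.HolderConjugate n p := .conjExponent hn1
  have hp1 : 1 < p := hpq.symm.lt
  set a : ℝ := 1 - 1 / (p : ℝ) with ha
  have hp1' : (1 : ℝ) < p := by exact_mod_cast hp1
  have ha0 : 0 < a := by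
    rw [ha, sub_pos, div_lt_one (by linarith)]
    exact hp1'
  set C : ℝ≥0 := eLpNormLESNormFDerivOneConst (volume : Measure E) p with hC
  set r : ℝ := τ / (C + 1) with hr
  have hr0 : 0 < r := by positivity
  refine ⟨r ^ a⁻¹, by positivity, fun S T hS hvol hT hc h0 => ?_⟩
  have hmeas : AEStronglyMeasurable T (volume : Measure E) := hT.continuous.aestronglyMeasurable
  have hrestr : ∀ q : ℝ≥0∞, eLpNorm T q (volume.restrict S) = eLpNorm T q volume := fun q => by
    rw [← eLpNorm_indicator_eq_eLpNorm_restrict hS]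
    congr 1
    ext x
    by_cases hx : x ∈ S
    · simp [hx]
    · simp [hx, h0 x hx]
  have h1 : eLpNorm T 1 volume ≤ eLpNorm T p volume * volume S ^ a := by
    have := eLpNorm_le_eLpNorm_mul_rpow_measure_univ (p := 1) (q := (p : ℝ≥0∞))
      (by exact_mod_cast hp1.le) (hmeas.restrict (s := S))
    rw [hrestr, hrestr, Measure.restrict_apply_univ] at this
    simpa [ha] using this
  have h2 : eLpNorm T p volume ≤ C * eLpNorm (fderiv ℝ T) 1 volume :=
    eLpNorm_le_eLpNorm_fderiv_one volume hT hc (by exact_mod_cast hpq)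
  have h3 : volume S ^ a ≤ ENNReal.ofReal r := by
    calc volume S ^ a ≤ ENNReal.ofReal (r ^ a⁻¹) ^ a := by gcongr
      _ = ENNReal.ofReal r := by
        rw [ENNReal.ofReal_rpow_of_pos (by positivity), ← Real.rpow_mul hr0.le,
          inv_mul_cancel₀ ha0.ne', Real.rpow_one]
  have hTint : Integrable T := hT.continuous.integrable_of_hasCompactSupport hc
  have hDint : Integrable (fderiv ℝ T) :=
    (hT.continuous_fderiv one_ne_zero).integrable_of_hasCompactSupport (hc.fderiv ℝ)
  have e1 : eLpNorm T 1 volume = ENNReal.ofReal (∫ x, ‖T x‖) := by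
    rw [eLpNorm_one_eq_lintegral_enorm, ofReal_integral_norm_eq_lintegral_enorm hTint]
  have e2 : eLpNorm (fderiv ℝ T) 1 volume = ENNReal.ofReal (∫ x, ‖fderiv ℝ T x‖) := by
    rw [eLpNorm_one_eq_lintegral_enorm, ofReal_integral_norm_eq_lintegral_enorm hDint]
  have hD0 : 0 ≤ ∫ x, ‖fderiv ℝ T x‖ := integral_nonneg fun x => norm_nonneg _
  have h4 : ENNReal.ofReal (∫ x, ‖T x‖)
      ≤ ENNReal.ofReal (C * (∫ x, ‖fderiv ℝ T x‖) * r) := by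
    rw [ENNReal.ofReal_mul (by positivity), ENNReal.ofReal_mul (by positivity), ← e1, ← e2,
      ENNReal.ofReal_coe_nnreal]
    exact h1.trans (mul_le_mul' h2 h3)
  rw [ENNReal.ofReal_le_ofReal_iff (by positivity)] at h4
  refine h4.trans ?_
  have h5 : C * r ≤ τ := by
    rw [hr, mul_div_assoc', div_le_iff₀ (by positivity)]
    nlinarith
  calc C * (∫ x, ‖fderiv ℝ T x‖) * r = C * r * ∫ x, ‖fderiv ℝ T x‖ := by ring
    _ ≤ _ := by gcongr

end Integral

section Comparison

theorem ComparisonPair.posPart_eq_zero {X : Type*} {U : Set X} {u v : X → ℝ} {ε : ℝ} {x : X}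
    (hx : x ∈ U) (hxC : x ∉ {x | x ∈ U ∧ ε ≤ u x - v x}) :
    max (u x - v x - ε) 0 = 0 := by
  have : u x - v x < ε := by
    by_contra! h
    exact hxC ⟨hx, h⟩
  exact max_eq_right (by linarith)

variable {E : Type*} [NormedAddCommGroup E] [InnerProductSpace ℝ E] [FiniteDimensional ℝ E]

/-- `u` is a subsolution relative to `v` on the open set `U`, for the mean curvature operator with
a zeroth order term of Lipschitz constant `K`, and `u ≤ v` on the boundary of `U`. -/
structure ComparisonPair (U : Set E) (u v : E → ℝ) (G K : ℝ) : Prop where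
  isOpen : IsOpen U
  contDiffAt_left : ∀ x ∈ U, ContDiffAt ℝ 2 u x
  contDiffAt_right : ∀ x ∈ U, ContDiffAt ℝ 2 v x
  norm_gradient_left : ∀ x ∈ U, ‖∇ u x‖ ≤ G
  norm_gradient_right : ∀ x ∈ U, ‖∇ v x‖ ≤ G
  mcOp_sub_le : ∀ x ∈ U, v x < u x →
    mcOp (∇ v x) (fderiv ℝ (∇ v) x) - mcOp (∇ u x) (fderiv ℝ (∇ u) x) ≤ K * (u x - v x)
  isCompact : ∀ ε : ℝ, 0 < ε → IsCompact {x | x ∈ U ∧ ε ≤ u x - v x}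

namespace ComparisonPair

variable {U : Set E} {u v : E → ℝ} {G K ε : ℝ}

theorem contDiffAt_sub (h : ComparisonPair U u v G K) (ε : ℝ) {x : E} (hx : x ∈ U) :
    ContDiffAt ℝ 1 (fun y => u y - v y - ε) x :=
  (((h.contDiffAt_left x hx).sub (h.contDiffAt_right x hx)).sub contDiffAt_const).of_le
    (by norm_num)

theorem continuousOn_sub (h : ComparisonPair U u v G K) :
    ContinuousOn (fun y => u y - v y) U := fun x hx =>
  ((h.contDiffAt_left x hx).sub (h.contDiffAt_right x hx)).continuousAt.continuousWithinAt

theorem continuousOn_gradient_sub (h : ComparisonPair U u v G K) :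
    ContinuousOn (fun y => ∇ u y - ∇ v y) U := fun x hx =>
  ((contDiffAt_gradient (h.contDiffAt_left x hx)).sub
    (contDiffAt_gradient (h.contDiffAt_right x hx))).continuousAt.continuousWithinAt

theorem hasFDerivAt_sub (h : ComparisonPair U u v G K) (ε : ℝ) {x : E} (hx : x ∈ U) :
    HasFDerivAt (fun y => u y - v y - ε) (innerSL ℝ (∇ u x - ∇ v x)) x := by
  have h1 := ((h.contDiffAt_left x hx).differentiableAt two_ne_zero).hasGradientAt.hasFDerivAt
  have h2 := ((h.contDiffAt_right x hx).differentiableAt two_ne_zero).hasGradientAt.hasFDerivAt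
  refine ((h1.sub h2).sub_const ε).congr_fderiv ?_
  ext k
  simp

theorem isOpen_setOf_lt (h : ComparisonPair U u v G K) : IsOpen {x | x ∈ U ∧ v x < u x} := by
  have := h.continuousOn_sub.isOpen_inter_preimage h.isOpen (isOpen_Ioi (a := (0 : ℝ)))
  convert this using 1
  ext x
  simp

variable [MeasurableSpace E] [BorelSpace E]

theorem integrable_weight (h : ComparisonPair U u v G K) (hε : 0 < ε) {g : ℝ → ℝ}
    (hg : Continuous g) (hg0 : g 0 = 0) {f : E → ℝ} (hf : ContinuousOn f U) :
    Integrable (U.indicator fun x => g (max (u x - v x - ε) 0) * f x) := by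
  refine integrable_indicator_of_compact h.isOpen (h.isCompact ε hε) (fun x hx => hx.1) ?_
    fun x hx hxC => ?_
  · have hmax : Continuous fun t : ℝ => max (t - ε) 0 := by fun_prop
    exact ((hg.comp hmax).comp_continuousOn h.continuousOn_sub).mul hf
  · simp [posPart_eq_zero hx hxC, hg0]

/-- The energy inequality obtained by testing with the square of a truncation. -/
theorem energy_le (h : ComparisonPair U u v G K) (hε : 0 < ε) :
    2 * (Real.sqrt (1 + G ^ 2) ^ 3)⁻¹ *
        ∫ x, U.indicator (fun x => max (u x - v x - ε) 0 * ‖∇ u x - ∇ v x‖ ^ 2) x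
      ≤ K * ∫ x, U.indicator (fun x => max (u x - v x - ε) 0 ^ 2 * (u x - v x)) x := by
  set c := (Real.sqrt (1 + G ^ 2) ^ 3)⁻¹ with hc
  set X : E → E := fun x => mcFlux (∇ u x) - mcFlux (∇ v x) with hX
  set F : E → E := fun x => max (u x - v x - ε) 0 ^ 2 • X x with hF
  have hX1 : ∀ x ∈ U, ContDiffAt ℝ 1 X x := fun x hx =>
    (contDiffAt_mcFlux_gradient (h.contDiffAt_left x hx)).sub
      (contDiffAt_mcFlux_gradient (h.contDiffAt_right x hx))
  have hF1 : ∀ x ∈ U, ContDiffAt ℝ 1 F x := fun x hx =>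
    (contDiff_posPart_sq.contDiffAt.comp x (h.contDiffAt_sub ε hx)).smul (hX1 x hx)
  have hF0 : ∀ x ∈ U, x ∉ {x | x ∈ U ∧ ε ≤ u x - v x} → F x = 0 := fun x hx hxC => by
    simp [hF, posPart_eq_zero hx hxC]
  have hC := h.isCompact ε hε
  obtain ⟨hdivint, hdiv0⟩ := integrable_trace_fderiv
    (contDiff_indicator h.isOpen hC.isClosed (fun x hx => hx.1) hF1 hF0)
    (hasCompactSupport_indicator hC hF0)
  have hint1 : Integrable
      (U.indicator (fun x => max (u x - v x - ε) 0 * ‖∇ u x - ∇ v x‖ ^ 2)) :=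
    h.integrable_weight hε (g := fun t => t) continuous_id rfl
      (h.continuousOn_gradient_sub.norm.pow 2)
  have hint2 : Integrable (U.indicator (fun x => max (u x - v x - ε) 0 ^ 2 * (u x - v x))) :=
    h.integrable_weight hε (g := fun t => t ^ 2) (continuous_pow 2) (by simp) h.continuousOn_sub
  have hpt : ∀ x, 2 * c * U.indicator (fun x => max (u x - v x - ε) 0 * ‖∇ u x - ∇ v x‖ ^ 2) x
      - K * U.indicator (fun x => max (u x - v x - ε) 0 ^ 2 * (u x - v x)) x
      ≤ LinearMap.trace ℝ E (fderiv ℝ (U.indicator F) x).toLinearMap := by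
    intro x
    by_cases hx : x ∈ U
    · rw [(indicator_eventuallyEq_self h.isOpen F hx).fderiv_eq, indicator_of_mem hx,
        indicator_of_mem hx]
      set z := max (u x - v x - ε) 0 with hz
      have hz0 : 0 ≤ z := le_max_right _ _
      have hd1 : HasFDerivAt (fun y => max (u y - v y - ε) 0 ^ 2)
          ((2 * z) • innerSL ℝ (∇ u x - ∇ v x)) x :=
        (hasDerivAt_posPart_sq _).comp_hasFDerivAt x (h.hasFDerivAt_sub ε hx)
      have hd2 := ((hX1 x hx).differentiableAt one_ne_zero).hasFDerivAt
      have hFd : HasFDerivAt F _ x := hd1.smul hd2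
      have hXtr : LinearMap.trace ℝ E (fderiv ℝ X x).toLinearMap
          = mcOp (∇ u x) (fderiv ℝ (∇ u) x) - mcOp (∇ v x) (fderiv ℝ (∇ v) x) := by
        have hu1 := (contDiffAt_mcFlux_gradient (h.contDiffAt_left x hx)).differentiableAt
          one_ne_zero
        have hv1 := (contDiffAt_mcFlux_gradient (h.contDiffAt_right x hx)).differentiableAt
          one_ne_zero
        rw [hX, fderiv_fun_sub hu1 hv1, ContinuousLinearMap.toLinearMap_sub, map_sub,
          trace_fderiv_mcFlux_gradient (h.contDiffAt_left x hx),
          trace_fderiv_mcFlux_gradient (h.contDiffAt_right x hx)]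
      have htr : LinearMap.trace ℝ E (fderiv ℝ F x).toLinearMap
          = z ^ 2 * (mcOp (∇ u x) (fderiv ℝ (∇ u) x) - mcOp (∇ v x) (fderiv ℝ (∇ v) x))
            + 2 * z * ⟪X x, ∇ u x - ∇ v x⟫ := by
        rw [hFd.fderiv, ContinuousLinearMap.toLinearMap_add, map_add,
          ContinuousLinearMap.toLinearMap_smul, map_smul, hXtr, trace_eq_sum]
        congr 1
        rw [← (stdOrthonormalBasis ℝ E).sum_inner_mul_inner, Finset.mul_sum]
        refine Finset.sum_congr rfl fun i _ => ?_
        simp only [ContinuousLinearMap.smulRight_apply, smul_apply,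
          innerSL_apply_apply, inner_smul_right, smul_eq_mul,
          real_inner_comm (X x), real_inner_comm (∇ u x - ∇ v x)]
        ring
      rw [htr]
      have hmono := mcFlux_monotone (h.norm_gradient_left x hx) (h.norm_gradient_right x hx)
      have h1 : 2 * c * (z * ‖∇ u x - ∇ v x‖ ^ 2) ≤ 2 * z * ⟪X x, ∇ u x - ∇ v x⟫ := by
        have := mul_le_mul_of_nonneg_left hmono (by positivity : 0 ≤ 2 * z)
        linarith
      have h2 : -(K * (z ^ 2 * (u x - v x)))
          ≤ z ^ 2 * (mcOp (∇ u x) (fderiv ℝ (∇ u) x) - mcOp (∇ v x) (fderiv ℝ (∇ v) x)) := by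
        rcases lt_or_ge (v x) (u x) with hlt | hge
        · have := mul_le_mul_of_nonneg_left (h.mcOp_sub_le x hx hlt) (sq_nonneg z)
          linarith
        · have : z = 0 := max_eq_right (by linarith)
          simp [this]
      linarith
    · have hxC : x ∉ {x | x ∈ U ∧ ε ≤ u x - v x} := fun h' => hx h'.1
      rw [(indicator_eventuallyEq_zero hC.isClosed hF0 hxC).fderiv_eq, indicator_of_notMem hx,
        indicator_of_notMem hx]
      simp
  have hfin := integral_mono ((hint1.const_mul (2 * c)).sub (hint2.const_mul K)) hdivint hpt
  rw [hdiv0] at hfin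
  simp only [Pi.sub_apply] at hfin
  rw [integral_sub (hint1.const_mul _) (hint2.const_mul _), integral_const_mul,
    integral_const_mul] at hfin
  linarith

/-- The maximum principle in domains where the violation set has small measure. -/
theorem exists_small_measure_le (hn : 2 ≤ finrank ℝ E) (G : ℝ) {K : ℝ} (hK : 0 ≤ K) :
    ∃ δ : ℝ, 0 < δ ∧ ∀ (U : Set E) (u v : E → ℝ), ComparisonPair U u v G K →
      volume {x | x ∈ U ∧ v x < u x} ≤ ENNReal.ofReal δ → ∀ x ∈ U, u x ≤ v x := by
  set c := (Real.sqrt (1 + G ^ 2) ^ 3)⁻¹ with hc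
  have hc0 : 0 < c := by positivity
  set τ := Real.sqrt (c / (9 * (K + 1))) with hτ
  have hτ0 : 0 < τ := Real.sqrt_pos.2 (by positivity)
  have hτ2 : τ ^ 2 = c / (9 * (K + 1)) := Real.sq_sqrt (by positivity)
  obtain ⟨δ, hδ, hP⟩ := exists_poincare_of_small_measure (E := E) hn hτ0
  refine ⟨δ, hδ, fun U u v h hvol => ?_⟩
  set S : Set E := {x | x ∈ U ∧ v x < u x} with hS
  have hSm : MeasurableSet S := h.isOpen_setOf_lt.measurableSet
  obtain ⟨m, hm0, hm⟩ : ∃ m : ℝ, 0 ≤ m ∧ ∀ x ∈ U, u x - v x ≤ m := by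
    obtain ⟨m, hm⟩ := ((h.isCompact 1 one_pos).bddAbove_image
      (h.continuousOn_sub.mono fun x hx => hx.1))
    refine ⟨max m 1, by positivity, fun x hx => ?_⟩
    by_cases hx1 : 1 ≤ u x - v x
    · exact (hm (mem_image_of_mem _ ⟨hx, hx1⟩)).trans (le_max_left _ _)
    · exact (not_le.1 hx1).le.trans (le_max_right _ _)
  set I : ℝ → ℝ := fun ε => ∫ x, U.indicator (fun x => max (u x - v x - ε) 0 ^ 3) x with hI
  have hint3 : ∀ ε, 0 < ε → Integrable (U.indicator (fun x => max (u x - v x - ε) 0 ^ 3)) :=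
    fun ε hε => by
      simpa using h.integrable_weight hε (g := fun t => t ^ 3) (continuous_pow 3) (by simp)
        (f := fun _ => 1) continuousOn_const
  have hbound : ∀ ε, 0 < ε → I ε ≤ ε * (m ^ 2 * δ) := by
    intro ε hε
    set z : E → ℝ := fun x => max (u x - v x - ε) 0 with hz
    have hz0 : ∀ x, 0 ≤ z x := fun x => le_max_right _ _
    have hC := h.isCompact ε hε
    have hint2 : Integrable (U.indicator fun x => z x ^ 2) := by
      simpa using h.integrable_weight hε (g := fun t => t ^ 2) (continuous_pow 2) (by simp)
        (f := fun _ => 1) continuousOn_const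
    have hintJ : Integrable (U.indicator fun x => z x * ‖∇ u x - ∇ v x‖ ^ 2) :=
      h.integrable_weight hε (g := fun t => t) continuous_id rfl
        (h.continuousOn_gradient_sub.norm.pow 2)
    set J := ∫ x, U.indicator (fun x => z x * ‖∇ u x - ∇ v x‖ ^ 2) x with hJ
    set M := ∫ x, U.indicator (fun x => z x ^ 2) x with hM
    have hM_le : M ≤ m ^ 2 * δ := by
      have hSfin : volume S ≠ ∞ := (hvol.trans_lt ENNReal.ofReal_lt_top).ne
      have h1 : M ≤ ∫ x, S.indicator (fun _ => m ^ 2) x := by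
        refine integral_mono hint2 ((integrable_indicator_iff hSm).2
          (integrableOn_const hSfin)) fun x => ?_
        by_cases hx : x ∈ U
        · rw [indicator_of_mem hx]
          by_cases hxS : x ∈ S
          · rw [indicator_of_mem hxS]
            exact pow_le_pow_left₀ (hz0 x) (max_le (by linarith [hm x hx]) hm0) 2
          · have : u x ≤ v x := not_lt.1 fun hlt => hxS ⟨hx, hlt⟩
            have hzx : z x = 0 := max_eq_right (by linarith)
            rw [indicator_of_notMem hxS, hzx]
            simp
        · rw [indicator_of_notMem hx]
          exact indicator_nonneg (fun _ _ => by positivity) x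
      rw [integral_indicator_const _ hSm, smul_eq_mul] at h1
      have h2 : volume.real S ≤ δ := ENNReal.toReal_le_of_le_ofReal hδ.le hvol
      nlinarith [mul_le_mul_of_nonneg_right h2 (sq_nonneg m)]
    have hE : 2 * c * J ≤ K * (I ε + ε * M) := by
      have h1 := h.energy_le hε
      have h2 : ∫ x, U.indicator (fun x => max (u x - v x - ε) 0 ^ 2 * (u x - v x)) x
          = I ε + ε * M := by
        rw [hI, hM, ← integral_const_mul, ← integral_add (hint3 ε hε) (hint2.const_mul ε)]
        refine integral_congr_ae (Eventually.of_forall fun x => ?_)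
        by_cases hx : x ∈ U
        · simp only [indicator_of_mem hx, posPart_cube_eq, hz]
          ring
        · simp [indicator_of_notMem hx]
      rwa [h2] at h1
    have hT0 : ∀ x ∈ U, x ∉ {x | x ∈ U ∧ ε ≤ u x - v x} → z x ^ 3 = 0 := fun x hx hxC => by
      simp [hz, posPart_eq_zero hx hxC]
    have hT1 := contDiff_indicator (k := 1) (g := fun x => z x ^ 3) h.isOpen hC.isClosed
      (fun x hx => hx.1)
      (fun x hx => contDiff_posPart_cube.contDiffAt.comp x (h.contDiffAt_sub ε hx)) hT0
    have hTc := hasCompactSupport_indicator (g := fun x => z x ^ 3) hC hT0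
    have hPT := hP S _ hSm hvol hT1 hTc fun x hx => by
      by_cases hxU : x ∈ U
      · rw [indicator_of_mem hxU]
        refine hT0 x hxU fun hxC => hx ⟨hxU, ?_⟩
        linarith [hxC.2]
      · exact indicator_of_notMem hxU _
    have hIeq : ∫ x, ‖U.indicator (fun x => z x ^ 3) x‖ = I ε := by
      refine integral_congr_ae (Eventually.of_forall fun x => ?_)
      exact Real.norm_of_nonneg (indicator_nonneg (fun y _ => pow_nonneg (hz0 y) 3) x)
    have hD : τ * ∫ x, ‖fderiv ℝ (U.indicator (fun x => z x ^ 3)) x‖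
        ≤ (1 / 2) * I ε + (9 / 2) * τ ^ 2 * J := by
      rw [hI, hJ, ← integral_const_mul, ← integral_const_mul, ← integral_const_mul,
        ← integral_add ((hint3 ε hε).const_mul _) (hintJ.const_mul _)]
      refine integral_mono
        (((hT1.continuous_fderiv one_ne_zero).norm.integrable_of_hasCompactSupport
        (hTc.fderiv ℝ).norm).const_mul _)
        (((hint3 ε hε).const_mul _).add (hintJ.const_mul _)) fun x => ?_
      by_cases hx : x ∈ U
      · have hd : HasFDerivAt (fun y => z y ^ 3)
            ((3 * z x ^ 2) • innerSL ℝ (∇ u x - ∇ v x)) x :=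
          (hasDerivAt_posPart_cube _).comp_hasFDerivAt x (h.hasFDerivAt_sub ε hx)
        simp only [indicator_of_mem hx]
        rw [(indicator_eventuallyEq_self h.isOpen _ hx).fderiv_eq, hd.fderiv, norm_smul,
          innerSL_apply_norm, Real.norm_of_nonneg (by positivity)]
        nlinarith [mul_nonneg (hz0 x) (sq_nonneg (z x - 3 * τ * ‖∇ u x - ∇ v x‖))]
      · simp only [indicator_of_notMem hx]
        rw [(indicator_eventuallyEq_zero hC.isClosed hT0 fun h' => hx h'.1).fderiv_eq]
        simp
    rw [hIeq] at hPT
    have hJ0 : 0 ≤ J := integral_nonneg fun x =>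
      indicator_nonneg (fun y _ => mul_nonneg (hz0 y) (sq_nonneg _)) x
    have hI0 : 0 ≤ I ε := integral_nonneg fun x =>
      indicator_nonneg (fun y _ => pow_nonneg (hz0 y) 3) x
    have hM0 : 0 ≤ M := integral_nonneg fun x =>
      indicator_nonneg (fun y _ => sq_nonneg _) x
    have h3 : I ε ≤ 9 * τ ^ 2 * J := by linarith
    have h4 : 2 * (K + 1) * I ε ≤ K * (I ε + ε * M) := by
      have : 9 * τ ^ 2 * (K + 1) = c := by
        rw [hτ2]; field_simp
      nlinarith
    have h5 : I ε ≤ ε * M := by nlinarith [mul_nonneg hε.le hM0]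
    exact h5.trans (mul_le_mul_of_nonneg_left hM_le hε.le)
  intro x hx
  by_contra! hlt
  set ε₀ := (u x - v x) / 2 with hε₀
  have hε₀0 : 0 < ε₀ := by rw [hε₀]; linarith
  have hpos : 0 < I ε₀ := by
    have hT0 : ∀ y ∈ U, y ∉ {y | y ∈ U ∧ ε₀ ≤ u y - v y} → max (u y - v y - ε₀) 0 ^ 3 = 0 :=
      fun y hy hyC => by simp [posPart_eq_zero hy hyC]
    have hC := h.isCompact ε₀ hε₀0
    have hT1 := contDiff_indicator (k := 1) (g := fun x => max (u x - v x - ε₀) 0 ^ 3) h.isOpen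
      hC.isClosed (fun x hx => hx.1)
      (fun x hx => contDiff_posPart_cube.contDiffAt.comp x (h.contDiffAt_sub ε₀ hx)) hT0
    refine hT1.continuous.integral_pos_of_hasCompactSupport_nonneg_nonzero
      (hasCompactSupport_indicator hC hT0)
      (fun y => indicator_nonneg (fun y _ => pow_nonneg (le_max_right _ _) 3) y) (x := x) ?_
    rw [indicator_of_mem hx, max_eq_left (by rw [hε₀]; linarith)]
    have : 0 < u x - v x - ε₀ := by rw [hε₀]; linarith
    positivity
  have hlim : Tendsto (fun ε : ℝ => ε * (m ^ 2 * δ)) (𝓝[>] 0) (𝓝 0) := by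
    have : Tendsto (fun ε : ℝ => ε * (m ^ 2 * δ)) (𝓝 0) (𝓝 (0 * (m ^ 2 * δ))) :=
      tendsto_id.mul_const _
    rw [zero_mul] at this
    exact this.mono_left nhdsWithin_le_nhds
  have hle : I ε₀ ≤ 0 := by
    refine ge_of_tendsto hlim ?_
    filter_upwards [Ioo_mem_nhdsGT hε₀0] with ε hε
    refine le_trans ?_ (hbound ε hε.1)
    refine integral_mono (hint3 _ hε₀0) (hint3 _ hε.1) fun y => ?_
    refine indicator_le_indicator ?_
    refine pow_le_pow_left₀ (le_max_right _ _) (max_le_max_right _ ?_) 3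
    linarith [hε.2]
  linarith

end ComparisonPair

end Comparison

section Hopf

variable {E : Type*} [NormedAddCommGroup E] [InnerProductSpace ℝ E]

/-- The barrier `ρ + βρ²` with `ρ = d² - |x - y|²`, scaled by `ε`. -/
def hopfBarrier (y : E) (d β ε : ℝ) (x : E) : ℝ :=
  ε * ((d ^ 2 - ‖x - y‖ ^ 2) + β * (d ^ 2 - ‖x - y‖ ^ 2) ^ 2)

theorem contDiff_hopfBarrier (y : E) (d β ε : ℝ) {k : WithTop ℕ∞} :
    ContDiff ℝ k (hopfBarrier y d β ε) := by
  have h : ContDiff ℝ k (fun x : E => d ^ 2 - ‖x - y‖ ^ 2) :=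
    contDiff_const.sub ((contDiff_id.sub contDiff_const).norm_sq ℝ)
  exact contDiff_const.mul (h.add (contDiff_const.mul (h.pow 2)))

theorem hasFDerivAt_sub_norm_sq (y : E) (d : ℝ) (x : E) :
    HasFDerivAt (fun x : E => d ^ 2 - ‖x - y‖ ^ 2) (-(2 : ℝ) • innerSL ℝ (x - y)) x := by
  have := (((hasFDerivAt_id x).sub_const y).norm_sq).const_sub (d ^ 2)
  refine this.congr_fderiv ?_
  ext k
  simp

section Identity

variable [FiniteDimensional ℝ E]

theorem mcOp_id_le (p : E) : mcOp p (ContinuousLinearMap.id ℝ E) ≤ finrank ℝ E := by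
  have h1 : LinearMap.trace ℝ E (ContinuousLinearMap.id ℝ E).toLinearMap = finrank ℝ E :=
    LinearMap.trace_id ℝ E
  have h2 : (areaFactor p)⁻¹ ≤ 1 := inv_le_one_of_one_le₀ (one_le_areaFactor p)
  have h0 : 0 ≤ (areaFactor p)⁻¹ := (inv_pos.2 (areaFactor_pos p)).le
  have h3 : 0 ≤ ⟪p, p⟫ / (1 + ‖p‖ ^ 2) := div_nonneg real_inner_self_nonneg (by positivity)
  rw [mcOp, h1]
  simp only [ContinuousLinearMap.id_apply]
  have hn : (0 : ℝ) ≤ finrank ℝ E := Nat.cast_nonneg _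
  nlinarith [mul_nonneg h0 h3]

theorem le_mcOp_rankOne {G : ℝ} {p : E} (hp : ‖p‖ ≤ G) (q : E) :
    (Real.sqrt (1 + G ^ 2) ^ 3)⁻¹ * ‖q‖ ^ 2 ≤ mcOp p ((innerSL ℝ q).smulRight q) := by
  have h1 : LinearMap.trace ℝ E ((innerSL ℝ q).smulRight q).toLinearMap = ‖q‖ ^ 2 := by
    rw [trace_eq_sum, ← real_inner_self_eq_norm_sq, ← (stdOrthonormalBasis ℝ E).sum_inner_mul_inner]
    refine Finset.sum_congr rfl fun i _ => ?_
    simp [inner_smul_right]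
  set s := areaFactor p with hs
  have hs0 : 0 < s := areaFactor_pos p
  have hs2 : s ^ 2 = 1 + ‖p‖ ^ 2 := areaFactor_sq p
  have hcs : ⟪q, p⟫ ^ 2 ≤ ‖q‖ ^ 2 * ‖p‖ ^ 2 := by
    rw [← mul_pow]
    exact sq_le_sq' (neg_le_of_abs_le (abs_real_inner_le_norm q p)) (real_inner_le_norm q p)
  have h2 : (s ^ 3)⁻¹ * ‖q‖ ^ 2 ≤ mcOp p ((innerSL ℝ q).smulRight q) := by
    rw [mcOp, h1, ← hs, ← hs2]
    simp only [ContinuousLinearMap.smulRight_apply, innerSL_apply_apply, real_inner_smul_left]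
    have : (s ^ 3)⁻¹ * ‖q‖ ^ 2 = s⁻¹ * (‖q‖ ^ 2 / s ^ 2) := by field_simp
    rw [this]
    gcongr
    rw [le_sub_iff_add_le, ← add_div, div_le_iff₀ (by positivity)]
    nlinarith
  refine le_trans ?_ h2
  have := areaFactor_le hp
  gcongr

theorem gradient_hopfBarrier (y : E) (d β ε : ℝ) (x : E) :
    ∇ (hopfBarrier y d β ε) x
      = (-(2 * ε) * (1 + 2 * β * (d ^ 2 - ‖x - y‖ ^ 2))) • (x - y) := by
  have h := hasFDerivAt_sub_norm_sq y d x
  have h1 := (h.add ((h.pow 2).const_mul β)).const_mul ε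
  have h2 : HasFDerivAt (hopfBarrier y d β ε) _ x := h1
  refine ext_inner_right ℝ fun k => ?_
  rw [inner_gradient_left, h2.fderiv]
  simp only [smul_apply, add_apply, innerSL_apply_apply, real_inner_smul_left, smul_eq_mul,
    nsmul_eq_mul, Nat.cast_ofNat, pow_one, Nat.add_one_sub_one]
  ring

theorem fderiv_gradient_hopfBarrier (y : E) (d β ε : ℝ) (x : E) :
    fderiv ℝ (∇ (hopfBarrier y d β ε)) x
      = ε • ((8 * β) • (innerSL ℝ (x - y)).smulRight (x - y)
        - (2 * (1 + 2 * β * (d ^ 2 - ‖x - y‖ ^ 2))) • ContinuousLinearMap.id ℝ E) := by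
  have h : ∇ (hopfBarrier y d β ε)
      = fun x => (-(2 * ε) * (1 + 2 * β * (d ^ 2 - ‖x - y‖ ^ 2))) • (x - y) :=
    funext (gradient_hopfBarrier y d β ε)
  have h0 : HasFDerivAt (fun x : E => x - y) (ContinuousLinearMap.id ℝ E) x :=
    (hasFDerivAt_id (𝕜 := ℝ) x).sub_const y
  have h1 := ((((hasFDerivAt_sub_norm_sq y d x).const_mul (2 * β)).const_add 1).const_mul
    (-(2 * ε))).smul h0
  rw [h]
  refine HasFDerivAt.fderiv (h1.congr_fderiv ?_)
  ext k
  simp only [smul_apply, add_apply, sub_apply, innerSL_apply_apply, smul_eq_mul,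
    ContinuousLinearMap.smulRight_apply, ContinuousLinearMap.id_apply]
  module

theorem norm_gradient_hopfBarrier_le {y : E} {d β ε : ℝ} {x : E} (hε : 0 ≤ ε) (hβ : 0 ≤ β)
    (hx : ‖x - y‖ ≤ d) (hx' : β * (d ^ 2 - ‖x - y‖ ^ 2) ≤ 1) :
    ‖∇ (hopfBarrier y d β ε) x‖ ≤ ε * (6 * d) := by
  have h0 : 0 ≤ d ^ 2 - ‖x - y‖ ^ 2 := by nlinarith [norm_nonneg (x - y)]
  have h1 := mul_nonneg hβ h0
  rw [gradient_hopfBarrier, norm_smul, Real.norm_eq_abs, abs_mul, abs_neg,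
    abs_of_nonneg (by positivity : 0 ≤ 2 * ε), abs_of_nonneg (by linarith)]
  calc _ ≤ 2 * ε * 3 * d := by gcongr; linarith
    _ = ε * (6 * d) := by ring

theorem le_mcOp_fderiv_gradient_hopfBarrier {y : E} {d β ε G : ℝ} {p x : E} (hε : 0 ≤ ε)
    (hβ : 0 ≤ β) (hp : ‖p‖ ≤ G) (hx : ‖x - y‖ ≤ d)
    (hx' : β * (d ^ 2 - ‖x - y‖ ^ 2) ≤ 1) :
    ε * (8 * β * ((Real.sqrt (1 + G ^ 2) ^ 3)⁻¹ * ‖x - y‖ ^ 2) - 6 * finrank ℝ E)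
      ≤ mcOp p (fderiv ℝ (∇ (hopfBarrier y d β ε)) x) := by
  have h0 : 0 ≤ d ^ 2 - ‖x - y‖ ^ 2 := by nlinarith [norm_nonneg (x - y)]
  have h1 := mul_nonneg hβ h0
  have h2 := le_mcOp_rankOne hp (x - y)
  have h3 := mcOp_id_le p
  rw [fderiv_gradient_hopfBarrier, mcOp_smul, mcOp_sub, mcOp_smul, mcOp_smul]
  have hn : (0 : ℝ) ≤ finrank ℝ E := Nat.cast_nonneg _
  gcongr ε * (8 * β * ?_ - ?_)
  calc _ ≤ 2 * (1 + 2 * β * (d ^ 2 - ‖x - y‖ ^ 2)) * finrank ℝ E := by gcongr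
    _ ≤ 6 * finrank ℝ E := by gcongr; linarith

/-- Comparison of the mean curvature operators where `v - u - h` has a local minimum. -/
theorem le_mcOp_sub_of_isLocalMin {u v h : E → ℝ} {x : E} {G B C : ℝ} (hu : ContDiffAt ℝ 2 u x)
    (hv : ContDiffAt ℝ 2 v x) (hh : ContDiffAt ℝ 2 h x)
    (hC : ∀ p q : E, ∀ H : E →L[ℝ] E, ‖p‖ ≤ G → ‖q‖ ≤ G → ‖H‖ ≤ B →
      |mcOp p H - mcOp q H| ≤ C * ‖p - q‖)
    (huG : ‖∇ u x‖ ≤ G) (hvG : ‖∇ v x‖ ≤ G) (huB : ‖fderiv ℝ (∇ u) x‖ ≤ B)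
    (hmin : IsLocalMin (fun y => v y - u y - h y) x) :
    mcOp (∇ v x) (fderiv ℝ (∇ h) x) - C * ‖∇ h x‖
      ≤ mcOp (∇ v x) (fderiv ℝ (∇ v) x) - mcOp (∇ u x) (fderiv ℝ (∇ u) x) := by
  have hvu : ContDiffAt ℝ 2 (fun y => v y - u y) x := hv.sub hu
  have hw : ContDiffAt ℝ 2 (fun y => v y - u y - h y) x := hvu.sub hh
  have hg := gradient_eq_zero_of_isLocalMin hmin
  rw [gradient_sub_of_contDiffAt hvu hh, gradient_sub_of_contDiffAt hv hu, sub_eq_zero] at hg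
  have h1 := mcOp_nonneg (∇ v x) (inner_fderiv_gradient_symm hw)
    (inner_fderiv_gradient_nonneg_of_isLocalMin hw hmin)
  rw [fderiv_gradient_sub hvu hh, fderiv_gradient_sub hv hu, mcOp_sub, mcOp_sub] at h1
  have h2 := hC _ _ _ hvG huG huB
  rw [hg] at h2
  linarith [(abs_le.1 h2).1]

/-- A multiple of the barrier lies below the difference of the two functions. -/
theorem exists_hopfBarrier_le {u v : E → ℝ} {y : E} {d K : ℝ} (hd : 0 < d) (hK : 0 ≤ K)
    (hu : ∀ x ∈ closedBall y d, ContDiffAt ℝ 2 u x)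
    (hv : ∀ x ∈ closedBall y d, ContDiffAt ℝ 2 v x)
    (hQ : ∀ x ∈ closedBall y d, mcOp (∇ v x) (fderiv ℝ (∇ v) x)
      - mcOp (∇ u x) (fderiv ℝ (∇ u) x) ≤ K * (v x - u x))
    (hle : ∀ x ∈ closedBall y d, u x ≤ v x) (hlt : ∀ x ∈ ball y d, u x < v x) :
    ∃ β > 0, ∃ ε > 0, ∀ x ∈ closedBall y d, β * (d ^ 2 - ‖x - y‖ ^ 2) ≤ 1 →
      hopfBarrier y d β ε x ≤ v x - u x := by
  have hcpt : IsCompact (closedBall y d) := isCompact_closedBall y d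
  obtain ⟨G₁, hG₁⟩ := hcpt.exists_bound_of_continuousOn (f := ∇ u) fun x hx =>
    (contDiffAt_gradient (hu x hx)).continuousAt.continuousWithinAt
  obtain ⟨G₂, hG₂⟩ := hcpt.exists_bound_of_continuousOn (f := ∇ v) fun x hx =>
    (contDiffAt_gradient (hv x hx)).continuousAt.continuousWithinAt
  obtain ⟨B, hB⟩ := hcpt.exists_bound_of_continuousOn (f := fderiv ℝ (∇ u)) fun x hx =>
    ((contDiffAt_gradient (hu x hx)).fderiv_right (m := 0)
      (by norm_num)).continuousAt.continuousWithinAt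
  set G := max G₁ G₂
  obtain ⟨C, hC0, hC⟩ := exists_mcOp_lipschitz (E := E) G B
  set s := Real.sqrt (1 + G ^ 2) ^ 3
  have hs : 0 < s := pow_pos (Real.sqrt_pos.2 (by positivity)) 3
  set N : ℝ := 6 * finrank ℝ E + C * (6 * d) + K * d ^ 2 + 1 with hN
  have hN0 : 0 < N := by positivity
  set β := 2 / d ^ 2 + s * N / (4 * d ^ 2) with hβ
  have hβ0 : 0 < β := by positivity
  have hβ2 : 2 ≤ β * d ^ 2 := by
    have : β * d ^ 2 = 2 + s * N / 4 := by rw [hβ]; field_simp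
    rw [this]
    have : 0 ≤ s * N / 4 := by positivity
    linarith
  have hβN : N ≤ 4 * β * (s⁻¹ * d ^ 2) := by
    have : 4 * β * (s⁻¹ * d ^ 2) = 8 / s + N := by rw [hβ]; field_simp; ring
    rw [this]
    have : 0 ≤ 8 / s := by positivity
    linarith
  have hρc : Continuous fun x : E => β * (d ^ 2 - ‖x - y‖ ^ 2) := by fun_prop
  have hwc : ContinuousOn (fun x => v x - u x) (closedBall y d) := fun x hx =>
    ((hv x hx).continuousAt.sub (hu x hx).continuousAt).continuousWithinAt
  obtain ⟨m, hm0, hm⟩ : ∃ m > 0, ∀ x ∈ closedBall y d, 1 ≤ β * (d ^ 2 - ‖x - y‖ ^ 2) →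
      m ≤ v x - u x := by
    have hc1 : IsCompact (closedBall y d ∩ {x | 1 ≤ β * (d ^ 2 - ‖x - y‖ ^ 2)}) :=
      hcpt.inter_right (isClosed_le continuous_const hρc)
    obtain ⟨x₁, hx₁, hmin⟩ := hc1.exists_isMinOn ⟨y, mem_closedBall_self hd.le, by
      simp only [mem_ofPred_eq, sub_self, norm_zero]; linarith⟩
      (hwc.mono inter_subset_left)
    refine ⟨v x₁ - u x₁, sub_pos.2 (hlt x₁ ?_), fun x hx h => hmin ⟨hx, h⟩⟩
    have h1 : 1 ≤ β * (d ^ 2 - ‖x₁ - y‖ ^ 2) := hx₁.2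
    rw [mem_ball, dist_eq_norm]
    have h2 : 0 < d ^ 2 - ‖x₁ - y‖ ^ 2 := by
      by_contra! h
      nlinarith
    exact lt_of_pow_lt_pow_left₀ 2 hd.le (by linarith)
  set ε := m / d ^ 2 with hε
  have hε0 : 0 < ε := by positivity
  have hεm : ε * d ^ 2 = m := by rw [hε]; field_simp
  set h := hopfBarrier y d β ε with hh
  have hc2 : ∀ x, ContDiffAt ℝ 2 h x := fun x => (contDiff_hopfBarrier y d β ε).contDiffAt
  refine ⟨β, hβ0, ε, hε0, ?_⟩
  have hcA : IsCompact (closedBall y d ∩ {x | β * (d ^ 2 - ‖x - y‖ ^ 2) ≤ 1}) :=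
    hcpt.inter_right (isClosed_le hρc continuous_const)
  have hcw : ContinuousOn (fun x => v x - u x - h x) (closedBall y d) := fun x hx =>
    (hwc x hx).sub (hc2 x).continuousAt.continuousWithinAt
  by_contra! hcon
  obtain ⟨x₂, hx₂, hβx₂, hneg⟩ := hcon
  obtain ⟨x, ⟨hx, hβx⟩, hmin⟩ := hcA.exists_isMinOn ⟨x₂, hx₂, hβx₂⟩
    (hcw.mono inter_subset_left)
  have hxneg : v x - u x < h x := by
    have : v x - u x - h x ≤ v x₂ - u x₂ - h x₂ := hmin ⟨hx₂, hβx₂⟩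
    linarith
  have hβx : β * (d ^ 2 - ‖x - y‖ ^ 2) ≤ 1 := hβx
  have hxd : ‖x - y‖ ≤ d := by rwa [mem_closedBall, dist_eq_norm] at hx
  set ρ := d ^ 2 - ‖x - y‖ ^ 2 with hρ
  have hhx : h x = ε * (ρ + β * ρ ^ 2) := rfl
  have hρ0 : 0 ≤ ρ := by rw [hρ]; nlinarith [norm_nonneg (x - y)]
  have hρd : 2 * ρ ≤ d ^ 2 := by nlinarith
  have hhd : h x ≤ ε * d ^ 2 := by
    rw [hhx]
    gcongr
    nlinarith
  have hβlt : β * ρ < 1 := by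
    refine lt_of_le_of_ne hβx fun he => ?_
    linarith [hm x hx he.ge]
  have hxlt : ‖x - y‖ < d := by
    refine lt_of_le_of_ne hxd fun he => ?_
    have : ρ = 0 := by rw [hρ, he, sub_self]
    rw [hhx, this] at hxneg
    linarith [hle x hx]
  have hloc : IsLocalMin (fun y => v y - u y - h y) x := by
    have h1 : ∀ᶠ x' in 𝓝 x, x' ∈ closedBall y d :=
      mem_of_superset (isOpen_ball.mem_nhds (by rwa [mem_ball, dist_eq_norm] :
        x ∈ ball y d)) ball_subset_closedBall
    have h2 : ∀ᶠ x' in 𝓝 x, β * (d ^ 2 - ‖x' - y‖ ^ 2) < 1 :=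
      hρc.continuousAt.eventually_lt continuousAt_const hβlt
    filter_upwards [h1, h2] with x' h1 h2
    exact hmin ⟨h1, h2.le⟩
  have h1 := le_mcOp_sub_of_isLocalMin (hu x hx) (hv x hx) (hc2 x) hC
    ((hG₁ x hx).trans (le_max_left _ _)) ((hG₂ x hx).trans (le_max_right _ _)) (hB x hx) hloc
  have h2 := norm_gradient_hopfBarrier_le hε0.le hβ0.le hxd hβx
  have h3 := le_mcOp_fderiv_gradient_hopfBarrier (G := G) hε0.le hβ0.le
    ((hG₂ x hx).trans (le_max_right _ _)) hxd hβx
  have h4 := hQ x hx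
  have h5 : K * (v x - u x) ≤ K * (ε * d ^ 2) := by gcongr; linarith
  have h6 : C * ‖∇ h x‖ ≤ C * (ε * (6 * d)) := by gcongr
  have h7 : d ^ 2 / 2 ≤ ‖x - y‖ ^ 2 := by linarith
  have h8 : ε * (8 * β * (s⁻¹ * (d ^ 2 / 2)) - 6 * finrank ℝ E)
      ≤ ε * (8 * β * (s⁻¹ * ‖x - y‖ ^ 2) - 6 * finrank ℝ E) := by gcongr
  have h9 : ε * N ≤ ε * (4 * β * (s⁻¹ * d ^ 2)) := by gcongr
  rw [hN] at h9
  linarith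

/-- The Hopf boundary point lemma for the difference of two functions. -/
theorem hopf_lemma {u v : E → ℝ} {y z : E} {d K : ℝ} (hd : 0 < d) (hK : 0 ≤ K)
    (hu : ∀ x ∈ closedBall y d, ContDiffAt ℝ 2 u x)
    (hv : ∀ x ∈ closedBall y d, ContDiffAt ℝ 2 v x)
    (hQ : ∀ x ∈ closedBall y d, mcOp (∇ v x) (fderiv ℝ (∇ v) x)
      - mcOp (∇ u x) (fderiv ℝ (∇ u) x) ≤ K * (v x - u x))
    (hle : ∀ x ∈ closedBall y d, u x ≤ v x) (hlt : ∀ x ∈ ball y d, u x < v x)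
    (hz : dist z y = d) (huz : u z = v z) :
    0 < ⟪∇ v z - ∇ u z, y - z⟫ := by
  obtain ⟨β, hβ0, ε, hε0, key⟩ := exists_hopfBarrier_le hd hK hu hv hQ hle hlt
  have hzn : ‖z - y‖ = d := by rwa [dist_eq_norm] at hz
  have hline : HasDerivAt (fun t : ℝ => z + t • (y - z)) (y - z) 0 := by
    simpa using ((hasDerivAt_id (0 : ℝ)).smul_const (y - z)).const_add z
  have hzc : z ∈ closedBall y d := hz.le
  have hz0 : z + (0 : ℝ) • (y - z) = z := by simp
  have hder : HasDerivAt (fun t : ℝ => v (z + t • (y - z)) - u (z + t • (y - z)))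
      ⟪∇ v z - ∇ u z, y - z⟫ 0 := by
    have hvz := ((hv z hzc).differentiableAt two_ne_zero).hasFDerivAt
    have huz := ((hu z hzc).differentiableAt two_ne_zero).hasFDerivAt
    have h1 := (hvz.sub huz)
    rw [← hz0] at h1
    have h2 := h1.comp_hasDerivAt (0 : ℝ) hline
    refine (h2.congr_deriv ?_)
    rw [hz0, inner_sub_left, inner_gradient_left, inner_gradient_left, sub_apply]
  have hρt : ∀ t : ℝ, d ^ 2 - ‖z + t • (y - z) - y‖ ^ 2 = d ^ 2 * (2 * t - t ^ 2) := fun t => by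
    have : z + t • (y - z) - y = (1 - t) • (z - y) := by module
    rw [this, norm_smul, mul_pow, hzn, Real.norm_eq_abs, sq_abs]
    ring
  have hge : ∀ᶠ t in 𝓝[>] (0 : ℝ), ε * d ^ 2
      ≤ slope (fun t : ℝ => v (z + t • (y - z)) - u (z + t • (y - z))) 0 t := by
    have hlim : ∀ᶠ t in 𝓝 (0 : ℝ), β * (d ^ 2 * (2 * t - t ^ 2)) < 1 :=
      ContinuousAt.eventually_lt (by fun_prop) continuousAt_const (by norm_num)
    filter_upwards [self_mem_nhdsWithin, nhdsWithin_le_nhds hlim,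
      nhdsWithin_le_nhds (Iio_mem_nhds one_pos)] with t ht hβt ht1
    have ht : 0 < t := ht
    have ht1 : t < 1 := ht1
    have h1 : d ^ 2 * t ≤ d ^ 2 * (2 * t - t ^ 2) := by gcongr; nlinarith
    have hmem : z + t • (y - z) ∈ closedBall y d := by
      rw [mem_closedBall, dist_eq_norm]
      have : 0 ≤ d ^ 2 * t := by positivity
      exact (pow_le_pow_iff_left₀ (norm_nonneg _) hd.le two_ne_zero).1 (by linarith [hρt t])
    have h2 := key _ hmem (by rw [hρt]; exact hβt.le)
    rw [hopfBarrier, hρt] at h2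
    rw [slope_def_field, hz0, huz, sub_self, sub_zero, sub_zero, le_div_iff₀ ht]
    refine le_trans ?_ h2
    rw [mul_assoc]
    gcongr
    have : 0 ≤ β * (d ^ 2 * (2 * t - t ^ 2)) ^ 2 := by positivity
    linarith
  have hlim := (hasDerivAt_iff_tendsto_slope.1 hder).mono_left
    (nhdsWithin_mono (0 : ℝ) (t := {0}ᶜ) (s := Ioi 0) fun t (ht : 0 < t) => ht.ne')
  exact lt_of_lt_of_le (by positivity) (ge_of_tendsto hlim hge)

end Identity

end Hopf

section StrongMaximum

variable {E : Type*} [NormedAddCommGroup E] [InnerProductSpace ℝ E] [FiniteDimensional ℝ E]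

/-- Strong maximum principle for the difference of two functions. -/
theorem lt_of_isPreconnected {U : Set E} {u v : E → ℝ} {K : ℝ} (hU : IsOpen U)
    (hconn : IsPreconnected U) (hK : 0 ≤ K)
    (hu : ∀ x ∈ U, ContDiffAt ℝ 2 u x) (hv : ∀ x ∈ U, ContDiffAt ℝ 2 v x)
    (hQ : ∀ x ∈ U, mcOp (∇ v x) (fderiv ℝ (∇ v) x)
      - mcOp (∇ u x) (fderiv ℝ (∇ u) x) ≤ K * (v x - u x))
    (hle : ∀ x ∈ U, u x ≤ v x) (hex : ∃ x ∈ U, u x < v x) : ∀ x ∈ U, u x < v x := by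
  have hcw : ContinuousOn (fun x => v x - u x) U := fun x hx =>
    ((hv x hx).continuousAt.sub (hu x hx).continuousAt).continuousWithinAt
  have hP : IsOpen (U ∩ {x | u x < v x}) := by
    have := hcw.isOpen_inter_preimage hU (isOpen_Ioi (a := (0 : ℝ)))
    convert this using 2
    ext x
    simp
  have hZ : IsOpen (U ∩ {x | u x = v x}) := by
    rw [Metric.isOpen_iff]
    rintro x ⟨hxU, hx⟩
    obtain ⟨r, hr, hrU⟩ := Metric.isOpen_iff.1 hU x hxU
    refine ⟨r / 4, by positivity, fun y hy => ?_⟩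
    have hyx : dist y x < r / 4 := hy
    have hyU : y ∈ U := hrU (by rw [mem_ball]; linarith)
    refine ⟨hyU, ?_⟩
    by_contra hne
    have hylt : u y < v y := lt_of_le_of_ne (hle y hyU) hne
    have hsub : closedBall y (r / 2) ⊆ U := fun z hz => hrU (by
      rw [mem_ball]
      have := dist_triangle z y x
      rw [mem_closedBall] at hz
      linarith)
    have hcpt : IsCompact (closedBall y (r / 2) ∩ (fun x => v x - u x) ⁻¹' {0}) := by
      refine (isCompact_closedBall y (r / 2)).of_isClosed_subset ?_ inter_subset_left
      exact (hcw.mono hsub).preimage_isClosed_of_isClosed isClosed_closedBall isClosed_singleton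
    obtain ⟨z, ⟨hzy, hz0⟩, hzmin⟩ := hcpt.exists_isMinOn (f := fun z => dist z y)
      ⟨x, by rw [mem_closedBall, dist_comm]; linarith, by
        simp only [mem_preimage, mem_singleton_iff, sub_eq_zero]; exact hx.symm⟩
      (by fun_prop)
    have huz : u z = v z := (sub_eq_zero.1 hz0).symm
    have hd : 0 < dist z y := dist_pos.2 fun h => by
      rw [h] at huz
      exact hylt.ne huz
    have hzr : dist z y ≤ r / 2 := hzy
    have hsub' : closedBall y (dist z y) ⊆ U := (closedBall_subset_closedBall hzr).trans hsub
    have hzU : z ∈ U := hsub hzy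
    have hpos := hopf_lemma hd hK (fun x hx => hu x (hsub' hx)) (fun x hx => hv x (hsub' hx))
      (fun x hx => hQ x (hsub' hx)) (fun x hx => hle x (hsub' hx))
      (fun x hx => lt_of_le_of_ne (hle x (hsub' (ball_subset_closedBall hx))) fun h => by
        have h1 : dist z y ≤ dist x y := hzmin
          ⟨closedBall_subset_closedBall hzr (ball_subset_closedBall hx), sub_eq_zero.2 h.symm⟩
        exact absurd (mem_ball.1 hx) (not_lt.2 h1)) rfl huz
    have hloc : IsLocalMin (fun x => v x - u x) z := by
      filter_upwards [hU.mem_nhds hzU] with x hx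
      rw [huz, sub_self]
      exact sub_nonneg.2 (hle x hx)
    have hg := gradient_eq_zero_of_isLocalMin hloc
    rw [gradient_sub_of_contDiffAt (hv z hzU) (hu z hzU)] at hg
    rw [hg, inner_zero_left] at hpos
    exact lt_irrefl _ hpos
  have hcover : U ⊆ (U ∩ {x | u x < v x}) ∪ (U ∩ {x | u x = v x}) := fun x hx =>
    (lt_or_eq_of_le (hle x hx)).imp (fun h => ⟨hx, h⟩) fun h => ⟨hx, h⟩
  have hdisj : Disjoint (U ∩ {x | u x < v x}) (U ∩ {x | u x = v x}) :=
    Set.disjoint_left.2 fun x hx hx' => hx.2.ne hx'.2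
  obtain ⟨x₁, hx₁, hlt⟩ := hex
  exact fun x hx => (hconn.subset_left_of_subset_union hP hZ hdisj hcover
    ⟨x₁, hx₁, hx₁, hlt⟩ hx).2

end StrongMaximum

section Reflection

variable {E : Type*} [NormedAddCommGroup E] [InnerProductSpace ℝ E]

/-- Reflection in the hyperplane `{x | ⟪x - x₀, e⟫ = t}`, for a unit vector `e`. -/
def planeReflection (x₀ e : E) (t : ℝ) (x : E) : E := x + (2 * (t - ⟪x - x₀, e⟫)) • e

variable {x₀ e : E} {t : ℝ}

theorem continuous_planeReflection :
    Continuous fun z : ℝ × E => planeReflection x₀ e z.1 z.2 := by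
  unfold planeReflection
  fun_prop

theorem inner_planeReflection (he : ‖e‖ = 1) (x : E) :
    ⟪planeReflection x₀ e t x - x₀, e⟫ = 2 * t - ⟪x - x₀, e⟫ := by
  rw [planeReflection, add_sub_right_comm, inner_add_left, real_inner_smul_left,
    real_inner_self_eq_norm_sq, he]
  ring

theorem planeReflection_eq_self {x : E} (hx : ⟪x - x₀, e⟫ = t) : planeReflection x₀ e t x = x := by
  simp [planeReflection, hx]

theorem norm_planeReflection_sub_sq (he : ‖e‖ = 1) (x : E) :
    ‖planeReflection x₀ e t x - x₀‖ ^ 2 = ‖x - x₀‖ ^ 2 - 4 * t * (⟪x - x₀, e⟫ - t) := by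
  rw [planeReflection, add_sub_right_comm, norm_add_sq_real, real_inner_smul_right, norm_smul, he,
    Real.norm_eq_abs, mul_one, sq_abs]
  ring

theorem norm_planeReflection_sub_le (he : ‖e‖ = 1) (ht : 0 ≤ t) {x : E} (hx : t ≤ ⟪x - x₀, e⟫) :
    ‖planeReflection x₀ e t x - x₀‖ ≤ ‖x - x₀‖ := by
  refine (pow_le_pow_iff_left₀ (norm_nonneg _) (norm_nonneg _) two_ne_zero).1 ?_
  rw [norm_planeReflection_sub_sq he]
  nlinarith [mul_nonneg ht (sub_nonneg.2 hx)]

theorem norm_planeReflection_sub_lt (he : ‖e‖ = 1) (ht : 0 < t) {x : E} (hx : t < ⟪x - x₀, e⟫) :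
    ‖planeReflection x₀ e t x - x₀‖ < ‖x - x₀‖ := by
  refine (pow_lt_pow_iff_left₀ (norm_nonneg _) (norm_nonneg _) two_ne_zero).1 ?_
  rw [norm_planeReflection_sub_sq he]
  nlinarith [mul_pos ht (sub_pos.2 hx)]

/-- The linear part of `planeReflection`. -/
def linearReflection (e : E) : E ≃ₗᵢ[ℝ] E := (ℝ ∙ e)ᗮ.reflection

theorem linearReflection_apply (he : ‖e‖ = 1) (x : E) :
    linearReflection e x = x - (2 * ⟪x, e⟫) • e := by
  rw [linearReflection, Submodule.reflection_orthogonal_apply,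
    Submodule.reflection_singleton_apply, he, real_inner_comm]
  simp only [one_pow, RCLike.ofReal_real_eq_id, id_eq, div_one]
  module

theorem linearReflection_symm : (linearReflection e).symm = linearReflection e :=
  Submodule.reflection_symm

theorem inner_linearReflection_left (x y : E) :
    ⟪linearReflection e x, y⟫ = ⟪x, linearReflection e y⟫ := by
  conv_lhs => rw [← (linearReflection e).inner_map_map]
  rw [linearReflection, Submodule.reflection_reflection]

theorem linearReflection_self (he : ‖e‖ = 1) : linearReflection e e = -e := by
  rw [linearReflection_apply he, real_inner_self_eq_norm_sq, he]
  module

theorem hasFDerivAt_planeReflection (he : ‖e‖ = 1) (x : E) :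
    HasFDerivAt (planeReflection x₀ e t) (linearReflection e : E →L[ℝ] E) x := by
  have h : planeReflection x₀ e t
      = fun x => linearReflection e x + (2 * (t + ⟪x₀, e⟫)) • e := by
    ext x
    rw [planeReflection, linearReflection_apply he, inner_sub_left]
    module
  rw [h]
  exact (linearReflection e : E →L[ℝ] E).hasFDerivAt.add_const _

theorem contDiff_planeReflection {k : WithTop ℕ∞} : ContDiff ℝ k (planeReflection x₀ e t) := by
  unfold planeReflection
  exact contDiff_id.add ((contDiff_const.mul (contDiff_const.sub
    ((contDiff_id.sub contDiff_const).inner ℝ contDiff_const))).smul contDiff_const)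

variable [FiniteDimensional ℝ E] {u : E → ℝ} {x : E}

theorem gradient_comp_planeReflection (he : ‖e‖ = 1)
    (hu : DifferentiableAt ℝ u (planeReflection x₀ e t x)) :
    ∇ (fun y => u (planeReflection x₀ e t y)) x
      = linearReflection e (∇ u (planeReflection x₀ e t x)) := by
  refine ext_inner_right ℝ fun k => ?_
  have h := hu.hasFDerivAt.comp x (hasFDerivAt_planeReflection he x)
  rw [inner_gradient_left, inner_linearReflection_left, inner_gradient_left]
  exact congrArg (fun L : E →L[ℝ] ℝ => L k) h.fderiv

theorem fderiv_gradient_comp_planeReflection (he : ‖e‖ = 1)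
    (hu : ContDiffAt ℝ 2 u (planeReflection x₀ e t x)) :
    fderiv ℝ (∇ (fun y => u (planeReflection x₀ e t y))) x
      = (linearReflection e : E →L[ℝ] E) ∘L fderiv ℝ (∇ u) (planeReflection x₀ e t x) ∘L
        ((linearReflection e).symm : E →L[ℝ] E) := by
  have h : ∇ (fun y => u (planeReflection x₀ e t y))
      =ᶠ[𝓝 x] fun y => linearReflection e (∇ u (planeReflection x₀ e t y)) := by
    have hc : ContinuousAt (planeReflection x₀ e t) x :=
      (hasFDerivAt_planeReflection he x).continuousAt
    filter_upwards [hc.eventually (hu.eventually (by simp))] with y hy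
    exact gradient_comp_planeReflection he (hy.differentiableAt two_ne_zero)
  rw [h.fderiv_eq, linearReflection_symm]
  exact ((linearReflection e : E →L[ℝ] E).hasFDerivAt.comp x
    ((differentiableAt_gradient hu).hasFDerivAt.comp x
      (hasFDerivAt_planeReflection he x))).fderiv

/-- The mean curvature operator is invariant under reflections. -/
theorem mcOp_comp_planeReflection (he : ‖e‖ = 1)
    (hu : ContDiffAt ℝ 2 u (planeReflection x₀ e t x)) :
    mcOp (∇ (fun y => u (planeReflection x₀ e t y)) x)
        (fderiv ℝ (∇ (fun y => u (planeReflection x₀ e t y))) x)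
      = mcOp (∇ u (planeReflection x₀ e t x))
        (fderiv ℝ (∇ u) (planeReflection x₀ e t x)) := by
  rw [gradient_comp_planeReflection he (hu.differentiableAt two_ne_zero),
    fderiv_gradient_comp_planeReflection he hu, mcOp_conj]

end Reflection

section MovingPlanes

variable {E : Type*} [NormedAddCommGroup E] [InnerProductSpace ℝ E]

/-- The cap cut off from `ball x₀ R` by the hyperplane `{x | ⟪x - x₀, e⟫ = t}`. -/
def ballCap (x₀ : E) (R : ℝ) (e : E) (t : ℝ) : Set E := {x | x ∈ ball x₀ R ∧ t < ⟪x - x₀, e⟫}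

variable {x₀ e : E} {R t : ℝ}

theorem isOpen_ballCap : IsOpen (ballCap x₀ R e t) :=
  isOpen_ball.inter (isOpen_lt continuous_const
    (by fun_prop : Continuous fun x : E => ⟪x - x₀, e⟫))

theorem isPreconnected_ballCap : IsPreconnected (ballCap x₀ R e t) := by
  have h : Convex ℝ {x : E | t < ⟪x - x₀, e⟫} := by
    have h1 := (convex_Ioi (𝕜 := ℝ) (t + ⟪x₀, e⟫)).linear_preimage (innerSL ℝ e).toLinearMap
    convert h1 using 1
    ext x
    simp [inner_sub_left, real_inner_comm, lt_sub_iff_add_lt]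
  exact ((convex_ball x₀ R).inter h).isPreconnected

theorem ballCap_eq_empty (he : ‖e‖ = 1) (ht : R ≤ t) : ballCap x₀ R e t = ∅ := by
  refine eq_empty_of_forall_notMem fun x hx => ?_
  have h1 := real_inner_le_norm (x - x₀) e
  have h2 : ‖x - x₀‖ < R := mem_ball_iff_norm.1 hx.1
  rw [he, mul_one] at h1
  linarith [hx.2]

theorem planeReflection_mem_ball (he : ‖e‖ = 1) (ht : 0 ≤ t) {x : E} (hx : x ∈ ball x₀ R)
    (hxt : t ≤ ⟪x - x₀, e⟫) : planeReflection x₀ e t x ∈ ball x₀ R := by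
  rw [mem_ball_iff_norm] at hx ⊢
  exact (norm_planeReflection_sub_le he ht hxt).trans_lt hx

variable [FiniteDimensional ℝ E]

/-- A positive solution in `ball x₀ R` of the mean curvature equation with a Lipschitz right-hand
side and gradient bounded by `G`, extended by zero to a continuous function on the whole space. -/
structure BallSolution (x₀ : E) (R : ℝ) (u : E → ℝ) (G K : ℝ) : Prop where
  continuous : Continuous u
  eq_zero : ∀ x ∉ ball x₀ R, u x = 0
  pos : ∀ x ∈ ball x₀ R, 0 < u x
  contDiffAt : ∀ x ∈ ball x₀ R, ContDiffAt ℝ 2 u x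
  norm_gradient_le : ∀ x ∈ ball x₀ R, ‖∇ u x‖ ≤ G
  abs_mcOp_sub_le : ∀ x ∈ ball x₀ R, ∀ y ∈ ball x₀ R,
    |mcOp (∇ u x) (fderiv ℝ (∇ u) x) - mcOp (∇ u y) (fderiv ℝ (∇ u) y)| ≤ K * |u x - u y|

namespace BallSolution

variable {u : E → ℝ} {G K : ℝ}

theorem nonneg (h : BallSolution x₀ R u G K) (x : E) : 0 ≤ u x := by
  by_cases hx : x ∈ ball x₀ R
  · exact (h.pos x hx).le
  · exact (h.eq_zero x hx).ge

theorem continuous_comp (h : BallSolution x₀ R u G K) (t : ℝ) :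
    Continuous fun x => u (planeReflection x₀ e t x) :=
  h.continuous.comp (contDiff_planeReflection (k := 0)).continuous

theorem contDiffAt_comp (h : BallSolution x₀ R u G K) {x : E}
    (hx : planeReflection x₀ e t x ∈ ball x₀ R) :
    ContDiffAt ℝ 2 (fun y => u (planeReflection x₀ e t y)) x :=
  (h.contDiffAt _ hx).comp x contDiff_planeReflection.contDiffAt

theorem abs_mcOp_comp_sub_le (h : BallSolution x₀ R u G K) (he : ‖e‖ = 1) (ht : 0 ≤ t) {x : E}
    (hx : x ∈ ball x₀ R) (hxt : t ≤ ⟪x - x₀, e⟫) :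
    mcOp (∇ (fun y => u (planeReflection x₀ e t y)) x)
        (fderiv ℝ (∇ (fun y => u (planeReflection x₀ e t y))) x)
      - mcOp (∇ u x) (fderiv ℝ (∇ u) x) ≤ K * |u (planeReflection x₀ e t x) - u x| := by
  have hσ := planeReflection_mem_ball he ht hx hxt
  rw [mcOp_comp_planeReflection he (h.contDiffAt _ hσ)]
  exact (le_abs_self _).trans (h.abs_mcOp_sub_le _ hσ x hx)

theorem comparisonPair (h : BallSolution x₀ R u G K) (he : ‖e‖ = 1) (ht : 0 ≤ t) :
    ComparisonPair (ballCap x₀ R e t) u (fun y => u (planeReflection x₀ e t y)) G K where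
  isOpen := isOpen_ballCap
  contDiffAt_left x hx := h.contDiffAt x hx.1
  contDiffAt_right x hx := h.contDiffAt_comp (planeReflection_mem_ball he ht hx.1 hx.2.le)
  norm_gradient_left x hx := h.norm_gradient_le x hx.1
  norm_gradient_right x hx := by
    have hσ := planeReflection_mem_ball he ht hx.1 hx.2.le
    rw [gradient_comp_planeReflection he ((h.contDiffAt _ hσ).differentiableAt two_ne_zero),
      LinearIsometryEquiv.norm_map]
    exact h.norm_gradient_le _ hσ
  mcOp_sub_le x hx hlt := by
    have := h.abs_mcOp_comp_sub_le he ht hx.1 hx.2.le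
    rwa [abs_sub_comm, abs_of_pos (sub_pos.2 hlt)] at this
  isCompact ε hε := by
    have hc : IsCompact (closedBall x₀ R ∩ ({x | t ≤ ⟪x - x₀, e⟫}
        ∩ {x | ε ≤ u x - u (planeReflection x₀ e t x)})) :=
      (isCompact_closedBall x₀ R).inter_right
        ((isClosed_le continuous_const (by fun_prop)).inter
          (isClosed_le continuous_const (h.continuous.sub (h.continuous_comp t))))
    convert hc using 1
    ext x
    constructor
    · rintro ⟨⟨h1, h2⟩, h3⟩
      exact ⟨ball_subset_closedBall h1, h2.le, h3⟩
    · rintro ⟨-, h2, h3⟩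
      have h2 : t ≤ ⟪x - x₀, e⟫ := h2
      have h3 : ε ≤ u x - u (planeReflection x₀ e t x) := h3
      refine ⟨⟨?_, lt_of_le_of_ne h2 fun heq => ?_⟩, h3⟩
      · by_contra hx
        linarith [h.eq_zero x hx, h.nonneg (planeReflection x₀ e t x)]
      · rw [planeReflection_eq_self heq.symm] at h3
        linarith

theorem lt_comp_planeReflection (h : BallSolution x₀ R u G K) (hK : 0 ≤ K) (he : ‖e‖ = 1)
    (ht : 0 < t) (htR : t < R)
    (hle : ∀ x ∈ ballCap x₀ R e t, u x ≤ u (planeReflection x₀ e t x)) :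
    ∀ x ∈ ballCap x₀ R e t, u x < u (planeReflection x₀ e t x) := by
  have hp := h.comparisonPair he ht.le
  refine lt_of_isPreconnected isOpen_ballCap isPreconnected_ballCap hK hp.contDiffAt_left
    hp.contDiffAt_right (fun x hx => ?_) hle ?_
  · have := h.abs_mcOp_comp_sub_le he ht.le hx.1 hx.2.le
    rwa [abs_of_nonneg (sub_nonneg.2 (hle x hx))] at this
  · have hin : ∀ s : ℝ, ⟪x₀ + s • e - x₀, e⟫ = s := fun s => by
      rw [add_sub_cancel_left, real_inner_smul_left, real_inner_self_eq_norm_sq, he]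
      ring
    have hno : ∀ s : ℝ, ‖x₀ + s • e - x₀‖ = |s| := fun s => by
      rw [add_sub_cancel_left, norm_smul, he, mul_one, Real.norm_eq_abs]
    have hR : 0 < R := ht.trans htR
    have hlt : u (x₀ + R • e) < u (planeReflection x₀ e t (x₀ + R • e)) := by
      rw [h.eq_zero]
      · refine h.pos _ (mem_ball_iff_norm.2 ?_)
        refine (norm_planeReflection_sub_lt he ht (by rwa [hin])).trans_eq ?_
        rw [hno, abs_of_pos hR]
      · rw [mem_ball_iff_norm, hno, abs_of_pos hR]
        exact lt_irrefl R
    have hline : Continuous fun s : ℝ => x₀ + s • e := by fun_prop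
    have hev : ∀ᶠ s in 𝓝[<] R, u (x₀ + s • e) < u (planeReflection x₀ e t (x₀ + s • e)) :=
      nhdsWithin_le_nhds (((h.continuous.comp hline).continuousAt).eventually_lt
        (((h.continuous_comp t).comp hline).continuousAt) hlt)
    obtain ⟨s, hs, hst, hsR⟩ := (hev.and (Ioo_mem_nhdsLT htR)).exists
    refine ⟨x₀ + s • e, ⟨?_, by rwa [hin]⟩, hs⟩
    rwa [mem_ball_iff_norm, hno, abs_of_pos (ht.trans hst)]

variable [MeasurableSpace E] [BorelSpace E]

theorem ae_inner_sub_ne (he : ‖e‖ = 1) (x₀ : E) (t : ℝ) : ∀ᵐ x : E, ⟪x - x₀, e⟫ ≠ t := by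
  set s : AffineSubspace ℝ E := AffineSubspace.mk' (x₀ + t • e) (ℝ ∙ e)ᗮ with hs
  have hmem : ∀ x, x ∈ s ↔ ⟪x - x₀, e⟫ = t := fun x => by
    rw [hs, AffineSubspace.mem_mk', Submodule.mem_orthogonal_singleton_iff_inner_left, vsub_eq_sub,
      ← sub_sub, inner_sub_left, real_inner_smul_left, real_inner_self_eq_norm_sq, he, sub_eq_zero]
    simp
  have htop : s ≠ ⊤ := fun htop => by
    have h1 : x₀ + (t + 1) • e ∈ s := htop ▸ AffineSubspace.mem_top ℝ E _
    rw [hmem, add_sub_cancel_left, real_inner_smul_left, real_inner_self_eq_norm_sq, he] at h1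
    linarith
  refine measure_mono_null (fun x hx => ?_) (Measure.addHaar_affineSubspace volume s htop)
  exact (hmem x).2 (not_not.1 hx)

/-- The moving plane can be pushed slightly beyond a position of strict inequality. -/
theorem eventually_le_comp_planeReflection (h : BallSolution x₀ R u G K) (hK : 0 ≤ K)
    (hn : 2 ≤ finrank ℝ E) (he : ‖e‖ = 1) (ht : 0 < t)
    (hlt : ∀ x ∈ ballCap x₀ R e t, u x < u (planeReflection x₀ e t x)) :
    ∀ᶠ τ in 𝓝 t, ∀ x ∈ ballCap x₀ R e τ, u x ≤ u (planeReflection x₀ e τ x) := by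
  obtain ⟨δ, hδ, hsmall⟩ := ComparisonPair.exists_small_measure_le hn G hK
  have hcont : ∀ x, Continuous fun τ => u (planeReflection x₀ e τ x) := fun x =>
    h.continuous.comp (continuous_planeReflection.comp (by fun_prop : Continuous fun τ => (τ, x)))
  have hlim : Tendsto (fun τ => volume {x | x ∈ ballCap x₀ R e τ ∧
      u (planeReflection x₀ e τ x) < u x}) (𝓝 t) (𝓝 (volume (∅ : Set E))) := by
    refine tendsto_measure_of_ae_tendsto_indicator (𝓝 t) MeasurableSet.empty (fun τ => ?_)
      (measurableSet_ball (x := x₀) (ε := R)) measure_ball_lt_top.ne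
      (Eventually.of_forall fun τ x hx => hx.1.1) ?_
    · exact (isOpen_ballCap.inter
        (isOpen_lt (h.continuous_comp τ) h.continuous)).measurableSet
    · filter_upwards [ae_inner_sub_ne he x₀ t] with x hx
      rcases lt_or_gt_of_ne hx with hx | hx
      · filter_upwards [Ioi_mem_nhds hx] with τ hτ
        exact iff_of_false (fun hx' => lt_asymm hτ hx'.1.2) (notMem_empty x)
      · by_cases hxR : x ∈ ball x₀ R
        · filter_upwards [continuousAt_const.eventually_lt (hcont x).continuousAt
            (hlt x ⟨hxR, hx⟩)] with τ hτ
          exact iff_of_false (fun hx' => lt_asymm hτ hx'.2) (notMem_empty x)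
        · exact Eventually.of_forall fun τ =>
            iff_of_false (fun hx' => hxR hx'.1.1) (notMem_empty x)
  rw [measure_empty] at hlim
  filter_upwards [hlim.eventually (Iic_mem_nhds (ENNReal.ofReal_pos.2 hδ)), Ioi_mem_nhds ht]
    with τ hτ hτ0
  exact hsmall _ _ _ (h.comparisonPair he (le_of_lt hτ0)) hτ

/-- The method of moving planes. -/
theorem le_comp_planeReflection (h : BallSolution x₀ R u G K) (hK : 0 ≤ K)
    (hn : 2 ≤ finrank ℝ E) (he : ‖e‖ = 1) (ht : t ∈ Ioo 0 R) :
    ∀ x ∈ ballCap x₀ R e t, u x ≤ u (planeReflection x₀ e t x) := by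
  set A : Set ℝ := {t | t ∈ Ioo 0 R ∧
    ∀ x ∈ ballCap x₀ R e t, u x ≤ u (planeReflection x₀ e t x)} with hA
  have hopen : IsOpen A := by
    rw [isOpen_iff_mem_nhds]
    rintro t ⟨ht, hle⟩
    filter_upwards [Ioo_mem_nhds ht.1 ht.2, h.eventually_le_comp_planeReflection hK hn he ht.1
      (h.lt_comp_planeReflection hK he ht.1 ht.2 hle)] with τ h1 h2
    exact ⟨h1, h2⟩
  have hR : 0 < R := ht.1.trans ht.2
  have hne : (Ioo 0 R ∩ A).Nonempty := by
    have hev := h.eventually_le_comp_planeReflection hK hn he hR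
      (fun x hx => absurd hx (by simp [ballCap_eq_empty he le_rfl]))
    obtain ⟨τ, h1, h2⟩ := ((hev.filter_mono nhdsWithin_le_nhds).and (Ioo_mem_nhdsLT hR)).exists
    exact ⟨τ, h2, h2, h1⟩
  have hclosed : closure A ∩ Ioo 0 R ⊆ A := by
    rintro t ⟨htA, ht⟩
    refine ⟨ht, fun x hx => ?_⟩
    by_contra! hlt
    have hcont : Continuous fun τ => u (planeReflection x₀ e τ x) :=
      h.continuous.comp (continuous_planeReflection.comp (by fun_prop : Continuous fun τ => (τ, x)))
    have h1 := hcont.continuousAt.eventually_lt continuousAt_const hlt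
    obtain ⟨τ, hτA, h1, h2⟩ :=
      ((mem_closure_iff_frequently.1 htA).and_eventually (h1.and (Iio_mem_nhds hx.2))).exists
    exact absurd (hτA.2 x ⟨hx.1, h2⟩) (not_le.2 h1)
  exact (isPreconnected_Ioo.subset_of_closure_inter_subset hopen hne hclosed ht).2

theorem le_comp_planeReflection_zero (h : BallSolution x₀ R u G K) (hK : 0 ≤ K)
    (hn : 2 ≤ finrank ℝ E) (he : ‖e‖ = 1) {x : E} (hx : x ∈ ballCap x₀ R e 0) :
    u x ≤ u (planeReflection x₀ e 0 x) := by
  have hcont : Continuous fun τ => u (planeReflection x₀ e τ x) :=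
    h.continuous.comp (continuous_planeReflection.comp (by fun_prop : Continuous fun τ => (τ, x)))
  have hR : 0 < R := pos_of_mem_ball hx.1
  refine ge_of_tendsto ((hcont.tendsto 0).mono_left (nhdsWithin_le_nhds (s := Ioi 0))) ?_
  filter_upwards [Ioo_mem_nhdsGT hR, Ioo_mem_nhdsGT hx.2] with τ h1 h2
  exact h.le_comp_planeReflection hK hn he h1 x ⟨hx.1, h2.2⟩

theorem eq_comp_planeReflection_zero (h : BallSolution x₀ R u G K) (hK : 0 ≤ K)
    (hn : 2 ≤ finrank ℝ E) (he : ‖e‖ = 1) {x : E} (hx : x ∈ ballCap x₀ R e 0) :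
    u x = u (planeReflection x₀ e 0 x) := by
  refine le_antisymm (h.le_comp_planeReflection_zero hK hn he hx) ?_
  have he' : ‖-e‖ = 1 := by rwa [norm_neg]
  have hmem : planeReflection x₀ e 0 x ∈ ballCap x₀ R (-e) 0 := by
    refine ⟨planeReflection_mem_ball he le_rfl hx.1 hx.2.le, ?_⟩
    rw [inner_neg_right, inner_planeReflection he]
    linarith [hx.2]
  have h1 := h.le_comp_planeReflection_zero hK hn he' hmem
  have h2 : planeReflection x₀ (-e) 0 (planeReflection x₀ e 0 x) = x := by
    rw [planeReflection, inner_neg_right, inner_planeReflection he, planeReflection]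
    module
  rwa [h2] at h1

/-- Radial symmetry. -/
theorem eq_of_norm_sub_eq (h : BallSolution x₀ R u G K) (hK : 0 ≤ K) (hn : 2 ≤ finrank ℝ E)
    {x y : E} (hxy : ‖x - x₀‖ = ‖y - x₀‖) : u x = u y := by
  by_cases hx : x ∈ ball x₀ R
  · rcases eq_or_ne x y with rfl | hne
    · rfl
    have hpos : 0 < ‖x - y‖ := norm_pos_iff.2 (sub_ne_zero.2 hne)
    set e : E := ‖x - y‖⁻¹ • (x - y) with hedef
    have he : ‖e‖ = 1 := by
      rw [hedef, norm_smul, norm_inv, norm_norm, inv_mul_cancel₀ hpos.ne']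
    have hin : ⟪x - x₀, x - y⟫ = ‖x - y‖ ^ 2 / 2 := by
      have h1 := norm_sub_sq_real (x - x₀) (y - x₀)
      have h2 : x - y = (x - x₀) - (y - x₀) := by abel
      rw [← hxy, ← h2] at h1
      rw [h1]
      conv_lhs => rw [h2, inner_sub_right, real_inner_self_eq_norm_sq]
      ring
    have hine : ⟪x - x₀, e⟫ = ‖x - y‖ / 2 := by
      rw [hedef, real_inner_smul_right, hin]
      field_simp
    have h1 := h.eq_comp_planeReflection_zero hK hn he (x := x) ⟨hx, by rw [hine]; positivity⟩
    have h2 : planeReflection x₀ e 0 x = y := by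
      rw [planeReflection, hine, hedef, smul_smul]
      have : 2 * (0 - ‖x - y‖ / 2) * ‖x - y‖⁻¹ = -1 := by field_simp; ring
      rw [this]
      module
    rwa [h2] at h1
  · have hy : y ∉ ball x₀ R := by rwa [mem_ball_iff_norm, ← hxy, ← mem_ball_iff_norm]
    rw [h.eq_zero x hx, h.eq_zero y hy]

/-- Strict radial monotonicity. -/
theorem inner_gradient_neg (h : BallSolution x₀ R u G K) (hK : 0 ≤ K) (hn : 2 ≤ finrank ℝ E)
    (he : ‖e‖ = 1) (ht : t ∈ Ioo 0 R) : ⟪∇ u (x₀ + t • e), e⟫ < 0 := by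
  set z := x₀ + t • e with hz
  set d := (R - t) / 4 with hd
  have hd0 : 0 < d := by linarith [ht.2]
  set y := z + d • e with hy
  have hee : ⟪e, e⟫ = (1 : ℝ) := by rw [real_inner_self_eq_norm_sq, he, one_pow]
  have hyx : y - x₀ = (t + d) • e := by rw [hy, hz]; module
  have hin : ∀ x, ⟪x - x₀, e⟫ = ⟪x - y, e⟫ + (t + d) := fun x => by
    rw [← sub_add_sub_cancel x y x₀, inner_add_left, hyx, real_inner_smul_left, hee, mul_one]
  have hle : ∀ x, |⟪x - y, e⟫| ≤ ‖x - y‖ := fun x => by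
    simpa [he] using abs_real_inner_le_norm (x - y) e
  have hball : ∀ x ∈ closedBall y d, x ∈ ball x₀ R := fun x hx => by
    rw [mem_closedBall_iff_norm] at hx
    rw [mem_ball_iff_norm, ← sub_add_sub_cancel x y x₀, hyx]
    refine (norm_add_le _ _).trans_lt ?_
    rw [norm_smul, he, mul_one, Real.norm_eq_abs, abs_of_pos (by linarith [ht.1])]
    linarith
  have hge : ∀ x ∈ closedBall y d, t ≤ ⟪x - x₀, e⟫ := fun x hx => by
    rw [mem_closedBall_iff_norm] at hx
    rw [hin]
    linarith [(abs_le.1 (hle x)).1]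
  have hgt : ∀ x ∈ ball y d, t < ⟪x - x₀, e⟫ := fun x hx => by
    rw [mem_ball_iff_norm] at hx
    rw [hin]
    linarith [(abs_le.1 (hle x)).1]
  have hplane := h.le_comp_planeReflection hK hn he ht
  have hcomp : ∀ x ∈ closedBall y d, u x ≤ u (planeReflection x₀ e t x) := fun x hx => by
    rcases (hge x hx).lt_or_eq with h1 | h1
    · exact hplane x ⟨hball x hx, h1⟩
    · rw [planeReflection_eq_self h1.symm]
  have hzd : dist z y = d := by
    rw [dist_eq_norm, hy, sub_add_cancel_left, norm_neg, norm_smul, he, mul_one, Real.norm_eq_abs,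
      abs_of_pos hd0]
  have hzz : planeReflection x₀ e t z = z := planeReflection_eq_self (by
    rw [hz, add_sub_cancel_left, real_inner_smul_left, hee, mul_one])
  have hopf := hopf_lemma (v := fun x => u (planeReflection x₀ e t x)) hd0 hK
    (fun x hx => h.contDiffAt x (hball x hx))
    (fun x hx => h.contDiffAt_comp (planeReflection_mem_ball he ht.1.le (hball x hx) (hge x hx)))
    (fun x hx => by
      have := h.abs_mcOp_comp_sub_le he ht.1.le (hball x hx) (hge x hx)
      rwa [abs_of_nonneg (sub_nonneg.2 (hcomp x hx))] at this)
    hcomp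
    (fun x hx => h.lt_comp_planeReflection hK he ht.1 ht.2 hplane x
      ⟨hball x (ball_subset_closedBall hx), hgt x hx⟩)
    hzd (by rw [hzz])
  have hzR : z ∈ ball x₀ R := hball z hzd.le
  rw [gradient_comp_planeReflection he
    (by rw [hzz]; exact (h.contDiffAt z hzR).differentiableAt two_ne_zero), hzz, hy,
    add_sub_cancel_left, real_inner_smul_right, inner_sub_left, inner_linearReflection_left,
    linearReflection_self he, inner_neg_right] at hopf
  have := pos_of_mul_pos_right hopf hd0.le
  linarith

end BallSolution

end MovingPlanes

/-- The zero extension of a positive solution in a ball. -/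
theorem exists_ballSolution_indicator {n : ℕ} {x₀ : EuclideanSpace ℝ (Fin n)} {R : ℝ}
    (hR : 0 < R) {f : ℝ → ℝ} (hf : LocallyLipschitzOn (Ici 0) f)
    {u : EuclideanSpace ℝ (Fin n) → ℝ} (huC2 : ContDiffOn ℝ 2 u (ball x₀ R))
    (huC1 : ContDiffOn ℝ 1 u (closedBall x₀ R)) (hupos : ∀ x ∈ ball x₀ R, 0 < u x)
    (hbdry : ∀ x ∈ sphere x₀ R, u x = 0) (hu : ∀ x ∈ ball x₀ R, meanCurv u x = f (u x)) :
    ∃ G K : ℝ, 0 ≤ K ∧ BallSolution x₀ R ((ball x₀ R).indicator u) G K := by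
  have hcpt : IsCompact (closedBall x₀ R) := isCompact_closedBall x₀ R
  have huniq : UniqueDiffOn ℝ (closedBall x₀ R) :=
    uniqueDiffOn_convex (convex_closedBall x₀ R)
      ⟨x₀, ball_subset_interior_closedBall (mem_ball_self hR)⟩
  obtain ⟨G, hG⟩ := hcpt.exists_bound_of_continuousOn
    (huC1.continuousOn_fderivWithin huniq le_rfl)
  obtain ⟨M, hM⟩ := hcpt.exists_bound_of_continuousOn huC1.continuousOn
  obtain ⟨K, hK⟩ := (hf.mono
    (Icc_subset_Ici_self : Icc 0 M ⊆ Ici 0)).exists_lipschitzOnWith_of_compact isCompact_Icc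
  have hC2 : ∀ x ∈ ball x₀ R, ContDiffAt ℝ 2 u x := fun x hx =>
    huC2.contDiffAt (isOpen_ball.mem_nhds hx)
  have heq : ∀ x ∈ ball x₀ R, (ball x₀ R).indicator u =ᶠ[𝓝 x] u := fun x hx => by
    filter_upwards [isOpen_ball.mem_nhds hx] with y hy
    exact indicator_of_mem hy u
  have hgrad : ∀ x ∈ ball x₀ R, ∇ ((ball x₀ R).indicator u) =ᶠ[𝓝 x] ∇ u := fun x hx => by
    filter_upwards [(heq x hx).eventuallyEq_nhds] with y hy
    rw [gradient, gradient, hy.fderiv_eq]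
  have hop : ∀ x ∈ ball x₀ R, mcOp (∇ ((ball x₀ R).indicator u) x)
      (fderiv ℝ (∇ ((ball x₀ R).indicator u)) x) = f (u x) := fun x hx => by
    rw [(hgrad x hx).fderiv_eq, (hgrad x hx).eq_of_nhds, ← meanCurv_eq_mcOp (hC2 x hx), hu x hx]
  have hIcc : ∀ x ∈ ball x₀ R, u x ∈ Icc 0 M := fun x hx =>
    ⟨(hupos x hx).le, (le_abs_self _).trans (hM x (ball_subset_closedBall hx))⟩
  refine ⟨G, K, K.2, ?_, fun x hx => indicator_of_notMem hx u, fun x hx => ?_, fun x hx => ?_,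
    fun x hx => ?_, fun x hx y hy => ?_⟩
  · refine continuous_indicator (fun x hx => hbdry x ?_) ?_
    · rwa [frontier_ball x₀ hR.ne'] at hx
    · rw [closure_ball x₀ hR.ne']
      exact huC1.continuousOn
  · rw [indicator_of_mem hx]
    exact hupos x hx
  · exact (hC2 x hx).congr_of_eventuallyEq (heq x hx)
  · rw [(hgrad x hx).eq_of_nhds, gradient, LinearIsometryEquiv.norm_map]
    have := hG x (ball_subset_closedBall hx)
    rwa [fderivWithin_of_mem_nhds (mem_of_superset (isOpen_ball.mem_nhds hx)
      ball_subset_closedBall)] at this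
  · rw [hop x hx, hop y hy, indicator_of_mem hx, indicator_of_mem hy]
    exact hK.norm_sub_le (hIcc x hx) (hIcc y hy)

/-- Radial symmetry of positive solutions in a ball (Lemma 4.1, from
Pucci–Serrin): a positive solution of the mean curvature equation with zero Dirichlet data
in an open ball `B(x₀, R)` of `ℝⁿ` (`n ≥ 3`), with `f` locally Lipschitz on `[0,∞)`, is
radially symmetric about `x₀` and strictly radially decreasing. -/
theorem radial_symmetry_in_ball
    (n : ℕ) (hn : 3 ≤ n) (x₀ : EuclideanSpace ℝ (Fin n)) (R : ℝ) (hR : 0 < R)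
    (Ω : Set (EuclideanSpace ℝ (Fin n))) (hΩ : Ω = Metric.ball x₀ R)
    (f : ℝ → ℝ)
    (hf : ∀ a ∈ Set.Ici (0:ℝ), ∃ s ∈ nhdsWithin a (Set.Ici (0:ℝ)), ∃ K : NNReal,
      LipschitzOnWith K f s)
    (u : EuclideanSpace ℝ (Fin n) → ℝ)
    (huC2 : ContDiffOn ℝ 2 u Ω) (huC1 : ContDiffOn ℝ 1 u (closure Ω))
    (hupos : ∀ x ∈ Ω, 0 < u x)
    (hbdry : ∀ x ∈ frontier Ω, u x = 0)
    (hu : ∀ x ∈ Ω, meanCurv u x = f (u x)) :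
    ∃ w : ℝ → ℝ, (∀ x ∈ closure Ω, u x = w (dist x x₀)) ∧
      ∀ r ∈ Set.Ioo (0:ℝ) R, ∃ d : ℝ, HasDerivAt w d r ∧ d < 0 := by
  subst hΩ
  rw [closure_ball x₀ hR.ne'] at huC1 ⊢
  rw [frontier_ball x₀ hR.ne'] at hbdry
  have hf' : LocallyLipschitzOn (Ici 0) f := fun a ha => by
    obtain ⟨s, hs, K, hK⟩ := hf a ha
    exact ⟨K, s, hs, hK⟩
  obtain ⟨G, K, hK, h⟩ := exists_ballSolution_indicator hR hf' huC2 huC1 hupos hbdry hu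
  have hfin : 2 ≤ finrank ℝ (EuclideanSpace ℝ (Fin n)) := by
    rw [finrank_euclideanSpace_fin]
    omega
  have heq : ∀ x ∈ closedBall x₀ R, (ball x₀ R).indicator u x = u x := fun x hx => by
    by_cases hx' : x ∈ ball x₀ R
    · exact indicator_of_mem hx' u
    · rw [indicator_of_notMem hx']
      exact (hbdry x (le_antisymm hx (not_lt.1 hx'))).symm
  set e : EuclideanSpace ℝ (Fin n) := EuclideanSpace.single ⟨0, by omega⟩ 1
  have he : ‖e‖ = 1 := by simp [e]
  refine ⟨fun r => (ball x₀ R).indicator u (x₀ + r • e), fun x hx => ?_, fun r hr => ?_⟩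
  · rw [← heq x hx]
    refine h.eq_of_norm_sub_eq hK hfin ?_
    rw [add_sub_cancel_left, norm_smul, he, mul_one, Real.norm_eq_abs, abs_of_nonneg dist_nonneg,
      dist_eq_norm]
  · refine ⟨_, ?_, h.inner_gradient_neg hK hfin he hr⟩
    have hmem : x₀ + r • e ∈ ball x₀ R := by
      rw [mem_ball_iff_norm, add_sub_cancel_left, norm_smul, he, mul_one, Real.norm_eq_abs,
        abs_of_pos hr.1]
      exact hr.2
    have hline : HasDerivAt (fun r : ℝ => x₀ + r • e) e r := by
      simpa using ((hasDerivAt_id r).smul_const e).const_add x₀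
    rw [inner_gradient_left]
    exact ((h.contDiffAt _ hmem).differentiableAt two_ne_zero).hasFDerivAt.comp_hasDerivAt r hline
end
end
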